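/- arXiv:2402.10661 — 2 statements merged into one kernel-verified Lean document; each statement's English description precedes it below -/
import Mathlib

section
/- Let c ≥ 3/2. Then the series defining κ(c) = −2·∑_{n=1}^∞ n^{−5/3}·Ai′(2·n^{2/3}·c) converges absolutely, and there exist a real constant D, a constant M > 0 and L₀ ≥ 1 such that for every L ≥ L₀ the series ∑_{n≥1} Tr_n(L,c)/n converges absolutely and |∑_{n=1}^∞ Tr_n(L,c)/n − κ(c)·L − D| ≤ M·e^{−L}. (This is the statement that the persistence probability, whose logarithm equals −∑_{n≥1} Tr_n(L,c)/n, behaves as C·e^{−κ(c)·L + O(e^{−L})}.) -/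
open MeasureTheory

/-- The Airy function, defined by an absolutely convergent contour integral
over the vertical line `Re w = 1`. -/
noncomputable def Ai (x : ℝ) : ℝ :=
  (1 / (2 * Real.pi)) *
    ∫ t : ℝ, (Complex.exp ((1 + (t : ℂ) * Complex.I) ^ 3 / 3
      - (1 + (t : ℂ) * Complex.I) * (x : ℂ))).re

/-- The derivative of the Airy function. -/
noncomputable def Ai' (x : ℝ) : ℝ :=
  -(1 / (2 * Real.pi)) *
    ∫ t : ℝ, ((1 + (t : ℂ) * Complex.I) * Complex.exp ((1 + (t : ℂ) * Complex.I) ^ 3 / 3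
      - (1 + (t : ℂ) * Complex.I) * (x : ℂ))).re

/-- Heat kernel `G_L(u,v)`. -/
noncomputable def G (L u v : ℝ) : ℝ :=
  (4 * Real.pi * L) ^ (-(1 : ℝ) / 2) * Real.exp (-(u - v) ^ 2 / (4 * L))

/-- The kernel `E_{L,c}(u,v)` of `e^{-LΔ}B_{0,c}`. -/
noncomputable def E (L c u v : ℝ) : ℝ :=
  Real.exp (-2 * L ^ 3 / 3 - L * (u + v + 2 * c)) * Ai (L ^ 2 + u + v + 2 * c)

/-- The kernel `K_{L,c}(x,y)`. -/
noncomputable def K (L c x y : ℝ) : ℝ :=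
  (if 0 < x then Ai (x + y + 2 * c) else 0)
  + (if x ≤ 0 then ∫ z in Set.Ioi (0 : ℝ), G L x z * E L c z y else 0)
  + (if x ≤ 0 then ∫ z in Set.Iic (0 : ℝ), G L (-x) z * E L c z y else 0)

/-- `Tr n L c` is the trace `Tr_{n+1}(L,c)` of the `(n+1)`-st power of `K_{L,c}`,
given by the cyclic integral over `ℝ^{n+1}`. -/
noncomputable def Tr (n : ℕ) (L c : ℝ) : ℝ :=
  ∫ x : Fin (n + 1) → ℝ, ∏ i : Fin (n + 1), K L c (x i) (x (i + 1))

/-- The persistence exponent `κ(c) = -2 ∑_{n≥1} n^{-5/3} Ai'(2 n^{2/3} c)`. -/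
noncomputable def kappa (c : ℝ) : ℝ :=
  -2 * ∑' n : ℕ, ((n : ℝ) + 1) ^ (-(5 : ℝ) / 3) * Ai' (2 * ((n : ℝ) + 1) ^ ((2 : ℝ) / 3) * c)

namespace AiryOnePersistence

open Complex Filter Topology Set

/-- The branch of the hyperbola `Re w² = α` in the right half plane, parametrised by `Im w²`. -/
noncomputable def hyp (α s : ℝ) : ℂ := ((α : ℂ) + s * I) ^ (2⁻¹ : ℂ)

lemma hyp_sq (α s : ℝ) : hyp α s ^ 2 = α + s * I := by
  simp [hyp]

lemma hyp_re_sq_sub (α s : ℝ) : (hyp α s).re ^ 2 - (hyp α s).im ^ 2 = α := by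
  have := congrArg Complex.re (hyp_sq α s)
  simpa [pow_two] using this

lemma hyp_re_mul_im (α s : ℝ) : 2 * (hyp α s).re * (hyp α s).im = s := by
  have := congrArg Complex.im (hyp_sq α s)
  simp [pow_two] at this
  linarith

lemma hyp_re_pos {α : ℝ} (hα : 0 < α) (s : ℝ) : 0 < (hyp α s).re := by
  rw [hyp, Complex.cpow_inv_two_re]
  apply Real.sqrt_pos.2
  have := norm_nonneg ((α : ℂ) + s * I)
  simp
  positivity

lemma hyp_ne_zero {α : ℝ} (hα : 0 < α) (s : ℝ) : hyp α s ≠ 0 := by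
  intro h
  have := hyp_re_pos hα s
  simp [h] at this

lemma sqrt_le_hyp_re {α : ℝ} (hα : 0 < α) (s : ℝ) : √α ≤ (hyp α s).re := by
  apply Real.sqrt_le_iff.2 ⟨(hyp_re_pos hα s).le, ?_⟩
  nlinarith [hyp_re_sq_sub α s, sq_nonneg (hyp α s).im]

lemma le_norm_hyp {α : ℝ} (hα : 0 < α) (s : ℝ) : √α ≤ ‖hyp α s‖ :=
  (sqrt_le_hyp_re hα s).trans (Complex.re_le_norm _)

/-- `|w|² = |w²|` on the hyperbola. -/
lemma hyp_re_sq_add (α s : ℝ) :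
    ((hyp α s).re ^ 2 + (hyp α s).im ^ 2) ^ 2 = α ^ 2 + s ^ 2 := by
  have h1 := hyp_re_sq_sub α s
  have h2 := hyp_re_mul_im α s
  linear_combination ((hyp α s).re ^ 2 - (hyp α s).im ^ 2 + α) * h1
    + (2 * (hyp α s).re * (hyp α s).im + s) * h2

lemma abs_le_hyp_re_sq_add (α s : ℝ) : |s| ≤ (hyp α s).re ^ 2 + (hyp α s).im ^ 2 := by
  apply abs_le_of_sq_le_sq _ (by positivity)
  · rw [hyp_re_sq_add]; nlinarith [sq_nonneg α]
  

lemma linear_le_hyp_re_sq_add (α s : ℝ) :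
    (4 * α + 3 * |s|) / 5 ≤ (hyp α s).re ^ 2 + (hyp α s).im ^ 2 := by
  apply le_of_sq_le_sq _ (by positivity)
  rw [hyp_re_sq_add]
  nlinarith [sq_nonneg (3 * α - 4 * |s|), sq_abs s]

lemma hyp_cube_re (α s : ℝ) :
    (hyp α s ^ 3).re
      = (hyp α s).re * (2 * α - ((hyp α s).re ^ 2 + (hyp α s).im ^ 2)) := by
  have h1 := hyp_re_sq_sub α s
  simp [pow_succ]
  linear_combination 2 * (hyp α s).re * h1

lemma hasDerivAt_hyp {α : ℝ} (hα : 0 < α) (s : ℝ) :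
    HasDerivAt (hyp α) (I / (2 * hyp α s)) s := by
  have h1 : HasDerivAt (fun s : ℝ => (α : ℂ) + s * I) I s := by
    simpa using ((hasDerivAt_id s).ofReal_comp.mul_const I).const_add (α : ℂ)
  have hm : (α : ℂ) + s * I ∈ slitPlane := by
    left; simpa using hα
  have h2 := ((HasDerivAt.cpow_const (c := (2⁻¹ : ℂ)) (hasDerivAt_id _) hm).comp s h1)
  have h3 := hyp_ne_zero hα s
  have h4 : ((α : ℂ) + s * I) ≠ 0 := slitPlane_ne_zero hm
  have h5 : I / (2 * hyp α s) = 2⁻¹ * ((α : ℂ) + s * I) ^ ((2⁻¹ : ℂ) - 1) * 1 * I := by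
    have h6 : ((α : ℂ) + s * I) ^ (2⁻¹ : ℂ) = hyp α s := by rw [hyp]
    rw [Complex.cpow_sub _ _ h4, cpow_one, h6, ← hyp_sq]
    field_simp
  rw [h5]
  exact h2

lemma continuous_hyp {α : ℝ} (hα : 0 < α) : Continuous (hyp α) :=
  continuous_iff_continuousAt.2 fun s => (hasDerivAt_hyp hα s).continuousAt

lemma hyp_neg {α : ℝ} (hα : 0 < α) (s : ℝ) : hyp α (-s) = (starRingEnd ℂ) (hyp α s) := by
  have h : (α : ℂ) + s * I ∈ slitPlane := by left; simpa using hα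
  have h1 := Complex.cpow_conj ((α : ℂ) + s * I) (2⁻¹ : ℂ) (mem_slitPlane_iff_arg.1 h).1
  have h2 : (starRingEnd ℂ) (2⁻¹ : ℂ) = 2⁻¹ := by
    rw [map_inv₀, Complex.conj_ofNat]
  rw [h2] at h1
  have h3 := congrArg (starRingEnd ℂ) h1
  rw [Complex.conj_conj] at h3
  rw [hyp, hyp, h3]
  simp

lemma exists_cubic_le (p q : ℝ) : ∃ C : ℝ, ∀ u : ℝ, 0 ≤ u →
    -(1 / 3) * u ^ 3 + p * u ^ 2 + q * u ≤ C := by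
  refine ⟨16 * (|p| + q ^ 2 + 1) ^ 3 + 1, fun u hu => ?_⟩
  set P : ℝ := |p| + q ^ 2 + 1 with hP
  have hP1 : 1 ≤ P := by have := abs_nonneg p; have := sq_nonneg q; linarith
  have h1 : p * u ^ 2 + q * u ≤ P * u ^ 2 + 1 := by
    have := le_abs_self p
    have h2 : q * u ≤ q ^ 2 * u ^ 2 + 1 := by nlinarith [sq_nonneg (q * u - 1 / 2)]
    nlinarith [sq_nonneg u]
  rcases le_total u (3 * P) with h | h
  · have : P * u ^ 2 ≤ P * (3 * P) ^ 2 := by gcongr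
    have h3 : 0 ≤ u ^ 3 := by positivity
    nlinarith [pow_pos (by linarith : 0 < P) 3]
  · have : 0 ≤ u ^ 2 * (u - 3 * P) := by
      apply mul_nonneg (sq_nonneg _); linarith
    nlinarith [pow_pos (by linarith : 0 < P) 3]

/-- On the hyperbola the cubic term beats any quadratic one. -/
lemma exists_hyp_exponent_le {α : ℝ} (hα : 0 < α) (p d : ℝ) : ∃ C : ℝ, ∀ s : ℝ,
    (hyp α s ^ 3).re / 3 + p * (hyp α s).re + d * (hyp α s).re ^ 2 ≤ C - |s| / 2 := by
  obtain ⟨C, hC⟩ := exists_cubic_le (d + 1) (p + α)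
  refine ⟨C, fun s => ?_⟩
  have hX := hyp_re_pos hα s
  have h1 := hyp_re_sq_sub α s
  have h2 := abs_le_hyp_re_sq_add α s
  have h3 := hC _ hX.le
  rw [hyp_cube_re]
  set X := (hyp α s).re
  set Y := (hyp α s).im
  have h4 : Y ^ 2 = X ^ 2 - α := by linarith
  rw [h4] at h2 ⊢
  have : 0 ≤ X ^ 3 := by positivity
  nlinarith

lemma integrable_exp_neg_mul_abs {b : ℝ} (hb : 0 < b) :
    Integrable fun s : ℝ => Real.exp (-b * |s|) := by
  rw [← integrableOn_univ, ← Iic_union_Ioi (a := (0 : ℝ))]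
  refine IntegrableOn.union ?_ ?_
  · refine (integrableOn_exp_mul_Iic hb 0).congr_fun (fun s hs => ?_) measurableSet_Iic
    simp only
    rw [abs_of_nonpos hs]; ring_nf
  · refine (integrableOn_exp_mul_Ioi (neg_neg_of_pos hb) 0).congr_fun (fun s hs => ?_)
      measurableSet_Ioi
    simp only
    rw [abs_of_pos hs]

lemma integral_exp_neg_mul_abs {b : ℝ} (hb : 0 < b) :
    ∫ s : ℝ, Real.exp (-b * |s|) = 2 / b := by
  rw [integral_comp_abs (f := fun s => Real.exp (-b * s)),
    integral_exp_mul_Ioi (neg_neg_of_pos hb)]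
  simp
  ring

lemma integrable_exp_sub_abs (C : ℝ) : Integrable fun s : ℝ => Real.exp (C - |s| / 2) := by
  have h := (integrable_exp_neg_mul_abs (b := 1 / 2) (by norm_num)).const_mul (Real.exp C)
  refine h.congr (Eventually.of_forall fun s => ?_)
  simp only
  rw [← Real.exp_add]; ring_nf

/-- The exponent of the contour integral for `e^{-tΔ}` applied to the Airy function. -/
noncomputable def phase (t x : ℝ) (w : ℂ) : ℂ := w ^ 3 / 3 - t * w ^ 2 - x * w

lemma phase_re (t x : ℝ) (w : ℂ) :
    (phase t x w).re = (w ^ 3).re / 3 - t * (w.re ^ 2 - w.im ^ 2) - x * w.re := by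
  simp [phase, pow_two]

lemma cube_re (w : ℂ) : (w ^ 3).re = w.re ^ 3 - 3 * w.re * w.im ^ 2 := by
  simp [pow_succ]; ring

lemma phase_hyp_re (α t x s : ℝ) :
    (phase t x (hyp α s)).re = (hyp α s ^ 3).re / 3 - t * α - x * (hyp α s).re := by
  rw [phase_re, hyp_re_sq_sub]

lemma differentiable_phase (t x : ℝ) : Differentiable ℂ (phase t x) := by
  unfold phase; fun_prop

lemma continuous_phase (t x : ℝ) : Continuous (phase t x) := (differentiable_phase t x).continuous

lemma exists_norm_exp_phase_hyp_le {α : ℝ} (hα : 0 < α) (t x : ℝ) : ∃ C : ℝ, ∀ s : ℝ,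
    ‖hyp α s‖ * ‖exp (phase t x (hyp α s))‖ ≤ Real.exp (C - |s| / 2) ∧
    ‖exp (phase t x (hyp α s))‖ ≤ Real.exp (C - |s| / 2) := by
  obtain ⟨C, hC⟩ := exists_hyp_exponent_le hα (2 - x) 0
  refine ⟨C - t * α, fun s => ?_⟩
  have hX := hyp_re_pos hα s
  have h0 : ‖hyp α s‖ ≤ Real.exp (2 * (hyp α s).re) := by
    have h1 : ‖hyp α s‖ ≤ |(hyp α s).re| + |(hyp α s).im| := Complex.norm_le_abs_re_add_abs_im _
    have h2 : |(hyp α s).im| ≤ |(hyp α s).re| := by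
      apply sq_le_sq.1
      linarith [hyp_re_sq_sub α s]
    rw [abs_of_pos hX] at h1 h2
    linarith [Real.add_one_le_exp (2 * (hyp α s).re)]
  have h1 := hC s
  have h2 := phase_hyp_re α t x s
  constructor
  · calc ‖hyp α s‖ * ‖exp (phase t x (hyp α s))‖
        ≤ Real.exp (2 * (hyp α s).re) * ‖exp (phase t x (hyp α s))‖ := by gcongr
      _ ≤ _ := by
        rw [Complex.norm_exp, ← Real.exp_add, Real.exp_le_exp]
        linarith
  · rw [Complex.norm_exp, Real.exp_le_exp]
    linarith

lemma integrable_hyp_phase {α : ℝ} (hα : 0 < α) (t x : ℝ) {q : ℂ → ℂ} (hq : Continuous q)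
    (hq' : ∀ w, ‖q w‖ ≤ 1 + ‖w‖) :
    Integrable fun s : ℝ => q (hyp α s) * exp (phase t x (hyp α s)) := by
  obtain ⟨C, hC⟩ := exists_norm_exp_phase_hyp_le hα t x
  refine ((integrable_exp_sub_abs C).const_mul 2).mono' ?_ (Eventually.of_forall fun s => ?_)
  · have h1 := continuous_phase t x
    have h2 := continuous_hyp hα
    exact (by fun_prop : Continuous fun s : ℝ => q (hyp α s) * exp (phase t x (hyp α s))).aestronglyMeasurable
  · rw [norm_mul]
    have := (hC s).1
    have := (hC s).2
    calc _ ≤ (1 + ‖hyp α s‖) * ‖exp (phase t x (hyp α s))‖ := by gcongr; exact hq' _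
      _ ≤ _ := by linarith

lemma integrable_vertical_phase (t x : ℝ) {q : ℂ → ℂ} (hq : Continuous q)
    (hq' : ∀ w, ‖q w‖ ≤ 1 + ‖w‖) :
    Integrable fun v : ℝ => q ((1 + t : ℝ) + v * I) * exp (phase t x ((1 + t : ℝ) + v * I)) := by
  set σ : ℝ := 1 + t with hσ
  set C : ℝ := Real.exp (σ ^ 3 / 3 - t * σ ^ 2 - x * σ) with hCdef
  have hC : 0 < C := Real.exp_pos _
  have hi : Integrable fun v : ℝ => C * ((1 + |σ|) * Real.exp (-1 * v ^ 2) +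
      ‖v * Real.exp (-1 * v ^ 2)‖) := by
    refine Integrable.const_mul (Integrable.add ?_ ?_) _
    · exact (integrable_exp_neg_mul_sq one_pos).const_mul _
    · exact (integrable_mul_exp_neg_mul_sq one_pos).norm
  refine hi.mono' ?_ (Eventually.of_forall fun v => ?_)
  · have h1 := continuous_phase t x
    exact (by fun_prop : Continuous fun v : ℝ =>
      q (σ + v * I) * exp (phase t x (σ + v * I))).aestronglyMeasurable
  · rw [norm_mul, Complex.norm_exp, phase_re, cube_re]
    have hn : ‖(σ : ℂ) + v * I‖ ≤ |σ| + |v| := by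
      refine (norm_add_le _ _).trans ?_
      simp
    have he : Real.exp ((((σ : ℂ) + v * I).re ^ 3 - 3 * ((σ : ℂ) + v * I).re *
        ((σ : ℂ) + v * I).im ^ 2) / 3 - t * (((σ : ℂ) + v * I).re ^ 2 - ((σ : ℂ) + v * I).im ^ 2)
        - x * ((σ : ℂ) + v * I).re) = C * Real.exp (-1 * v ^ 2) := by
      rw [hCdef, ← Real.exp_add]
      congr 1
      simp
      rw [hσ]; ring
    rw [he, norm_mul, Real.norm_eq_abs, Real.norm_eq_abs, Real.abs_exp]
    have := hq' ((σ : ℂ) + v * I)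
    calc _ ≤ (1 + (|σ| + |v|)) * (C * Real.exp (-1 * v ^ 2)) := by gcongr; linarith
      _ = _ := by ring

/-- Between the vertical line and the hyperbola the integrand decays. -/
lemma exists_phase_re_le (α t x : ℝ) (ht : 0 ≤ t) : ∃ C : ℝ, ∀ w : ℂ, 1 + t ≤ w.re →
    w.re ^ 2 ≤ α + w.im ^ 2 → (phase t x w).re ≤ C - w.im ^ 2 / 3 := by
  obtain ⟨C, hC⟩ := exists_cubic_le (-t / 3) (2 / 3 * |α| + |x|)
  refine ⟨C, fun w h1 h2 => ?_⟩
  rw [phase_re, cube_re]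
  set u := w.re
  set y := w.im
  have hu : 0 ≤ u := by linarith
  have h3 := hC u hu
  have h4 : 0 ≤ (u - t - 1) * y ^ 2 := mul_nonneg (by linarith) (sq_nonneg _)
  have h5 : (u - t) * (u ^ 2 - α) ≤ (u - t) * y ^ 2 :=
    mul_le_mul_of_nonneg_left (by linarith) (by linarith)
  have h6 : α * (u - t) ≤ |α| * u := by
    have := le_abs_self α
    nlinarith [abs_nonneg α]
  have h7 : -x * u ≤ |x| * u := by
    have := neg_le_abs x
    nlinarith
  nlinarith

lemma exists_primitive {f : ℂ → ℂ} (hf : Differentiable ℂ f) :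
    ∃ P : ℂ → ℂ, ∀ z, HasDerivAt P (f z) z := by
  obtain ⟨P, hP⟩ := hf.isExactOn_univ
  exact ⟨P, fun z => by simpa using hP z (mem_univ z)⟩

lemma tendsto_hyp_im (α : ℝ) (hα : 0 < α) :
    Tendsto (fun s => (hyp α s).im) atTop atTop := by
  have h1 : Tendsto (fun s : ℝ => √((s - α) / 2)) atTop atTop := by
    refine Real.tendsto_sqrt_atTop.comp ?_
    exact (tendsto_atTop_add_const_right _ (-α) tendsto_id).atTop_div_const two_pos
  refine tendsto_atTop_mono' _ ?_ h1
  filter_upwards [eventually_gt_atTop 0] with s hs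
  have h2 := hyp_re_mul_im α s
  have h3 := hyp_re_pos hα s
  have h4 : 0 < (hyp α s).im := by
    by_contra h
    have : (hyp α s).re * (hyp α s).im ≤ 0 := mul_nonpos_of_nonneg_of_nonpos h3.le (not_lt.1 h)
    linarith
  apply Real.sqrt_le_iff.2 ⟨h4.le, ?_⟩
  have h5 := hyp_re_sq_sub α s
  have h6 := abs_le_hyp_re_sq_add α s
  rw [abs_of_pos hs] at h6
  linarith

lemma tendsto_linear_mul_exp (A B : ℝ) :
    Tendsto (fun u : ℝ => (A + 4 * u) * Real.exp (B - u / 3)) atTop (𝓝 0) := by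
  have h0 : Tendsto (fun u : ℝ => u / 3) atTop atTop := tendsto_id.atTop_div_const (by norm_num)
  have h1 := (Real.tendsto_pow_mul_exp_neg_atTop_nhds_zero 1).comp h0
  have h2 := (Real.tendsto_pow_mul_exp_neg_atTop_nhds_zero 0).comp h0
  have h3 := ((h2.const_mul A).add (h1.const_mul 12)).const_mul (Real.exp B)
  simp only [mul_zero, add_zero] at h3
  refine h3.congr fun u => ?_
  simp only [Function.comp, pow_zero, pow_one, sub_eq_add_neg, Real.exp_add]
  ring

lemma norm_primitive_sub_le {f P : ℂ → ℂ} (hP : ∀ z, HasDerivAt P (f z) z) {M σ X y : ℝ}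
    (hσX : σ ≤ X) (hM : ∀ u, σ ≤ u → u ≤ X → ‖f (u + y * I)‖ ≤ M) :
    ‖P (X + y * I) - P (σ + y * I)‖ ≤ M * (X - σ) := by
  have h := (convex_Icc σ X).norm_image_sub_le_of_norm_hasDerivWithin_le
    (f := fun u : ℝ => P (u + y * I)) (f' := fun u : ℝ => f (u + y * I)) (C := M)
    (x := σ) (y := X) (fun u _ => ?_) (fun u hu => hM u hu.1 hu.2) (left_mem_Icc.2 hσX)
    (right_mem_Icc.2 hσX)
  · simpa [Real.norm_eq_abs, abs_of_nonneg (sub_nonneg.2 hσX)] using h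
  · have h1 : HasDerivAt (fun u : ℂ => u + y * I) 1 (u : ℂ) := (hasDerivAt_id _).add_const _
    have h2 := ((hP ((u : ℂ) + y * I)).comp (u : ℂ) h1).comp_ofReal
    simpa using h2.hasDerivWithinAt

lemma integral_vertical_eq_integral_hyp {α t : ℝ} (hα : 0 < α) (ht : 0 ≤ t) (x : ℝ) {q : ℂ → ℂ}
    (hq : Differentiable ℂ q) (hq' : ∀ w, ‖q w‖ ≤ 1 + ‖w‖) :
    ∫ v : ℝ, q ((1 + t : ℝ) + v * I) * exp (phase t x ((1 + t : ℝ) + v * I)) =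
      ∫ s : ℝ, q (hyp α s) * exp (phase t x (hyp α s)) / (2 * hyp α s) := by
  set σ : ℝ := 1 + t with hσ
  set f : ℂ → ℂ := fun w => q w * exp (phase t x w) with hf
  have hfd : Differentiable ℂ f := hq.mul (differentiable_phase t x).cexp
  have hfc : Continuous f := hfd.continuous
  obtain ⟨P, hP⟩ := exists_primitive hfd
  have hhc := continuous_hyp hα
  have hne := fun s => hyp_ne_zero hα s
  have hgi : Integrable fun s : ℝ => f (hyp α s) / (2 * hyp α s) := by
    refine ((integrable_hyp_phase hα t x hq.continuous hq').norm.const_mul (1 / (2 * √α))).mono' ?_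
      (Eventually.of_forall fun s => ?_)
    · exact (hfc.comp hhc |>.div (by fun_prop) (fun s => by simpa using hne s)).aestronglyMeasurable
    · rw [norm_div, div_eq_inv_mul, one_div, norm_mul 2, Complex.norm_ofNat]
      have h1 : √α ≤ ‖hyp α s‖ := (sqrt_le_hyp_re hα s).trans (Complex.re_le_norm _)
      have h2 : 0 < √α := Real.sqrt_pos.2 hα
      gcongr
  have hvi : Integrable fun v : ℝ => f (σ + v * I) := integrable_vertical_phase t x hq.continuous hq'
  -- fundamental theorem of calculus along both curves
  have hB : ∀ R : ℝ, ∫ s in (-R)..R, I * (f (hyp α s) / (2 * hyp α s)) =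
      P (hyp α R) - P (hyp α (-R)) := by
    intro R
    refine intervalIntegral.integral_eq_sub_of_hasDerivAt (f := fun s => P (hyp α s)) (fun s _ => ?_)
      (hgi.const_mul I).intervalIntegrable
    have := (hP (hyp α s)).comp s (hasDerivAt_hyp hα s)
    refine this.congr_deriv ?_
    ring
  have hA : ∀ R : ℝ, ∫ v in (-R)..R, I * f (σ + v * I) =
      P (σ + R * I) - P (σ + (-R : ℝ) * I) := by
    intro R
    refine intervalIntegral.integral_eq_sub_of_hasDerivAt (f := fun v : ℝ => P (σ + v * I))
      (fun v _ => ?_) (hvi.const_mul I).intervalIntegrable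
    have h1 : HasDerivAt (fun u : ℂ => σ + u * I) I (v : ℂ) := by
      simpa using ((hasDerivAt_id (v : ℂ)).mul_const I).const_add (σ : ℂ)
    have := ((hP ((σ : ℂ) + v * I)).comp (v : ℂ) h1).comp_ofReal
    refine this.congr_deriv ?_
    ring
  have hTB := intervalIntegral_tendsto_integral (hgi.const_mul I) tendsto_neg_atTop_atBot tendsto_id
  have hTA := intervalIntegral_tendsto_integral (hvi.const_mul I)
    (tendsto_neg_atTop_atBot.comp (tendsto_hyp_im α hα)) (tendsto_hyp_im α hα)
  simp only [id, Function.comp_def, hA, hB] at hTA hTB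
  -- comparison of the end points
  obtain ⟨C, hC⟩ := exists_phase_re_le α t x ht
  have hu2 : Tendsto (fun s => (hyp α s).im ^ 2) atTop atTop :=
    (tendsto_pow_atTop two_ne_zero).comp (tendsto_hyp_im α hα)
  have hsmall := (tendsto_linear_mul_exp (1 + 3 * α) C).comp hu2
  have hev : ∀ᶠ s in atTop, ∀ y : ℝ, y ^ 2 = (hyp α s).im ^ 2 →
      ‖P ((hyp α s).re + y * I) - P (σ + y * I)‖ ≤
        (1 + 3 * α + 4 * (hyp α s).im ^ 2) * Real.exp (C - (hyp α s).im ^ 2 / 3) := by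
    filter_upwards [hu2.eventually_ge_atTop (σ ^ 2)] with s hs y hy
    have h1 := hyp_re_sq_sub α s
    have h2 := hyp_re_pos hα s
    have hσ0 : 0 < σ := by linarith
    set X := (hyp α s).re
    set Y := (hyp α s).im
    have hX : σ ≤ X := by nlinarith
    have hXy : |y| ≤ X := abs_le_of_sq_le_sq (by linarith) h2.le
    refine (norm_primitive_sub_le hP hX (M := (1 + X + |y|) * Real.exp (C - Y ^ 2 / 3))
      (fun u hu1 hu2 => ?_)).trans ?_
    · have h3 := hC (u + y * I) (by simpa using hu1) (by
        simp; nlinarith)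
      simp only [hf, norm_mul, Complex.norm_exp]
      have h4 : ‖(u : ℂ) + y * I‖ ≤ X + |y| := by
        refine (norm_add_le _ _).trans ?_
        simp only [norm_real, norm_mul, norm_I, mul_one, Real.norm_eq_abs]
        rw [abs_of_nonneg (by linarith : 0 ≤ u)]
        linarith
      have h5 := hq' ((u : ℂ) + y * I)
      have h6 : ((u : ℂ) + y * I).im ^ 2 = Y ^ 2 := by simp [hy]
      rw [h6] at h3
      gcongr
      linarith
    · have h3 : (1 + X + |y|) * (X - σ) ≤ 1 + 3 * α + 4 * Y ^ 2 := by
        nlinarith [abs_nonneg y, sq_nonneg (X - 1)]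
      calc _ = (1 + X + |y|) * (X - σ) * Real.exp (C - Y ^ 2 / 3) := by ring
        _ ≤ _ := by gcongr
  have hd1 : Tendsto (fun s => P (hyp α s) - P (σ + (hyp α s).im * I)) atTop (𝓝 0) := by
    refine squeeze_zero_norm' ?_ hsmall
    filter_upwards [hev] with s hs
    simpa [Complex.re_add_im] using hs _ rfl
  have hd2 : Tendsto (fun s => P (hyp α (-s)) - P (σ + (-(hyp α s).im : ℝ) * I)) atTop (𝓝 0) := by
    refine squeeze_zero_norm' ?_ hsmall
    filter_upwards [hev] with s hs
    have h1 : hyp α (-s) = (hyp α s).re + (-(hyp α s).im : ℝ) * I := by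
      rw [hyp_neg hα]
      apply Complex.ext <;> simp
    rw [h1]
    exact hs _ (by ring)
  have hfin := (hTB.sub hTA).sub (hd1.sub hd2)
  have h0 : (∫ s, I * (f (hyp α s) / (2 * hyp α s))) - (∫ v : ℝ, I * f (σ + v * I)) - (0 - 0) = 0 := by
    refine tendsto_nhds_unique hfin ?_
    refine tendsto_const_nhds.congr fun s => ?_
    ring
  rw [integral_const_mul, integral_const_mul, sub_zero, sub_zero, ← mul_sub] at h0
  have := (mul_eq_zero.1 h0).resolve_left I_ne_zero
  exact (sub_eq_zero.1 this).symm

lemma ofReal_integral_re_of_conj {Z : ℝ → ℂ} (hZ : Integrable Z)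
    (h : ∀ s, Z (-s) = (starRingEnd ℂ) (Z s)) : ((∫ s, (Z s).re : ℝ) : ℂ) = ∫ s, Z s := by
  have h1 : (starRingEnd ℂ) (∫ s, Z s) = ∫ s, Z s := by
    rw [← integral_conj, ← integral_neg_eq_self]
    simp [h]
  have h2 : ∫ s, (Z s).re = (∫ s, Z s).re := by
    simpa using reCLM.integral_comp_comm hZ
  rw [h2]
  exact (Complex.conj_eq_iff_re).1 h1

lemma phase_conj (t x : ℝ) (w : ℂ) : phase t x ((starRingEnd ℂ) w) = (starRingEnd ℂ) (phase t x w) := by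
  simp [phase, map_ofNat]

/-- `exp (-2 t³ / 3 - t x) * Ai (t² + x)`, the kernel of the backward heat flow applied to `Ai`. -/
noncomputable def heatAi (t x : ℝ) : ℝ := Real.exp (-2 * t ^ 3 / 3 - t * x) * Ai (t ^ 2 + x)

lemma phase_shift (t x : ℝ) (w : ℂ) : phase t x (w + t) =
    w ^ 3 / 3 - w * ((t ^ 2 + x : ℝ) : ℂ) + ((-2 * t ^ 3 / 3 - t * x : ℝ) : ℂ) := by
  simp only [phase]; push_cast; ring

lemma integral_re_vertical {α t : ℝ} (hα : 0 < α) (ht : 0 ≤ t) (x : ℝ) {q : ℂ → ℂ}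
    (hq : Differentiable ℂ q) (hq' : ∀ w, ‖q w‖ ≤ 1 + ‖w‖)
    (hqc : ∀ w, q ((starRingEnd ℂ) w) = (starRingEnd ℂ) (q w)) :
    ((∫ v : ℝ, (q ((1 + t : ℝ) + v * I) * exp (phase t x ((1 + t : ℝ) + v * I))).re : ℝ) : ℂ) =
      ∫ s : ℝ, q (hyp α s) * exp (phase t x (hyp α s)) / (2 * hyp α s) := by
  rw [← integral_vertical_eq_integral_hyp hα ht x hq hq']
  refine ofReal_integral_re_of_conj (integrable_vertical_phase t x hq.continuous hq') fun s => ?_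
  have : (((1 + t : ℝ) : ℂ) + ((-s : ℝ) : ℂ) * I) = (starRingEnd ℂ) (((1 + t : ℝ) : ℂ) + s * I) := by
    simp
  rw [this, phase_conj, hqc, exp_conj, map_mul]

lemma ofReal_heatAi {α t : ℝ} (hα : 0 < α) (ht : 0 ≤ t) (x : ℝ) :
    (heatAi t x : ℂ) = (1 / (2 * Real.pi)) * ∫ s : ℝ, exp (phase t x (hyp α s)) / (2 * hyp α s) := by
  have h := integral_re_vertical hα ht x (q := fun _ => 1) (differentiable_const _)
    (fun w => by simp) (fun w => by simp)
  simp only [one_mul] at h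
  rw [← h, heatAi, Ai, ← mul_assoc, mul_comm (Real.exp _), mul_assoc, ← integral_const_mul]
  push_cast
  congr 3
  funext v
  have : ((1 + t : ℝ) : ℂ) + v * I = (1 + v * I) + t := by push_cast; ring
  rw [← ofReal_one, ← ofReal_add, this, phase_shift, Complex.exp_add, mul_comm (exp _), ← ofReal_exp, re_ofReal_mul]
  simp

lemma ofReal_Ai' {α : ℝ} (hα : 0 < α) (x : ℝ) :
    (Ai' x : ℂ) = -(1 / (2 * Real.pi)) * ∫ s : ℝ, exp (phase 0 x (hyp α s)) / 2 := by
  have h := integral_re_vertical hα le_rfl x (q := fun w => w) differentiable_id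
    (fun w => by simp) (fun w => rfl)
  have h2 : ∀ s, exp (phase 0 x (hyp α s)) / 2 =
      hyp α s * exp (phase 0 x (hyp α s)) / (2 * hyp α s) := fun s => by
    have := hyp_ne_zero hα s
    field_simp
  simp only [h2]
  rw [← h, Ai']
  push_cast
  congr 3
  funext v
  simp [phase, mul_comm (x : ℂ)]

/-- The complementary error function, up to normalization. -/
noncomputable def erfcInt (ζ : ℂ) : ℂ := ∫ q in Ioi (0 : ℝ), exp (-(q + ζ) ^ 2)

lemma neg_sq_re (z : ℂ) : (-z ^ 2).re = z.im ^ 2 - z.re ^ 2 := by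
  simp [pow_two]

lemma norm_exp_neg_sq (q : ℝ) (ζ : ℂ) :
    ‖exp (-(q + ζ) ^ 2)‖ = Real.exp (ζ.im ^ 2 - (q + ζ.re) ^ 2) := by
  rw [norm_exp, neg_sq_re]; simp

lemma integrable_exp_neg_add_sq (ζ : ℂ) : Integrable fun q : ℝ => exp (-(q + ζ) ^ 2) := by
  have h := integrable_cexp_quadratic' (b := -1) (by simp) (-2 * ζ) (-ζ ^ 2)
  refine h.congr (Eventually.of_forall fun q => ?_)
  simp only
  congr 1; ring

lemma norm_erfcInt_le {ζ : ℂ} (h : 0 ≤ ζ.re) :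
    ‖erfcInt ζ‖ ≤ Real.exp (ζ.im ^ 2 - ζ.re ^ 2) * (√Real.pi / 2) := by
  have hg : ∫ q in Ioi (0 : ℝ), Real.exp (-1 * q ^ 2) = √Real.pi / 2 := by
    simpa using integral_gaussian_Ioi 1
  rw [← hg, ← integral_const_mul, erfcInt]
  refine norm_integral_le_of_norm_le ?_ ?_
  · exact ((integrable_exp_neg_mul_sq one_pos).const_mul _).integrableOn
  · refine (ae_restrict_mem measurableSet_Ioi).mono fun q hq => ?_
    rw [norm_exp_neg_sq, ← Real.exp_add, Real.exp_le_exp]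
    have : (0 : ℝ) < q := hq
    nlinarith [mul_nonneg this.le h]

lemma hasDerivAt_erfcInt (ζ : ℂ) : HasDerivAt erfcInt (-exp (-ζ ^ 2)) ζ := by
  obtain ⟨Q, hQ⟩ := exists_primitive (f := fun z : ℂ => exp (-z ^ 2)) (by fun_prop)
  have h1 : ∀ ζ : ℂ, Tendsto (fun R : ℝ => Q (R + ζ)) atTop (𝓝 (erfcInt ζ + Q ζ)) := by
    intro ζ
    have h2 := intervalIntegral_tendsto_integral_Ioi 0
      (integrable_exp_neg_add_sq ζ).integrableOn tendsto_id
    have h3 : ∀ R : ℝ, ∫ q in (0 : ℝ)..R, exp (-((q : ℂ) + ζ) ^ 2) = Q (R + ζ) - Q ζ := by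
      intro R
      rw [intervalIntegral.integral_eq_sub_of_hasDerivAt (f := fun q : ℝ => Q (q + ζ))
        (fun q _ => ?_) (integrable_exp_neg_add_sq ζ).intervalIntegrable]
      · simp
      · have h1 : HasDerivAt (fun u : ℂ => u + ζ) 1 (q : ℂ) := (hasDerivAt_id _).add_const _
        have h2 := ((hQ ((q : ℂ) + ζ)).comp (q : ℂ) h1).comp_ofReal
        simpa using h2
    simp only [id, h3] at h2
    have := h2.add_const (Q ζ)
    simpa [erfcInt] using this
  have h2 : ∀ ζ : ℂ, erfcInt ζ + Q ζ = erfcInt 0 + Q 0 := by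
    intro ζ
    have h3 := (h1 ζ).sub (h1 0)
    refine sub_eq_zero.1 (tendsto_nhds_unique h3 ?_)
    have hlim : Tendsto (fun R : ℝ => Real.exp (‖ζ‖ ^ 2 - (R - ‖ζ‖)) * ‖ζ‖) atTop (𝓝 0) := by
      have : Tendsto (fun R : ℝ => ‖ζ‖ ^ 2 - (R - ‖ζ‖)) atTop atBot :=
        tendsto_const_nhds.add_atBot (tendsto_neg_atTop_atBot.comp
          (tendsto_atTop_add_const_right _ (-‖ζ‖) tendsto_id))
      simpa using (Real.tendsto_exp_atBot.comp this).mul_const ‖ζ‖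
    refine squeeze_zero_norm' ?_ hlim
    filter_upwards [eventually_ge_atTop (‖ζ‖ + 1)] with R hR
    have := (convex_closedBall (R : ℂ) ‖ζ‖).norm_image_sub_le_of_norm_hasDerivWithin_le
      (f := Q) (f' := fun z => exp (-z ^ 2)) (x := R) (y := R + ζ)
      (C := Real.exp (‖ζ‖ ^ 2 - (R - ‖ζ‖))) (fun z _ => (hQ z).hasDerivWithinAt) (fun z hz => ?_)
      (by simp) (by simp)
    · simpa using this
    · rw [norm_exp, neg_sq_re, Real.exp_le_exp]
      have h4 : ‖z - R‖ ≤ ‖ζ‖ := by simpa [dist_eq_norm] using hz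
      have h5 := (abs_re_le_norm (z - R)).trans h4
      have h6 := (abs_im_le_norm (z - R)).trans h4
      simp only [sub_re, ofReal_re, sub_im, ofReal_im, sub_zero] at h5 h6
      have h7 := abs_le.1 h5
      have h8 : z.im ^ 2 ≤ ‖ζ‖ ^ 2 := sq_le_sq.2 (by simpa using h6)
      have h9 : R - ‖ζ‖ ≤ z.re := by linarith
      nlinarith
  have h3 : erfcInt = fun ζ => erfcInt 0 + Q 0 - Q ζ := by
    funext ζ
    rw [← h2 ζ]; ring
  rw [h3]
  exact (hQ ζ).const_sub _

lemma erfcInt_add_neg (ζ : ℂ) : erfcInt ζ + erfcInt (-ζ) = √Real.pi := by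
  have h1 : ∀ z, HasDerivAt (fun ζ => erfcInt ζ + erfcInt (-ζ)) 0 z := by
    intro z
    have h2 := (hasDerivAt_erfcInt (-z)).comp z (hasDerivAt_neg z)
    convert! (hasDerivAt_erfcInt z).add h2 using 1
    ring_nf
  have h2 := is_const_of_deriv_eq_zero (fun z => (h1 z).differentiableAt) (fun z => (h1 z).deriv) ζ 0
  have h3 : erfcInt 0 = (√Real.pi / 2 : ℝ) := by
    rw [erfcInt]
    have := integral_gaussian_Ioi 1
    rw [div_one] at this
    rw [← this]
    refine Eq.trans ?_ integral_complex_ofReal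
    simp
  simp only [neg_zero, h3] at h2
  rw [h2]
  push_cast; ring

/-- The centred heat kernel at time `t`. -/
noncomputable def gauss (t z : ℝ) : ℝ := (√(4 * Real.pi * t))⁻¹ * Real.exp (-z ^ 2 / (4 * t))

/-- The density of the first passage time of Brownian motion (with generator `∂²`) at distance `r`. -/
noncomputable def hit (r t : ℝ) : ℝ := r / t * gauss t r

lemma gauss_nonneg (t z : ℝ) : 0 ≤ gauss t z := by unfold gauss; positivity

lemma hit_nonneg {r t : ℝ} (hr : 0 ≤ r) (ht : 0 ≤ t) : 0 ≤ hit r t :=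
  mul_nonneg (div_nonneg hr ht) (gauss_nonneg t r)

@[fun_prop]
lemma measurable_gauss : Measurable (Function.uncurry gauss) := by
  unfold gauss Function.uncurry; fun_prop

lemma measurable_hit : Measurable (Function.uncurry hit) := by
  unfold hit
  have := measurable_gauss.comp measurable_swap
  exact (measurable_fst.div measurable_snd).mul this

/-- The antiderivative in `t` of `hit r t * exp (-t * w ^ 2)`. -/
noncomputable def passage (r : ℝ) (w : ℂ) (t : ℝ) : ℂ :=
  (√Real.pi)⁻¹ * (exp (r * w) * erfcInt ((r / (2 * √t) : ℝ) + w * √t) +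
    exp (-(r * w)) * erfcInt ((r / (2 * √t) : ℝ) - w * √t))

lemma hasDerivAt_passage (r : ℝ) (w : ℂ) {t : ℝ} (ht : 0 < t) :
    HasDerivAt (passage r w) (hit r t * exp (-t * w ^ 2)) t := by
  have hs : 0 < √t := Real.sqrt_pos.2 ht
  have hst : √t ^ 2 = t := Real.sq_sqrt ht.le
  have h1 : HasDerivAt (fun t : ℝ => ((√t : ℝ) : ℂ)) ((1 / (2 * √t) : ℝ) : ℂ) t :=
    (Real.hasDerivAt_sqrt ht.ne').ofReal_comp
  have h2 : HasDerivAt (fun t : ℝ => ((r / (2 * √t) : ℝ) : ℂ)) ((-r / (4 * t * √t) : ℝ) : ℂ) t := by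
    apply HasDerivAt.ofReal_comp
    have := (((Real.hasDerivAt_sqrt ht.ne').const_mul 2).inv (by positivity)).const_mul r
    refine this.congr_deriv ?_
    rw [← hst, Real.sqrt_sq hs.le]
    field_simp
    ring
  have h3 : ∀ v : ℂ, v ^ 2 = w ^ 2 → HasDerivAt
      (fun t : ℝ => exp (r * v) * erfcInt ((r / (2 * √t) : ℝ) + v * √t))
      (exp (-(r ^ 2 / (4 * t) : ℝ)) * exp (-t * w ^ 2) *
        ((r / (4 * t * √t) : ℝ) - v * (1 / (2 * √t) : ℝ))) t := by
    intro v hv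
    have h4 := (hasDerivAt_erfcInt ((r / (2 * √t) : ℝ) + v * √t)).comp t (h2.add (h1.const_mul v))
    refine (h4.const_mul (exp (r * v))).congr_deriv ?_
    have h5 : -(((r / (2 * √t) : ℝ) : ℂ) + v * √t) ^ 2 =
        -(r ^ 2 / (4 * t) : ℝ) + -t * w ^ 2 + -(r * v) := by
      rw [← hv]
      have : ((√t : ℝ) : ℂ) ≠ 0 := by exact_mod_cast hs.ne'
      have h6 : (t : ℂ) = (√t : ℂ) ^ 2 := by exact_mod_cast hst.symm
      push_cast
      rw [h6]
      field_simp
      ring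
    rw [h5, Complex.exp_add, Complex.exp_add, Complex.exp_neg (r * v)]
    have h7 := Complex.exp_ne_zero (r * v)
    field_simp
    push_cast
    ring
  have h4 := ((h3 w rfl).add (h3 (-w) (by ring))).const_mul (((√Real.pi)⁻¹ : ℝ) : ℂ)
  unfold passage
  convert! h4 using 1
  · funext t
    simp [sub_eq_add_neg]
  · have h5 : √(4 * Real.pi * t) = 2 * √Real.pi * √t := by
      rw [Real.sqrt_mul (by positivity), Real.sqrt_mul (by norm_num)]
      congr 2
      rw [show (4 : ℝ) = 2 ^ 2 by norm_num, Real.sqrt_sq (by norm_num)]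
    rw [hit, gauss, h5, neg_div]
    have hp : ((√Real.pi : ℝ) : ℂ) ≠ 0 := by exact_mod_cast (Real.sqrt_pos.2 Real.pi_pos).ne'
    have : ((√t : ℝ) : ℂ) ≠ 0 := by exact_mod_cast hs.ne'
    have htc : (t : ℂ) ≠ 0 := by exact_mod_cast ht.ne'
    push_cast
    field_simp
    ring

lemma erfcInt_arg_re {r : ℝ} (w : ℂ) (t : ℝ) :
    (((r / (2 * √t) : ℝ) : ℂ) + w * √t).re = r / (2 * √t) + w.re * √t ∧
    (((r / (2 * √t) : ℝ) : ℂ) + w * √t).im = w.im * √t := by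
  simp [-ofReal_div]

lemma tendsto_passage_zero {r : ℝ} (hr : 0 < r) (w : ℂ) :
    Tendsto (passage r w) (𝓝[>] 0) (𝓝 0) := by
  have hs : Tendsto (fun t : ℝ => √t) (𝓝[>] 0) (𝓝[>] 0) := by
    refine tendsto_nhdsWithin_iff.2 ⟨?_, ?_⟩
    · have := (Real.continuous_sqrt.tendsto 0).mono_left (nhdsWithin_le_nhds (s := Ioi 0))
      simpa using this
    · filter_upwards [self_mem_nhdsWithin] with t ht using Real.sqrt_pos.2 ht
  have hs0 := hs.mono_right nhdsWithin_le_nhds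
  have h1 : Tendsto (fun t : ℝ => r / (2 * √t)) (𝓝[>] 0) atTop := by
    have := (tendsto_inv_nhdsGT_zero.comp hs).const_mul_atTop (half_pos hr)
    refine this.congr fun t => ?_
    simp only [Function.comp]
    rw [div_mul_eq_div_div, div_eq_mul_inv (r / 2)]
  have h2 : ∀ v : ℂ, Tendsto (fun t : ℝ => erfcInt ((r / (2 * √t) : ℝ) + v * √t)) (𝓝[>] 0) (𝓝 0) := by
    intro v
    have h3 : Tendsto (fun t : ℝ => r / (2 * √t) + v.re * √t) (𝓝[>] 0) atTop := by
      exact h1.atTop_add (hs0.const_mul v.re)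
    have h4 : Tendsto (fun t : ℝ => (v.im * √t) ^ 2 - (r / (2 * √t) + v.re * √t) ^ 2) (𝓝[>] 0)
        atBot := by
      have := ((hs0.const_mul v.im).pow 2).add_atBot
        (tendsto_neg_atTop_atBot.comp ((tendsto_pow_atTop two_ne_zero).comp h3))
      simpa [sub_eq_add_neg] using this
    have h5 := (Real.tendsto_exp_atBot.comp h4).mul_const (√Real.pi / 2)
    rw [zero_mul] at h5
    refine squeeze_zero_norm' ?_ h5
    filter_upwards [h3.eventually_ge_atTop 0] with t ht
    obtain ⟨h6, h7⟩ := erfcInt_arg_re (r := r) v t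
    have := norm_erfcInt_le (ζ := ((r / (2 * √t) : ℝ) : ℂ) + v * √t) (by rw [h6]; exact ht)
    rwa [h6, h7] at this
  have h3 := (((h2 w).const_mul (exp (r * w))).add
    ((h2 (-w)).const_mul (exp (-(r * w))))).const_mul (((√Real.pi)⁻¹ : ℝ) : ℂ)
  simp only [mul_zero, add_zero] at h3
  refine h3.congr fun t => ?_
  simp [passage, sub_eq_add_neg]

lemma tendsto_sqrt_mul_erfc {r : ℝ} {w : ℂ} (hw : 0 < w.re) (hw2 : 0 < (w ^ 2).re) :
    Tendsto (fun t : ℝ => erfcInt ((r / (2 * √t) : ℝ) + w * √t)) atTop (𝓝 0) := by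
  have hs := Real.tendsto_sqrt_atTop
  have h1 : Tendsto (fun t : ℝ => r / (2 * √t)) atTop (𝓝 0) :=
    tendsto_const_nhds.div_atTop (hs.const_mul_atTop two_pos)
  have h3 : Tendsto (fun t : ℝ => r / (2 * √t) + w.re * √t) atTop atTop :=
    h1.add_atTop (hs.const_mul_atTop hw)
  have h4 : Tendsto (fun t : ℝ => (w.im * √t) ^ 2 - (r / (2 * √t) + w.re * √t) ^ 2) atTop atBot := by
    have h5 : Tendsto (fun t : ℝ => -((r / (2 * √t)) ^ 2) - r * w.re - t * (w ^ 2).re) atTop atBot := by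
      have h6 : Tendsto (fun t : ℝ => -((r / (2 * √t)) ^ 2) - r * w.re) atTop (𝓝 (-0 ^ 2 - r * w.re)) :=
        ((h1.pow 2).neg).sub_const _
      have h7 := h6.add_atBot (tendsto_neg_atTop_atBot.comp (tendsto_id.atTop_mul_const hw2))
      refine h7.congr fun t => ?_
      simp [sub_eq_add_neg]
    refine h5.congr' ?_
    filter_upwards [eventually_gt_atTop 0] with t ht
    have hs : 0 < √t := Real.sqrt_pos.2 ht
    have hst : √t ^ 2 = t := Real.sq_sqrt ht.le
    have h8 : (w ^ 2).re = w.re ^ 2 - w.im ^ 2 := by simp [pow_two]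
    rw [h8]
    have h9 : r / (2 * √t) * √t = r / 2 := by field_simp
    calc _ = -((r / (2 * √t)) ^ 2) - 2 * w.re * (r / 2) - t * (w.re ^ 2 - w.im ^ 2) := by ring
      _ = _ := by rw [← h9, ← hst, Real.sqrt_sq hs.le]; ring
  have h5 := (Real.tendsto_exp_atBot.comp h4).mul_const (√Real.pi / 2)
  rw [zero_mul] at h5
  refine squeeze_zero_norm' ?_ h5
  filter_upwards [h3.eventually_ge_atTop 0] with t ht
  obtain ⟨h6, h7⟩ := erfcInt_arg_re (r := r) w t
  have := norm_erfcInt_le (ζ := ((r / (2 * √t) : ℝ) : ℂ) + w * √t) (by rw [h6]; exact ht)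
  rwa [h6, h7] at this

lemma sqrt_pi_ne_zero : ((√Real.pi : ℝ) : ℂ) ≠ 0 := by
  exact_mod_cast (Real.sqrt_pos.2 Real.pi_pos).ne'

lemma tendsto_passage_atTop {r : ℝ} {w : ℂ} (hw : 0 < w.re) (hw2 : 0 < (w ^ 2).re) :
    Tendsto (passage r w) atTop (𝓝 (exp (-(r * w)))) := by
  have h1 := tendsto_sqrt_mul_erfc (r := r) hw hw2
  have h2 := tendsto_sqrt_mul_erfc (r := -r) hw hw2
  have h3 := ((h1.const_mul (exp (r * w))).add
    ((h2.const_sub (√Real.pi : ℂ)).const_mul (exp (-(r * w))))).const_mul (((√Real.pi)⁻¹ : ℝ) : ℂ)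
  have h4 : ((√Real.pi)⁻¹ : ℝ) * (exp (r * w) * 0 + exp (-(r * w)) * (√Real.pi - 0)) =
      exp (-(r * w)) := by
    have := sqrt_pi_ne_zero
    push_cast; field_simp; ring
  rw [h4] at h3
  refine h3.congr fun t => ?_
  rw [passage, ← erfcInt_add_neg (((-r / (2 * √t) : ℝ) : ℂ) + w * √t), add_sub_cancel_left]
  push_cast
  congr 4
  ring

lemma tendsto_passage_atTop_zero (r : ℝ) : Tendsto (passage r 0) atTop (𝓝 1) := by
  have h1 : Tendsto (fun t : ℝ => ((r / (2 * √t) : ℝ) : ℂ)) atTop (𝓝 0) := by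
    have : Tendsto (fun t : ℝ => r / (2 * √t)) atTop (𝓝 0) :=
      tendsto_const_nhds.div_atTop (Real.tendsto_sqrt_atTop.const_mul_atTop two_pos)
    exact_mod_cast (continuous_ofReal.tendsto 0).comp this
  have h2 := ((hasDerivAt_erfcInt 0).continuousAt.tendsto.comp h1).const_mul
    ((2 * (√Real.pi)⁻¹ : ℝ) : ℂ)
  have h3 : ((2 * (√Real.pi)⁻¹ : ℝ) : ℂ) * erfcInt 0 = 1 := by
    have h4 := erfcInt_add_neg 0
    rw [neg_zero] at h4
    have := sqrt_pi_ne_zero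
    push_cast
    rw [mul_right_comm, two_mul, h4]
    field_simp
  rw [h3] at h2
  refine h2.congr fun t => ?_
  simp [passage]
  ring

lemma hit_mass {r : ℝ} (hr : 0 < r) :
    IntegrableOn (hit r) (Ioi 0) ∧ ∫ t in Ioi 0, hit r t = 1 := by
  set g : ℝ → ℝ := fun t => if t ≤ 0 then 0 else (passage r 0 t).re with hg
  have hev : ∀ t : ℝ, 0 < t → g =ᶠ[𝓝 t] fun t => (passage r 0 t).re := fun t ht => by
    filter_upwards [eventually_gt_nhds ht] with u hu
    simp [hg, not_le.2 hu]
  have h1 : ∀ t ∈ Ioi (0 : ℝ), HasDerivAt g (hit r t) t := by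
    intro t ht
    have h2 := hasDerivAt_passage r 0 (t := t) ht
    have h3 : HasDerivAt (fun t => (passage r 0 t).re) (hit r t) t := by
      have := reCLM.hasFDerivAt.comp_hasDerivAt t h2
      simpa [Function.comp_def] using this
    exact h3.congr_of_eventuallyEq (hev t ht)
  have h2 : ContinuousWithinAt g (Ici 0) 0 := by
    rw [← continuousWithinAt_Ioi_iff_Ici]
    have h3 := (continuous_re.tendsto 0).comp (tendsto_passage_zero hr 0)
    have h4 : g 0 = 0 := by simp [hg]
    rw [ContinuousWithinAt, h4]
    refine (h3.congr' ?_)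
    filter_upwards [self_mem_nhdsWithin] with t ht
    simp [hg, not_le.2 (show (0 : ℝ) < t from ht)]
  have h3 : Tendsto g atTop (𝓝 1) := by
    have h4 := (continuous_re.tendsto 1).comp (tendsto_passage_atTop_zero r)
    refine h4.congr' ?_
    filter_upwards [eventually_gt_atTop 0] with t ht
    simp [hg, not_le.2 ht]
  have h4 : ∀ t ∈ Ioi (0 : ℝ), 0 ≤ hit r t := fun t ht => hit_nonneg hr.le (le_of_lt ht)
  refine ⟨integrableOn_Ioi_deriv_of_nonneg h2 h1 h4 h3, ?_⟩
  rw [integral_Ioi_of_hasDerivAt_of_nonneg h2 h1 h4 h3]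
  simp [hg]

lemma integrableOn_hit {r : ℝ} (hr : 0 < r) : IntegrableOn (hit r) (Ioi 0) := (hit_mass hr).1

lemma integral_hit {r : ℝ} (hr : 0 < r) : ∫ t in Ioi 0, hit r t = 1 := (hit_mass hr).2

lemma integrableOn_hit_mul_exp {r : ℝ} (hr : 0 < r) {w : ℂ} (hw2 : 0 ≤ (w ^ 2).re) :
    IntegrableOn (fun t : ℝ => (hit r t : ℂ) * exp (-t * w ^ 2)) (Ioi 0) := by
  have h := (integrableOn_hit hr).ofReal (𝕜 := ℂ)
  refine h.mono (h.aestronglyMeasurable.mul (Continuous.aestronglyMeasurable (by fun_prop))) ?_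
  refine (ae_restrict_mem measurableSet_Ioi).mono fun t ht => ?_
  have ht' : (0 : ℝ) < t := ht
  rw [norm_mul]
  refine mul_le_of_le_one_right (norm_nonneg _) ?_
  rw [norm_exp, Real.exp_le_one_iff]
  simp only [neg_mul, neg_re, re_ofReal_mul]
  have := mul_nonneg ht'.le hw2
  linarith

lemma integrableOn_hit_mul_exp_Ioc {r L : ℝ} (hr : 0 < r) (w : ℂ) :
    IntegrableOn (fun t : ℝ => (hit r t : ℂ) * exp (-t * w ^ 2)) (Ioc 0 L) := by
  have h := ((integrableOn_hit hr).mono_set Ioc_subset_Ioi_self).ofReal (𝕜 := ℂ) (μ := volume.restrict (Ioc 0 L))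
  refine (h.const_mul (Real.exp (L * ‖w ^ 2‖) : ℂ)).mono
    (h.aestronglyMeasurable.mul (Continuous.aestronglyMeasurable (by fun_prop))) ?_
  refine (ae_restrict_mem measurableSet_Ioc).mono fun t ht => ?_
  have ht' : (0 : ℝ) < t := ht.1
  rw [norm_mul, norm_mul, mul_comm]
  refine mul_le_mul_of_nonneg_right ?_ (norm_nonneg _)
  rw [norm_exp, norm_real, Real.norm_eq_abs, Real.abs_exp, Real.exp_le_exp]
  refine (re_le_norm _).trans ?_
  rw [norm_mul, norm_neg, norm_real, Real.norm_eq_abs, abs_of_pos ht']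
  exact mul_le_mul_of_nonneg_right ht.2 (norm_nonneg _)

lemma integral_hit_mul_exp_Ioc_eq_passage {r L : ℝ} (hr : 0 < r) (hL : 0 < L) (w : ℂ) :
    ∫ t in Ioc 0 L, (hit r t : ℂ) * exp (-t * w ^ 2) = passage r w L := by
  rw [← intervalIntegral.integral_of_le hL.le,
    intervalIntegral.integral_eq_sub_of_hasDerivAt_of_tendsto hL
      (fun t ht => hasDerivAt_passage r w ht.1) ?_ (tendsto_passage_zero hr w)
      ((hasDerivAt_passage r w hL).continuousAt.tendsto.mono_left nhdsWithin_le_nhds), sub_zero]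
  rw [intervalIntegrable_iff, uIoc_of_le hL.le]
  exact integrableOn_hit_mul_exp_Ioc hr w

/-- The Laplace transform of the first passage time. -/
lemma integral_hit_mul_exp {r : ℝ} (hr : 0 < r) {w : ℂ} (hw : 0 < w.re) (hw2 : 0 < (w ^ 2).re) :
    ∫ t in Ioi 0, (hit r t : ℂ) * exp (-t * w ^ 2) = exp (-(r * w)) := by
  have h1 := intervalIntegral_tendsto_integral_Ioi 0 (integrableOn_hit_mul_exp hr hw2.le) tendsto_id
  refine tendsto_nhds_unique h1 ((tendsto_passage_atTop (r := r) hw hw2).congr' ?_)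
  filter_upwards [eventually_gt_atTop 0] with L hL
  rw [id, intervalIntegral.integral_of_le hL.le, integral_hit_mul_exp_Ioc_eq_passage hr hL]

lemma gauss_mul_exp (r : ℝ) (w : ℂ) {L : ℝ} (hL : 0 < L) (z : ℝ) :
    exp (-L * w ^ 2) * ((gauss L (r + z) : ℂ) * exp (-(w * z))) =
      (√(4 * Real.pi * L))⁻¹ * exp (r * w) *
        exp (-(((1 / (2 * √L) * z : ℝ) : ℂ) + ((r / (2 * √L) : ℝ) + w * √L)) ^ 2) := by
  have hs : 0 < √L := Real.sqrt_pos.2 hL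
  have hsc : ((√L : ℝ) : ℂ) ≠ 0 := by exact_mod_cast hs.ne'
  have h6 : (L : ℂ) = (√L : ℂ) ^ 2 := by exact_mod_cast (Real.sq_sqrt hL.le).symm
  have : exp (r * w) * exp (-(((1 / (2 * √L) * z : ℝ) : ℂ) + ((r / (2 * √L) : ℝ) + w * √L)) ^ 2) =
      exp (-L * w ^ 2) * (exp ((-(r + z) ^ 2 / (4 * L) : ℝ) : ℂ) * exp (-(w * z))) := by
    rw [← Complex.exp_add, ← Complex.exp_add, ← Complex.exp_add]
    congr 1
    push_cast
    rw [h6]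
    field_simp
    ring
  rw [mul_assoc, this, gauss, ofReal_mul, ← ofReal_exp]
  push_cast
  ring

lemma integral_gauss_mul_exp (r : ℝ) (w : ℂ) {L : ℝ} (hL : 0 < L) :
    ∫ z in Ioi (0 : ℝ), exp (-L * w ^ 2) * ((gauss L (r + z) : ℂ) * exp (-(w * z))) =
      (√Real.pi)⁻¹ * (exp (r * w) * erfcInt ((r / (2 * √L) : ℝ) + w * √L)) := by
  have hs : 0 < √L := Real.sqrt_pos.2 hL
  simp_rw [gauss_mul_exp r w hL]
  rw [integral_const_mul]
  have := integral_comp_mul_left_Ioi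
    (fun u : ℝ => exp (-((u : ℂ) + ((r / (2 * √L) : ℝ) + w * √L)) ^ 2)) 0
    (b := 1 / (2 * √L)) (by positivity)
  rw [this, mul_zero, ← erfcInt]
  have h5 : √(4 * Real.pi * L) = 2 * √Real.pi * √L := by
    rw [Real.sqrt_mul (by positivity), Real.sqrt_mul (by norm_num)]
    congr 2
    rw [show (4 : ℝ) = 2 ^ 2 by norm_num, Real.sqrt_sq (by norm_num)]
  rw [h5]
  have hsc : ((√L : ℝ) : ℂ) ≠ 0 := by exact_mod_cast hs.ne'
  have := sqrt_pi_ne_zero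
  rw [real_smul]
  push_cast
  field_simp

/-- The heat semigroup reflected at the origin, in terms of the first passage time. -/
lemma integral_hit_mul_exp_Ioc {r L : ℝ} (hr : 0 < r) (hL : 0 < L) (w : ℂ) :
    ∫ t in Ioc 0 L, (hit r t : ℂ) * exp (-t * w ^ 2) =
      (∫ z in Ioi (0 : ℝ), exp (-L * w ^ 2) * ((gauss L (r + z) : ℂ) * exp (-(w * z)))) +
      ∫ z in Ioi (0 : ℝ), exp (-L * w ^ 2) * ((gauss L (r + z) : ℂ) * exp (w * z)) := by
  rw [integral_hit_mul_exp_Ioc_eq_passage hr hL, integral_gauss_mul_exp r w hL, passage, mul_add]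
  congr 1
  have := integral_gauss_mul_exp r (-w) hL
  simp only [neg_mul, mul_neg, neg_neg, even_two.neg_pow, ← sub_eq_add_neg] at this
  rw [← this]
  simp

lemma exp_phase_eq (t x : ℝ) (w : ℂ) : exp (phase t x w) = exp (-t * w ^ 2) * exp (phase 0 x w) := by
  rw [← Complex.exp_add]; congr 1; simp [phase]; ring

lemma exp_phase_add (t x z : ℝ) (w : ℂ) :
    exp (phase t (z + x) w) = exp (-(w * z)) * exp (phase t x w) := by
  rw [← Complex.exp_add]; congr 1; simp [phase]; ring

lemma integrable_hyp_phase_div {α : ℝ} (hα : 0 < α) (t x : ℝ) :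
    Integrable fun s : ℝ => exp (phase t x (hyp α s)) / (2 * hyp α s) := by
  have h := integrable_hyp_phase hα t x (q := fun _ => 1) continuous_const (fun w => by simp)
  simp only [one_mul] at h
  have hc := continuous_hyp hα
  have hp := continuous_phase t x
  refine (h.norm.const_mul (1 / (2 * √α))).mono' ?_ (Eventually.of_forall fun s => ?_)
  · exact (by fun_prop (disch := simpa using fun s => hyp_ne_zero hα s) : Continuous fun s : ℝ =>
      exp (phase t x (hyp α s)) / (2 * hyp α s)).aestronglyMeasurable
  · rw [norm_div, div_eq_inv_mul, one_div, norm_mul 2, Complex.norm_ofNat]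
    have h1 := le_norm_hyp hα s
    have h2 : 0 < √α := Real.sqrt_pos.2 hα
    gcongr

lemma norm_exp_neg_mul_hyp_sq_le {α t : ℝ} (hα : 0 < α) (ht : 0 < t) (s : ℝ) :
    ‖exp (-t * hyp α s ^ 2)‖ ≤ 1 := by
  rw [norm_exp, Real.exp_le_one_iff, hyp_sq]
  simp
  positivity

lemma integral_hit_mul_heatAi {α : ℝ} (hα : 0 < α) {r : ℝ} (hr : 0 < r) (x : ℝ) {T : Set ℝ}
    (hT : MeasurableSet T) (hT0 : T ⊆ Ioi 0) :
    ((∫ t in T, hit r t * heatAi t x : ℝ) : ℂ) = (1 / (2 * Real.pi)) * ∫ s : ℝ,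
      (∫ t in T, (hit r t : ℂ) * exp (-t * hyp α s ^ 2)) *
        (exp (phase 0 x (hyp α s)) / (2 * hyp α s)) := by
  have hi : Integrable (Function.uncurry fun (t s : ℝ) => (hit r t : ℂ) * exp (-t * hyp α s ^ 2) *
      (exp (phase 0 x (hyp α s)) / (2 * hyp α s))) ((volume.restrict T).prod volume) := by
    have h1 : Integrable (fun t => (hit r t : ℂ)) (volume.restrict T) :=
      ((integrableOn_hit hr).mono_set hT0).ofReal
    have h2 := h1.mul_prod (integrable_hyp_phase_div hα 0 x)
    have hc := continuous_hyp hα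
    have h3 : Continuous fun p : ℝ × ℝ => exp (-p.1 * hyp α p.2 ^ 2) := by fun_prop
    refine (h2.mul_of_top_right
      (memLp_top_of_bound h3.aestronglyMeasurable 1 ?_)).congr (Eventually.of_forall fun p => ?_)
    · have : ∀ᵐ p ∂((volume.restrict T).prod (volume : Measure ℝ)), p.1 ∈ T :=
        Measure.quasiMeasurePreserving_fst.ae (ae_restrict_mem hT)
      exact this.mono fun p hp => norm_exp_neg_mul_hyp_sq_le hα (hT0 hp) p.2
    · simp only [Function.uncurry, Pi.mul_apply]
      ring
  have h4 := integral_integral_swap hi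
  simp only [integral_mul_const] at h4
  rw [← h4, ← integral_complex_ofReal, ← integral_const_mul]
  refine setIntegral_congr_fun hT fun t ht => ?_
  have ht' : 0 < t := hT0 ht
  rw [ofReal_mul, ofReal_heatAi hα ht'.le, mul_left_comm, ← integral_const_mul]
  congr 2
  funext s
  rw [exp_phase_eq]
  ring

lemma integral_hit_mul_heatAi_Ioi {r : ℝ} (hr : 0 < r) (x : ℝ) :
    ∫ t in Ioi 0, hit r t * heatAi t x = heatAi 0 (r + x) := by
  apply ofReal_injective
  rw [integral_hit_mul_heatAi one_pos hr x measurableSet_Ioi subset_rfl,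
    ofReal_heatAi one_pos le_rfl]
  congr 2
  funext s
  rw [integral_hit_mul_exp hr (hyp_re_pos one_pos s) (by rw [hyp_sq]; simp), exp_phase_add 0 x r]
  ring_nf

lemma integrable_exp_hyp_exponent {α : ℝ} (hα : 0 < α) (p d : ℝ) : Integrable fun s : ℝ =>
    Real.exp ((hyp α s ^ 3).re / 3 + p * (hyp α s).re + d * (hyp α s).re ^ 2) := by
  obtain ⟨C, hC⟩ := exists_hyp_exponent_le hα p d
  refine (integrable_exp_sub_abs C).mono' ?_ (Eventually.of_forall fun s => ?_)
  · have := continuous_hyp hα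
    exact (by fun_prop : Continuous fun s : ℝ =>
      Real.exp ((hyp α s ^ 3).re / 3 + p * (hyp α s).re + d * (hyp α s).re ^ 2)).aestronglyMeasurable
  · rw [Real.norm_eq_abs, Real.abs_exp, Real.exp_le_exp]
    exact hC s

lemma norm_exp_phase_div_le {α : ℝ} (hα : 0 < α) (t x s : ℝ) :
    ‖exp (phase t x (hyp α s)) / (2 * hyp α s)‖ ≤ (2 * √α)⁻¹ * Real.exp (-α * t) *
      Real.exp ((hyp α s ^ 3).re / 3 - x * (hyp α s).re) := by
  rw [norm_div, norm_exp, phase_hyp_re, norm_mul 2, Complex.norm_ofNat, mul_assoc, ← Real.exp_add,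
    div_eq_inv_mul]
  have h1 := le_norm_hyp hα s
  have h2 : 0 < √α := Real.sqrt_pos.2 hα
  gcongr
  linarith

lemma integrable_gauss_exp_phase {r L : ℝ} (hr : 0 < r) (hL : 0 < L) (x ε : ℝ) (hε : |ε| ≤ 1) :
    Integrable (Function.uncurry fun (z s : ℝ) => (gauss L (r + z) : ℂ) *
      (exp (phase L (ε * z + x) (hyp 1 s)) / (2 * hyp 1 s)))
      ((volume.restrict (Ioi 0)).prod volume) := by
  have h1 : Integrable (fun z : ℝ => (√(4 * Real.pi * L))⁻¹ * Real.exp (-(1 / (8 * L)) * z ^ 2))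
      (volume.restrict (Ioi 0)) :=
    ((integrable_exp_neg_mul_sq (by positivity)).const_mul _).integrableOn
  have h2 := (integrable_exp_hyp_exponent one_pos (-x) (2 * L)).const_mul
    ((2 * √1)⁻¹ * Real.exp (-1 * L))
  refine (h1.mul_prod h2).mono' ?_ ?_
  · have hc := continuous_hyp one_pos
    have hm := hc.measurable
    have hg : Measurable fun z : ℝ × ℝ => (gauss L (r + z.1) : ℂ) := by
      unfold gauss; fun_prop
    refine (hg.mul ?_).aestronglyMeasurable
    unfold phase
    fun_prop
  · have : ∀ᵐ p ∂((volume.restrict (Ioi (0 : ℝ))).prod (volume : Measure ℝ)), p.1 ∈ Ioi (0 : ℝ) :=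
      Measure.quasiMeasurePreserving_fst.ae (ae_restrict_mem measurableSet_Ioi)
    refine this.mono fun p hp => ?_
    have hz : 0 < p.1 := hp
    simp only [Function.uncurry]
    rw [norm_mul, norm_real, Real.norm_eq_abs, abs_of_nonneg (gauss_nonneg _ _)]
    have hX := hyp_re_pos one_pos p.2
    set X := (hyp 1 p.2).re with hXdef
    calc _ ≤ (√(4 * Real.pi * L))⁻¹ * Real.exp (-p.1 ^ 2 / (4 * L)) *
          ((2 * √1)⁻¹ * Real.exp (-1 * L) *
            Real.exp ((hyp 1 p.2 ^ 3).re / 3 - (ε * p.1 + x) * X)) := by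
          unfold gauss
          gcongr
          · linarith
          · exact norm_exp_phase_div_le one_pos _ _ _
      _ = (√(4 * Real.pi * L))⁻¹ * ((2 * √1)⁻¹ * Real.exp (-1 * L)) *
          Real.exp (-p.1 ^ 2 / (4 * L) + ((hyp 1 p.2 ^ 3).re / 3 - (ε * p.1 + x) * X)) := by
          rw [Real.exp_add]; ring
      _ ≤ (√(4 * Real.pi * L))⁻¹ * ((2 * √1)⁻¹ * Real.exp (-1 * L)) *
          Real.exp (-(1 / (8 * L)) * p.1 ^ 2 + ((hyp 1 p.2 ^ 3).re / 3 + -x * X + 2 * L * X ^ 2)) := by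
          gcongr ?_ * Real.exp ?_
          have h3 : -ε * (p.1 * X) ≤ p.1 * X := by
            have := neg_le_of_abs_le hε
            have : 0 ≤ p.1 * X := by positivity
            nlinarith
          have h4 : p.1 * X ≤ p.1 ^ 2 / (8 * L) + 2 * L * X ^ 2 := by
            have : p.1 ^ 2 / (8 * L) + 2 * L * X ^ 2 - p.1 * X = (p.1 - 4 * L * X) ^ 2 / (8 * L) := by
              field_simp; ring
            have : 0 ≤ (p.1 - 4 * L * X) ^ 2 / (8 * L) := by positivity
            linarith
          have h5 : -p.1 ^ 2 / (4 * L) = -(1 / (8 * L)) * p.1 ^ 2 - p.1 ^ 2 / (8 * L) := by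
            field_simp; ring
          rw [h5]
          linarith
      _ = _ := by rw [Real.exp_add]; ring

lemma integral_gauss_mul_heatAi {r L : ℝ} (hr : 0 < r) (hL : 0 < L) (x ε : ℝ) (hε : |ε| ≤ 1) :
    ((∫ z in Ioi (0 : ℝ), gauss L (r + z) * heatAi L (ε * z + x) : ℝ) : ℂ) =
      (1 / (2 * Real.pi)) * ∫ s : ℝ,
      (∫ z in Ioi (0 : ℝ), exp (-L * hyp 1 s ^ 2) * (gauss L (r + z) * exp (-(ε * hyp 1 s * z)))) *
        (exp (phase 0 x (hyp 1 s)) / (2 * hyp 1 s)) ∧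
    Integrable fun s : ℝ =>
      (∫ z in Ioi (0 : ℝ), exp (-L * hyp 1 s ^ 2) * (gauss L (r + z) * exp (-(ε * hyp 1 s * z)))) *
        (exp (phase 0 x (hyp 1 s)) / (2 * hyp 1 s)) := by
  have hi := integrable_gauss_exp_phase hr hL x ε hε
  have hs := integral_integral_swap hi
  have he : ∀ s : ℝ, (∫ z in Ioi (0 : ℝ), (gauss L (r + z) : ℂ) *
      (exp (phase L (ε * z + x) (hyp 1 s)) / (2 * hyp 1 s))) =
      (∫ z in Ioi (0 : ℝ), exp (-L * hyp 1 s ^ 2) * (gauss L (r + z) * exp (-(ε * hyp 1 s * z)))) *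
        (exp (phase 0 x (hyp 1 s)) / (2 * hyp 1 s)) := by
    intro s
    rw [← integral_mul_const]
    congr 1
    funext z
    rw [exp_phase_add, exp_phase_eq]
    have : hyp 1 s * ((ε * z : ℝ) : ℂ) = ε * hyp 1 s * z := by push_cast; ring
    rw [this]
    ring
  simp only [he] at hs
  refine ⟨?_, ?_⟩
  · rw [← hs, ← integral_complex_ofReal, ← integral_const_mul]
    refine setIntegral_congr_fun measurableSet_Ioi fun z _ => ?_
    rw [ofReal_mul, ofReal_heatAi one_pos hL.le, integral_const_mul]
    ring
  · have := hi.swap.integral_prod_left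
    simpa only [Function.comp_def, Prod.swap, Function.uncurry, he] using this

lemma integral_hit_mul_heatAi_Ioc {r L : ℝ} (hr : 0 < r) (hL : 0 < L) (x : ℝ) :
    ∫ t in Ioc 0 L, hit r t * heatAi t x =
      (∫ z in Ioi (0 : ℝ), gauss L (r + z) * heatAi L (z + x)) +
      ∫ z in Ioi (0 : ℝ), gauss L (r + z) * heatAi L (-z + x) := by
  apply ofReal_injective
  rw [integral_hit_mul_heatAi one_pos hr x measurableSet_Ioc Ioc_subset_Ioi_self]
  obtain ⟨h1, h2⟩ := integral_gauss_mul_heatAi hr hL x 1 (by simp)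
  obtain ⟨h3, h4⟩ := integral_gauss_mul_heatAi hr hL x (-1) (by simp)
  simp only [one_mul, neg_mul, ofReal_one, ofReal_neg, neg_neg] at h1 h2 h3 h4
  rw [ofReal_add, h1, h3, ← mul_add, ← integral_add h2 h4]
  congr 2
  funext s
  rw [integral_hit_mul_exp_Ioc hr hL, add_mul]
  simp only [neg_mul]

lemma E_eq_heatAi (L c z y : ℝ) : E L c z y = heatAi L (z + (y + 2 * c)) := by
  unfold E heatAi; ring_nf

lemma G_eq_gauss {L : ℝ} (hL : 0 < L) (u v : ℝ) : G L u v = gauss L (u - v) := by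
  unfold G gauss
  congr 1
  rw [neg_div, Real.rpow_neg (by positivity), ← Real.sqrt_eq_rpow]

/-- The set of first passage times that contribute to `K` at position `x`. -/
def passageTimes (L x : ℝ) : Set ℝ := if 0 < x then Ioi 0 else Ioc 0 L

/-- The kernel `K` as a mixture over first passage times. -/
lemma K_eq_integral {L : ℝ} (hL : 0 < L) (c : ℝ) {x : ℝ} (hx : x ≠ 0) (y : ℝ) :
    K L c x y = ∫ t in passageTimes L x, hit |x| t * heatAi t (y + 2 * c) := by
  unfold K passageTimes
  rcases lt_or_gt_of_ne hx with h | h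
  · rw [if_neg h.not_gt, if_pos h.le, if_pos h.le, if_neg h.not_gt,
      integral_hit_mul_heatAi_Ioc (abs_pos.2 hx) hL, zero_add]
    congr 1
    · refine setIntegral_congr_fun measurableSet_Ioi fun z _ => ?_
      rw [G_eq_gauss hL, E_eq_heatAi, abs_of_neg h]
      have : gauss L (x - z) = gauss L (-x + z) := by
        unfold gauss; ring_nf
      rw [this]
    · rw [← neg_zero, ← integral_comp_neg_Ioi, neg_zero]
      refine setIntegral_congr_fun measurableSet_Ioi fun z _ => ?_
      rw [G_eq_gauss hL, E_eq_heatAi, abs_of_neg h, sub_neg_eq_add]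
  · rw [if_pos h, if_neg h.not_ge, if_neg h.not_ge, if_pos h,
      integral_hit_mul_heatAi_Ioi (abs_pos.2 hx), abs_of_pos h]
    unfold heatAi
    simp [add_assoc]

/-- The first passage density from `x`, restricted to the passage times contributing to `K`. -/
noncomputable def passageDensity (L x t : ℝ) : ℝ :=
  if 0 < t ∧ (0 < x ∨ t ≤ L) then hit |x| t else 0

lemma passageDensity_nonneg (L x t : ℝ) : 0 ≤ passageDensity L x t := by
  unfold passageDensity
  split_ifs with h
  · exact hit_nonneg (abs_nonneg x) h.1.le
  · rfl

lemma measurable_passageDensity (L : ℝ) : Measurable (Function.uncurry (passageDensity L)) := by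
  unfold passageDensity Function.uncurry
  refine Measurable.ite ?_ ?_ measurable_const
  · exact (measurableSet_lt measurable_const measurable_snd).inter
      ((measurableSet_lt measurable_const measurable_fst).union
        (measurableSet_le measurable_snd measurable_const))
  · exact measurable_hit.comp ((measurable_norm.comp measurable_fst).prodMk measurable_snd)

lemma passageDensity_eq_indicator (L x : ℝ) :
    passageDensity L x = (passageTimes L x).indicator (hit |x|) := by
  funext t
  unfold passageDensity passageTimes indicator
  by_cases hx : 0 < x <;> simp [hx]

lemma measurableSet_passageTimes (L x : ℝ) : MeasurableSet (passageTimes L x) := by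
  unfold passageTimes; split_ifs
  · exact measurableSet_Ioi
  · exact measurableSet_Ioc

lemma passageTimes_subset (L x : ℝ) : passageTimes L x ⊆ Ioi 0 := by
  unfold passageTimes; split_ifs
  · exact subset_rfl
  · exact Ioc_subset_Ioi_self

lemma K_eq_integral_passageDensity {L : ℝ} (hL : 0 < L) (c : ℝ) {x : ℝ} (hx : x ≠ 0) (y : ℝ) :
    K L c x y = ∫ t, passageDensity L x t * heatAi t (y + 2 * c) := by
  rw [K_eq_integral hL c hx, passageDensity_eq_indicator,
    ← integral_indicator (measurableSet_passageTimes L x)]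
  congr 1
  funext t
  by_cases h : t ∈ passageTimes L x <;> simp [h]

lemma measurable_Ai : Measurable Ai := by
  unfold Ai
  have h : Continuous (Function.uncurry fun (x t : ℝ) => (Complex.exp ((1 + (t : ℂ) * Complex.I) ^ 3 / 3
      - (1 + (t : ℂ) * Complex.I) * (x : ℂ))).re) := by
    unfold Function.uncurry; fun_prop
  exact (h.stronglyMeasurable.integral_prod_right (ν := volume)).measurable.const_mul _

lemma measurable_heatAi : Measurable (Function.uncurry heatAi) := by
  unfold heatAi Function.uncurry
  have := measurable_Ai
  fun_prop

lemma hit_le {r t L : ℝ} (hr : 0 ≤ r) (ht : 0 < t) (htL : t ≤ L) :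
    hit r t ≤ √2 * Real.exp (-r ^ 2 / (8 * L)) * hit (r / √2) t := by
  have h2 : (0 : ℝ) < √2 := by positivity
  unfold hit gauss
  have h1 : -r ^ 2 / (4 * t) ≤ -r ^ 2 / (8 * L) + -(r / √2) ^ 2 / (4 * t) := by
    rw [div_pow, Real.sq_sqrt zero_le_two]
    have h3 : -r ^ 2 / (4 * t) = -r ^ 2 / (8 * t) + -(r ^ 2 / 2) / (4 * t) := by ring
    rw [h3, neg_div, neg_div (8 * L)]
    gcongr
  calc _ ≤ r / t * ((√(4 * Real.pi * t))⁻¹ *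
        Real.exp (-r ^ 2 / (8 * L) + -(r / √2) ^ 2 / (4 * t))) := by gcongr
    _ = _ := by
      rw [Real.exp_add]
      field_simp

/-- The growth rate of `heatAi` in space. -/
noncomputable def growth (L y : ℝ) : ℝ := if y ≤ 0 then Real.exp (y ^ 2 / (16 * L)) else Real.exp (-y)

lemma growth_nonneg (L y : ℝ) : 0 ≤ growth L y := by unfold growth; split_ifs <;> positivity

lemma measurable_growth (L : ℝ) : Measurable (growth L) := by
  unfold growth
  exact Measurable.ite measurableSet_Iic (by fun_prop) (by fun_prop)

lemma abs_heatAi_le {α : ℝ} (hα : 0 < α) {t : ℝ} (ht : 0 ≤ t) (x : ℝ) :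
    |heatAi t x| ≤ (4 * Real.pi * √α)⁻¹ * Real.exp (-α * t) *
      ∫ s : ℝ, Real.exp ((hyp α s ^ 3).re / 3 - x * (hyp α s).re) := by
  rw [← Real.norm_eq_abs, ← Complex.norm_real, ofReal_heatAi hα ht, norm_mul]
  have hi : Integrable fun s : ℝ => Real.exp ((hyp α s ^ 3).re / 3 - x * (hyp α s).re) := by
    simpa [sub_eq_add_neg] using integrable_exp_hyp_exponent hα (-x) 0
  have h1 := norm_integral_le_of_norm_le (hi.const_mul ((2 * √α)⁻¹ * Real.exp (-α * t)))
    (Eventually.of_forall fun s => norm_exp_phase_div_le hα t x s)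
  have h2 : ‖(1 / (2 * (Real.pi : ℂ)))‖ = (2 * Real.pi)⁻¹ := by
    simp [abs_of_pos Real.pi_pos]
  rw [h2]
  calc _ ≤ (2 * Real.pi)⁻¹ * _ := mul_le_mul_of_nonneg_left h1 (by positivity)
    _ = _ := by
      rw [integral_const_mul, show 4 * Real.pi * √α = (2 * Real.pi) * (2 * √α) by ring, mul_inv]
      ring

lemma exists_abs_heatAi_le {L : ℝ} (hL : 0 < L) (c : ℝ) : ∃ C : ℝ, 0 ≤ C ∧ ∀ t y : ℝ, 0 ≤ t →
    |heatAi t (y + 2 * c)| ≤ C * growth L y := by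
  refine ⟨(4 * Real.pi * √1)⁻¹ *
    ∫ s : ℝ, Real.exp ((hyp 1 s ^ 3).re / 3 + (-2 * c) * (hyp 1 s).re + 4 * L * (hyp 1 s).re ^ 2),
    mul_nonneg (by positivity) (integral_nonneg fun s => (Real.exp_pos _).le), fun t y ht => ?_⟩
  have h1 := abs_heatAi_le one_pos ht (y + 2 * c)
  have h2 : ∫ s : ℝ, Real.exp ((hyp 1 s ^ 3).re / 3 - (y + 2 * c) * (hyp 1 s).re) ≤
      (∫ s : ℝ, Real.exp ((hyp 1 s ^ 3).re / 3 + (-2 * c) * (hyp 1 s).re +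
        4 * L * (hyp 1 s).re ^ 2)) * growth L y := by
    rw [← integral_mul_const]
    refine integral_mono ?_ ((integrable_exp_hyp_exponent one_pos _ _).mul_const _) fun s => ?_
    · simpa only [zero_mul, add_zero, neg_mul, ← sub_eq_add_neg] using
        integrable_exp_hyp_exponent one_pos (-(y + 2 * c)) 0
    · have hX := sqrt_le_hyp_re one_pos s
      rw [Real.sqrt_one] at hX
      set X := (hyp 1 s).re
      simp only
      unfold growth
      split_ifs with hy
      · rw [← Real.exp_add, Real.exp_le_exp]
        have : y ^ 2 / (16 * L) + 4 * L * X ^ 2 + y * X = (y + 8 * L * X) ^ 2 / (16 * L) := by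
          field_simp; ring
        have : 0 ≤ (y + 8 * L * X) ^ 2 / (16 * L) := by positivity
        linarith
      · rw [← Real.exp_add, Real.exp_le_exp]
        have : 0 ≤ 4 * L * X ^ 2 := by positivity
        nlinarith
  have h3 : Real.exp (-1 * t) ≤ 1 := by
    rw [Real.exp_le_one_iff]; linarith
  have h4 : 0 ≤ ∫ s : ℝ, Real.exp ((hyp 1 s ^ 3).re / 3 - (y + 2 * c) * (hyp 1 s).re) :=
    integral_nonneg fun s => (Real.exp_pos _).le
  calc _ ≤ _ := h1
    _ ≤ (4 * Real.pi * √1)⁻¹ * 1 * _ := by gcongr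
    _ ≤ (4 * Real.pi * √1)⁻¹ * 1 * _ := mul_le_mul_of_nonneg_left h2 (by positivity)
    _ = _ := by ring

lemma integrable_passageDensity_growth {L : ℝ} (hL : 0 < L) :
    Integrable (fun p : ℝ × ℝ => passageDensity L p.1 p.2 * growth L p.1) := by
  have hm : Measurable (fun p : ℝ × ℝ => passageDensity L p.1 p.2 * growth L p.1) :=
    (measurable_passageDensity L).mul ((measurable_growth L).comp measurable_fst)
  have hb : ∀ x : ℝ, x ≠ 0 → Integrable (passageDensity L x) ∧
      (∫ t, passageDensity L x t) * growth L x ≤ √2 * Real.exp (-(1 / (16 * L)) * x ^ 2) +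
        Real.exp (-1 * |x|) := by
    intro x hx
    have hr := abs_pos.2 hx
    have h0 : Integrable (passageDensity L x) := by
      rw [passageDensity_eq_indicator, integrable_indicator_iff (measurableSet_passageTimes L x)]
      exact (integrableOn_hit hr).mono_set (passageTimes_subset L x)
    refine ⟨h0, ?_⟩
    rw [passageDensity_eq_indicator, integral_indicator (measurableSet_passageTimes L x)]
    unfold passageTimes growth
    rcases lt_or_gt_of_ne hx with h | h
    · rw [if_neg h.not_gt, if_pos h.le]
      have hr2 : 0 < |x| / √2 := by positivity
      have h1 : ∫ t in Ioc 0 L, hit |x| t ≤ √2 * Real.exp (-|x| ^ 2 / (8 * L)) * 1 := by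
        rw [← integral_hit hr2, ← integral_const_mul]
        calc _ ≤ ∫ t in Ioc 0 L, √2 * Real.exp (-|x| ^ 2 / (8 * L)) * hit (|x| / √2) t := by
              refine setIntegral_mono_on ((integrableOn_hit hr).mono_set Ioc_subset_Ioi_self)
                (((integrableOn_hit hr2).mono_set Ioc_subset_Ioi_self).const_mul _)
                measurableSet_Ioc fun t ht => hit_le hr.le ht.1 ht.2
          _ ≤ _ := by
            refine setIntegral_mono_set ((integrableOn_hit hr2).const_mul _) ?_
              Ioc_subset_Ioi_self.eventuallyLE
            refine (ae_restrict_mem measurableSet_Ioi).mono fun t ht => ?_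
            exact mul_nonneg (by positivity) (hit_nonneg hr2.le (le_of_lt ht))
      rw [sq_abs, mul_one] at h1
      calc _ ≤ √2 * Real.exp (-x ^ 2 / (8 * L)) * Real.exp (x ^ 2 / (16 * L)) := by gcongr
        _ = √2 * Real.exp (-(1 / (16 * L)) * x ^ 2) := by
          rw [mul_assoc, ← Real.exp_add]
          congr 2
          field_simp
          ring
        _ ≤ _ := le_add_of_nonneg_right (Real.exp_pos _).le
    · rw [if_pos h, if_neg h.not_ge, integral_hit hr, one_mul, abs_of_pos h, neg_one_mul]
      exact le_add_of_nonneg_left (by positivity)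
  rw [Measure.volume_eq_prod, integrable_prod_iff hm.aestronglyMeasurable]
  have hae : ∀ᵐ x : ℝ, x ≠ 0 := by
    simp [ae_iff]
  constructor
  · filter_upwards [hae] with x hx using (hb x hx).1.mul_const _
  · have h1 := (((integrable_exp_neg_mul_sq (b := 1 / (16 * L)) (by positivity)).const_mul √2).add
      (integrable_exp_neg_mul_abs one_pos))
    refine h1.mono' ?_ ?_
    · exact (hm.norm.stronglyMeasurable.integral_prod_right').aestronglyMeasurable
    · filter_upwards [hae] with x hx
      have h2 : ∀ t, ‖passageDensity L x t * growth L x‖ = passageDensity L x t * growth L x := fun t =>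
        Real.norm_of_nonneg (mul_nonneg (passageDensity_nonneg _ _ _) (growth_nonneg _ _))
      simp only [h2]
      rw [integral_mul_const, Real.norm_of_nonneg]
      · exact (hb x hx).2
      · exact mul_nonneg (integral_nonneg fun t => passageDensity_nonneg _ _ _) (growth_nonneg _ _)

/-- The kernel in the time variables whose cyclic integrals are the traces of `K`. -/
noncomputable def timeKernel (c L t s : ℝ) : ℝ :=
  ∫ y, heatAi t (y + 2 * c) * passageDensity L y s

lemma integrable_prod_pairs {ι : Type*} [Fintype ι] {F : ℝ → ℝ → ℝ}
    (hF : Integrable fun p : ℝ × ℝ => F p.1 p.2) :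
    Integrable (fun p : (ι → ℝ) × (ι → ℝ) => ∏ i, F (p.1 i) (p.2 i)) (volume.prod volume) := by
  have h1 : Integrable (fun p : ι → ℝ × ℝ => ∏ i, F (p i).1 (p i).2) :=
    Integrable.fintype_prod (f := fun _ (q : ℝ × ℝ) => F q.1 q.2) fun _ => hF
  have h2 := (volume_measurePreserving_arrowProdEquivProdArrow ℝ ℝ ι).symm
  exact h2.integrable_comp_of_integrable h1

lemma integrable_passage_prod {L : ℝ} (hL : 0 < L) (c : ℝ) (n : ℕ) :
    Integrable (Function.uncurry fun (x t : Fin (n + 1) → ℝ) =>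
      ∏ i, passageDensity L (x i) (t i) * heatAi (t i) (x (i + 1) + 2 * c))
      (volume.prod volume) := by
  obtain ⟨C, hC, hb⟩ := exists_abs_heatAi_le hL c
  have h2 := integrable_prod_pairs (ι := Fin (n + 1))
    (F := fun x t => C * (passageDensity L x t * growth L x))
    ((integrable_passageDensity_growth hL).const_mul C)
  refine h2.mono' ?_ (Eventually.of_forall fun p => ?_)
  · have hA := measurable_passageDensity L
    have hH := measurable_heatAi
    refine (Finset.measurable_fun_prod _ fun i _ => ?_).aestronglyMeasurable
    exact Measurable.mul (hA.comp (f := fun p : (Fin (n + 1) → ℝ) × (Fin (n + 1) → ℝ) =>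
      (p.1 i, p.2 i)) (by fun_prop)) (hH.comp (f := fun p : (Fin (n + 1) → ℝ) × (Fin (n + 1) → ℝ) =>
      (p.2 i, p.1 (i + 1) + 2 * c)) (by fun_prop))
  · obtain ⟨x, t⟩ := p
    have h3 : ∏ i, C * (passageDensity L (x i) (t i) * growth L (x i)) =
      ∏ i, passageDensity L (x i) (t i) * (C * growth L (x (i + 1))) := by
      have h4 : ∏ i, growth L (x (i + 1)) = ∏ i, growth L (x i) :=
        Equiv.prod_comp (Equiv.addRight 1) fun i => growth L (x i)
      simp only [Finset.prod_mul_distrib]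
      rw [h4]
      ring
    simp only [Function.uncurry]
    rw [h3, norm_prod]
    refine Finset.prod_le_prod (fun i _ => norm_nonneg _) fun i _ => ?_
    rw [norm_mul, Real.norm_of_nonneg (passageDensity_nonneg _ _ _), Real.norm_eq_abs]
    by_cases ht : 0 < t i
    · exact mul_le_mul_of_nonneg_left (hb _ _ ht.le) (passageDensity_nonneg _ _ _)
    · simp [passageDensity, ht]

lemma integral_prod_shift {n : ℕ} (F : Fin (n + 1) → ℝ → ℝ) :
    ∫ x : Fin (n + 1) → ℝ, ∏ i, F i (x (i + 1)) = ∏ i, ∫ y, F i y := by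
  have h : ∀ x : Fin (n + 1) → ℝ, ∏ i, F i (x (i + 1)) = ∏ i, F (i - 1) (x i) := fun x => by
    rw [← Equiv.prod_comp (Equiv.addRight 1) fun i => F (i - 1) (x i)]
    simp
  simp_rw [h]
  rw [integral_fintype_prod_volume_eq_prod (fun i => F (i - 1))]
  exact Equiv.prod_comp (Equiv.subRight 1) fun i => ∫ y, F i y

lemma Tr_eq_integral_timeKernel {L : ℝ} (hL : 0 < L) (c : ℝ) (n : ℕ) :
    Tr n L c = ∫ t : Fin (n + 1) → ℝ, ∏ i, timeKernel c L (t i) (t (i + 1)) ∧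
    Integrable fun t : Fin (n + 1) → ℝ => ∏ i, timeKernel c L (t i) (t (i + 1)) := by
  have hi := integrable_passage_prod hL c n
  have hinner : ∀ t : Fin (n + 1) → ℝ, (∫ x : Fin (n + 1) → ℝ,
      ∏ i, passageDensity L (x i) (t i) * heatAi (t i) (x (i + 1) + 2 * c)) =
      ∏ i, timeKernel c L (t i) (t (i + 1)) := by
    intro t
    unfold timeKernel
    rw [← integral_prod_shift fun i y => heatAi (t i) (y + 2 * c) * passageDensity L y (t (i + 1))]
    congr 1
    funext x
    rw [Finset.prod_mul_distrib, Finset.prod_mul_distrib, mul_comm]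
    congr 1
    exact (Equiv.prod_comp (Equiv.addRight 1) fun i => passageDensity L (x i) (t i)).symm
  refine ⟨?_, ?_⟩
  · simp_rw [← hinner]
    rw [← integral_integral_swap hi, Tr]
    refine integral_congr_ae ?_
    have hae : ∀ᵐ x : Fin (n + 1) → ℝ, ∀ i, x i ≠ 0 := by
      rw [ae_all_iff]
      intro i
      have h0 : ∀ᵐ y : ℝ, y ≠ 0 := by simp [ae_iff]
      exact (Measure.quasiMeasurePreserving_eval (fun _ : Fin (n + 1) => (volume : Measure ℝ)) i).ae h0
    filter_upwards [hae] with x hx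
    refine Eq.trans ?_ (integral_fintype_prod_volume_eq_prod
      fun i t => passageDensity L (x i) t * heatAi t (x (i + 1) + 2 * c)).symm
    exact Finset.prod_congr rfl fun i _ => K_eq_integral_passageDensity hL c (hx i) _
  · have := hi.swap.integral_prod_left
    simpa only [Function.comp_def, Prod.swap, Function.uncurry, hinner] using this

lemma exp_mul_gauss_le {s : ℝ} (hs : 0 < s) (X y : ℝ) :
    Real.exp (-(X * y)) * gauss s y ≤ Real.exp (2 * s * X ^ 2) *
      ((√(4 * Real.pi * s))⁻¹ * Real.exp (-(1 / (8 * s)) * y ^ 2)) := by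
  unfold gauss
  have h : -(X * y) + -y ^ 2 / (4 * s) ≤ 2 * s * X ^ 2 + -(1 / (8 * s)) * y ^ 2 := by
    have h1 : 2 * s * X ^ 2 + -(1 / (8 * s)) * y ^ 2 - (-(X * y) + -y ^ 2 / (4 * s)) =
      (4 * s * X + y) ^ 2 / (8 * s) := by field_simp; ring
    have h2 : 0 ≤ (4 * s * X + y) ^ 2 / (8 * s) := by positivity
    linarith
  calc _ = (√(4 * Real.pi * s))⁻¹ * Real.exp (-(X * y) + -y ^ 2 / (4 * s)) := by
        rw [Real.exp_add]; ring
    _ ≤ (√(4 * Real.pi * s))⁻¹ * Real.exp (2 * s * X ^ 2 + -(1 / (8 * s)) * y ^ 2) := by gcongr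
    _ = _ := by rw [Real.exp_add]; ring

/-- The Gaussian majorant appearing in `exp_mul_gauss_le`, times the drift `|y| / s`. -/
lemma integrable_drift {s : ℝ} (hs : 0 < s) :
    Integrable fun y : ℝ => |y| / s * ((√(4 * Real.pi * s))⁻¹ *
      Real.exp (-(1 / (8 * s)) * y ^ 2)) := by
  have h := ((integrable_mul_exp_neg_mul_sq (b := 1 / (8 * s)) (by positivity)).norm.const_mul
    (s⁻¹ * (√(4 * Real.pi * s))⁻¹))
  refine h.congr (Eventually.of_forall fun y => ?_)
  simp only [norm_mul, Real.norm_eq_abs, Real.abs_exp]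
  ring

lemma measurable_gauss_right (s : ℝ) : Measurable (gauss s) := by unfold gauss; fun_prop

lemma norm_drift_le {s : ℝ} (hs : 0 < s) (w : ℂ) (y : ℝ) :
    ‖cexp (-(w * y)) * ((-y / s * gauss s y : ℝ) : ℂ)‖ ≤ Real.exp (2 * s * w.re ^ 2) *
      (|y| / s * ((√(4 * Real.pi * s))⁻¹ * Real.exp (-(1 / (8 * s)) * y ^ 2))) := by
  rw [norm_mul, norm_exp, norm_real, norm_mul, norm_div, norm_neg, Real.norm_eq_abs,
    Real.norm_of_nonneg hs.le, Real.norm_of_nonneg (gauss_nonneg _ _)]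
  have h := exp_mul_gauss_le hs w.re y
  have h2 : (-(w * y)).re = -(w.re * y) := by simp
  rw [h2]
  calc _ = |y| / s * (Real.exp (-(w.re * y)) * gauss s y) := by ring
    _ ≤ |y| / s * _ := mul_le_mul_of_nonneg_left h (by positivity)
    _ = _ := by ring

lemma integrable_exp_mul_drift {s : ℝ} (hs : 0 < s) (w : ℂ) :
    Integrable fun y : ℝ => cexp (-(w * y)) * ((-y / s * gauss s y : ℝ) : ℂ) := by
  refine ((integrable_drift hs).const_mul (Real.exp (2 * s * w.re ^ 2))).mono' ?_
    (Eventually.of_forall fun y => norm_drift_le hs w y)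
  have := measurable_gauss_right s
  exact Measurable.aestronglyMeasurable (by fun_prop)

lemma integral_exp_mul_gauss {s : ℝ} (hs : 0 < s) (w : ℂ) :
    ∫ y : ℝ, cexp (-(w * y)) * (gauss s y : ℂ) = cexp (s * w ^ 2) := by
  have hs' : (s : ℂ) ≠ 0 := by exact_mod_cast hs.ne'
  have hb : (-(1 / (4 * s) : ℝ) : ℂ).re < 0 := by
    rw [neg_re, ofReal_re, neg_lt_zero]; positivity
  have h := integral_cexp_quadratic hb (-w) 0
  have h2 : (Real.pi / -(-((1 / (4 * s) : ℝ) : ℂ))) ^ (1 / 2 : ℂ) = ((√(4 * Real.pi * s) : ℝ) : ℂ) := by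
    rw [neg_neg, ← ofReal_div, Real.sqrt_eq_rpow, ofReal_cpow (by positivity)]
    congr 2
    · field_simp
    · norm_num
  have h3 : ∀ y : ℝ, cexp (-(w * y)) * (gauss s y : ℂ) = ((√(4 * Real.pi * s) : ℝ) : ℂ)⁻¹ *
      cexp ((-(1 / (4 * s) : ℝ) : ℂ) * y ^ 2 + -w * y + 0) := fun y => by
    unfold gauss
    push_cast
    rw [mul_left_comm, ← Complex.exp_add]
    congr 2
    field_simp
    ring
  simp_rw [h3]
  rw [integral_const_mul, h, h2, ← mul_assoc, inv_mul_cancel₀, one_mul]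
  · congr 1
    push_cast
    field_simp
    ring
  · have : 0 < √(4 * Real.pi * s) := by positivity
    exact_mod_cast this.ne'

lemma integrable_exp_mul_gauss {s : ℝ} (hs : 0 < s) (w : ℂ) :
    Integrable fun y : ℝ => cexp (-(w * y)) * (gauss s y : ℂ) := by
  have h := ((integrable_exp_neg_mul_sq (b := 1 / (8 * s)) (by positivity)).const_mul
    (Real.exp (2 * s * w.re ^ 2) * (√(4 * Real.pi * s))⁻¹))
  refine h.mono' ?_ (Eventually.of_forall fun y => ?_)
  · have := measurable_gauss_right s
    exact Measurable.aestronglyMeasurable (by fun_prop)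
  · rw [norm_mul, norm_exp, norm_real, Real.norm_of_nonneg (gauss_nonneg _ _)]
    have h := exp_mul_gauss_le hs w.re y
    have h2 : (-(w * y)).re = -(w.re * y) := by simp
    rw [h2]
    linarith

lemma integral_exp_mul_drift {s : ℝ} (hs : 0 < s) (w : ℂ) :
    ∫ y : ℝ, cexp (-(w * y)) * ((-y / s * gauss s y : ℝ) : ℂ) = 2 * w * cexp (s * w ^ 2) := by
  have hs' : (s : ℂ) ≠ 0 := by exact_mod_cast hs.ne'
  have hd : ∀ y : ℝ, HasDerivAt (fun y : ℝ => cexp (-(w * y)) * (gauss s y : ℂ))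
      (-w * (cexp (-(w * y)) * (gauss s y : ℂ)) +
        2⁻¹ * (cexp (-(w * y)) * ((-y / s * gauss s y : ℝ) : ℂ))) y := by
    intro y
    have h1 : HasDerivAt (fun y : ℝ => cexp (-(w * y))) (cexp (-(w * y)) * -(w * 1)) y :=
      (((hasDerivAt_id' (y : ℂ)).const_mul w).neg.cexp).comp_ofReal
    have h2 : HasDerivAt (gauss s) ((√(4 * Real.pi * s))⁻¹ *
        (Real.exp (-y ^ 2 / (4 * s)) * (-(2 * y ^ 1 * 1) / (4 * s)))) y := by
      exact ((((hasDerivAt_id' y).pow 2).neg.div_const (4 * s)).exp).const_mul _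
    refine (h1.mul h2.ofReal_comp).congr_deriv ?_
    unfold gauss
    push_cast
    field_simp
    ring
  have h0 := integral_eq_zero_of_hasDerivAt_of_integrable hd
    (((integrable_exp_mul_gauss hs w).const_mul (-w)).add
      ((integrable_exp_mul_drift hs w).const_mul 2⁻¹)) (integrable_exp_mul_gauss hs w)
  rw [integral_add ((integrable_exp_mul_gauss hs w).const_mul (-w))
      ((integrable_exp_mul_drift hs w).const_mul 2⁻¹), integral_const_mul, integral_const_mul,
      integral_exp_mul_gauss hs] at h0
  linear_combination 2 * h0

/-- The drift integral of `heatAi` over the whole line. -/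
lemma integral_heatAi_mul_drift {α : ℝ} (hα : 0 < α) (c : ℝ) {t s : ℝ} (ht : 0 ≤ t) (hs : 0 < s) :
    ((∫ y, heatAi t (y + 2 * c) * (-y / s * gauss s y) : ℝ) : ℂ) =
      (1 / (2 * Real.pi)) * ∫ u : ℝ, cexp (phase (t - s) (2 * c) (hyp α u)) := by
  rw [← integral_complex_ofReal]
  have h1 : ∀ y : ℝ, ((heatAi t (y + 2 * c) * (-y / s * gauss s y) : ℝ) : ℂ) =
      (1 / (2 * Real.pi)) * ∫ u : ℝ, cexp (phase t (2 * c) (hyp α u)) / (2 * hyp α u) *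
        (cexp (-(hyp α u * y)) * ((-y / s * gauss s y : ℝ) : ℂ)) := fun y => by
    rw [ofReal_mul, ofReal_heatAi hα ht, mul_assoc, ← integral_mul_const]
    congr 1
    refine integral_congr_ae (Eventually.of_forall fun u => ?_)
    simp only
    rw [exp_phase_add]
    push_cast
    ring
  simp_rw [h1]
  rw [integral_const_mul, integral_integral_swap]
  · congr 1
    refine integral_congr_ae (Eventually.of_forall fun u => ?_)
    simp only
    rw [integral_const_mul, integral_exp_mul_drift hs, exp_phase_eq t, exp_phase_eq (t - s)]
    have h0 := hyp_ne_zero hα u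
    field_simp
    rw [← Complex.exp_add]
    congr 1
    push_cast
    ring
  · have hi := (integrable_exp_hyp_exponent hα (-(2 * c)) (2 * s)).const_mul
      ((2 * √α)⁻¹ * Real.exp (-α * t))
    refine ((integrable_drift hs).mul_prod hi).mono' ?_ (Eventually.of_forall fun p => ?_)
    · have := measurable_gauss_right s
      have h2 : Measurable (hyp α) := (continuous_hyp hα).measurable
      unfold Function.uncurry phase
      exact Measurable.aestronglyMeasurable (by fun_prop)
    · obtain ⟨y, u⟩ := p
      simp only [Function.uncurry]
      rw [norm_mul]
      have h3 := norm_exp_phase_div_le hα t (2 * c) u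
      have h4 := norm_drift_le hs (hyp α u) y
      calc _ ≤ _ := mul_le_mul h3 h4 (norm_nonneg _) (by positivity)
        _ = _ := by
          rw [show -(2 * c) * (hyp α u).re = -(2 * c * (hyp α u).re) by ring, sub_eq_add_neg,
            Real.exp_add _ (2 * s * _)]
          ring

/-- The translation invariant part of the time kernel. -/
noncomputable def stepKernel (c τ : ℝ) : ℝ :=
  ((1 / (2 * Real.pi)) * ∫ u : ℝ, cexp (phase (-τ) (2 * c) (hyp (5 / 2) u))).re

/-- The boundary correction of the time kernel. -/
noncomputable def edgeKernel (c t s : ℝ) : ℝ := ∫ y in Ioi 0, heatAi t (y + 2 * c) * hit y s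

lemma ofReal_stepKernel {α : ℝ} (hα : 0 < α) (c τ : ℝ) :
    (stepKernel c τ : ℂ) =
      (1 / (2 * Real.pi)) * ∫ u : ℝ, cexp (phase (-τ) (2 * c) (hyp α u)) := by
  have hs : 0 < |τ| + 1 := by positivity
  have ht : 0 ≤ |τ| + 1 - τ := by linarith [le_abs_self τ]
  have h := fun {α : ℝ} (hα : 0 < α) => integral_heatAi_mul_drift hα c ht hs
  rw [show |τ| + 1 - τ - (|τ| + 1) = -τ by ring] at h
  rw [stepKernel, ← h (by norm_num : (0 : ℝ) < 5 / 2), ofReal_re, h hα]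

lemma integrable_hyp_real {α : ℝ} (hα : 0 < α) (x : ℝ) :
    Integrable fun u : ℝ => Real.exp ((hyp α u ^ 3).re / 3 - x * (hyp α u).re) := by
  simpa [sub_eq_add_neg] using integrable_exp_hyp_exponent hα (-x) 0

lemma abs_stepKernel_le {α : ℝ} (hα : 0 < α) (c τ : ℝ) : |stepKernel c τ| ≤
    (2 * Real.pi)⁻¹ * Real.exp (α * τ) *
      ∫ u : ℝ, Real.exp ((hyp α u ^ 3).re / 3 - 2 * c * (hyp α u).re) := by
  rw [← Real.norm_eq_abs, ← Complex.norm_real, ofReal_stepKernel hα, norm_mul, mul_assoc]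
  have h2 : ‖(1 / (2 * (Real.pi : ℂ)))‖ = (2 * Real.pi)⁻¹ := by
    simp [abs_of_pos Real.pi_pos]
  rw [h2]
  refine mul_le_mul_of_nonneg_left ?_ (by positivity)
  rw [← integral_const_mul]
  refine norm_integral_le_of_norm_le ((integrable_hyp_real hα (2 * c)).const_mul _)
    (Eventually.of_forall fun u => ?_)
  rw [norm_exp, phase_hyp_re, ← Real.exp_add, Real.exp_le_exp]
  apply le_of_eq
  ring

lemma integral_hyp_real_le {α : ℝ} (hα : 0 < α) (hα' : α ≤ 15 / 2) {c : ℝ} (hc : 3 / 2 ≤ c) :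
    ∫ u : ℝ, Real.exp ((hyp α u ^ 3).re / 3 - 2 * c * (hyp α u).re) ≤
      Real.exp (-√α * (3 - 2 / 5 * α)) * (2 / (√α * (1 / 5))) := by
  have hr : 0 < √α := Real.sqrt_pos.2 hα
  have h5 : 0 < √α * (1 / 5) := by positivity
  rw [← integral_exp_neg_mul_abs h5, ← integral_const_mul]
  refine integral_mono (integrable_hyp_real hα _) ((integrable_exp_neg_mul_abs h5).const_mul _)
    fun u => ?_
  simp only
  rw [← Real.exp_add, Real.exp_le_exp, hyp_cube_re]
  have h1 := linear_le_hyp_re_sq_add α u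
  have h2 := sqrt_le_hyp_re hα u
  set X := (hyp α u).re
  have hX : 0 < X := hr.trans_le h2
  have h3 : X * (4 * α + 3 * |u|) / 5 ≤ X * (X ^ 2 + (hyp α u).im ^ 2) := by
    rw [mul_div_assoc]; exact mul_le_mul_of_nonneg_left h1 hX.le
  have h4 : 0 ≤ (X - √α) * (3 - 2 / 5 * α + |u| / 5) := by
    refine mul_nonneg (by linarith) ?_
    have := abs_nonneg u
    linarith
  have h6 : 0 ≤ (2 * c - 3) * X := mul_nonneg (by linarith) hX.le
  linarith

lemma exp_two_mul_pi_inv_le {A x : ℝ} (h : A ≤ Real.exp x) (hA : 0 < A) :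
    Real.exp (-x) ≤ A⁻¹ := by
  rw [Real.exp_neg]; exact inv_anti₀ hA h

lemma integral_hyp_one_le {c : ℝ} (hc : 3 / 2 ≤ c) :
    ∫ u : ℝ, Real.exp ((hyp 1 u ^ 3).re / 3 - 2 * c * (hyp 1 u).re) ≤ 2 * Real.pi / 8 := by
  refine (integral_hyp_real_le one_pos (by norm_num) hc).trans ?_
  rw [Real.sqrt_one]
  have h1 : (13 : ℝ) ≤ Real.exp (13 / 5) := by
    have h := Real.exp_one_gt_d9
    have h3 : (13 : ℝ) ^ 5 ≤ (Real.exp (13 / 5)) ^ 5 := by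
      rw [← Real.exp_nat_mul]
      have : ((5 : ℕ) : ℝ) * (13 / 5) = ((13 : ℕ) : ℝ) * 1 := by norm_num
      rw [this, Real.exp_nat_mul]
      calc (13 : ℝ) ^ 5 ≤ 2.7182818283 ^ 13 := by norm_num
        _ ≤ _ := pow_le_pow_left₀ (by norm_num) h.le 13
    exact le_of_pow_le_pow_left₀ (by norm_num) (Real.exp_pos _).le h3
  have h2 := exp_two_mul_pi_inv_le h1 (by norm_num)
  have h3 : Real.exp (-1 * (3 - 2 / 5 * 1)) = Real.exp (-(13 / 5)) := by norm_num
  rw [h3]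
  have := Real.pi_gt_d2
  linarith

lemma integral_hyp_four_le {c : ℝ} (hc : 3 / 2 ≤ c) :
    ∫ u : ℝ, Real.exp ((hyp 4 u ^ 3).re / 3 - 2 * c * (hyp 4 u).re) ≤ 2 * Real.pi / 16 := by
  refine (integral_hyp_real_le (by norm_num) (by norm_num) hc).trans ?_
  have h4 : √(4 : ℝ) = 2 := by rw [show (4 : ℝ) = 2 ^ 2 by norm_num, Real.sqrt_sq zero_le_two]
  rw [h4]
  have h1 : (13 : ℝ) ≤ Real.exp (14 / 5) := by
    have h := Real.exp_one_gt_d9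
    have h3 : (13 : ℝ) ^ 5 ≤ (Real.exp (14 / 5)) ^ 5 := by
      rw [← Real.exp_nat_mul]
      have : ((5 : ℕ) : ℝ) * (14 / 5) = ((14 : ℕ) : ℝ) * 1 := by norm_num
      rw [this, Real.exp_nat_mul]
      calc (13 : ℝ) ^ 5 ≤ 2.7182818283 ^ 14 := by norm_num
        _ ≤ _ := pow_le_pow_left₀ (by norm_num) h.le 14
    exact le_of_pow_le_pow_left₀ (by norm_num) (Real.exp_pos _).le h3
  have h2 := exp_two_mul_pi_inv_le h1 (by norm_num)
  have h3 : Real.exp (-2 * (3 - 2 / 5 * 4)) = Real.exp (-(14 / 5)) := by norm_num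
  rw [h3]
  have := Real.pi_gt_d2
  linarith

/-- The step kernel conjugated to be exponentially decaying in both directions. -/
noncomputable def tiltedStep (c τ : ℝ) : ℝ := Real.exp (-(5 / 2 * τ)) * stepKernel c τ

lemma abs_tiltedStep_le {c : ℝ} (hc : 3 / 2 ≤ c) (τ : ℝ) :
    |tiltedStep c τ| ≤ 1 / 8 * Real.exp (-(3 / 2 * |τ|)) := by
  unfold tiltedStep
  rw [abs_mul, Real.abs_exp]
  rcases le_total 0 τ with h | h
  · have h1 := abs_stepKernel_le one_pos c τ
    have h2 := integral_hyp_one_le hc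
    have h3 : |stepKernel c τ| ≤ 1 / 8 * Real.exp (1 * τ) := by
      refine h1.trans ((mul_le_mul_of_nonneg_left h2 (by positivity)).trans (le_of_eq ?_))
      field_simp
    calc _ ≤ Real.exp (-(5 / 2 * τ)) * (1 / 8 * Real.exp (1 * τ)) := by gcongr
      _ = 1 / 8 * Real.exp (-(5 / 2 * τ) + 1 * τ) := by rw [Real.exp_add]; ring
      _ = _ := by rw [abs_of_nonneg h]; congr 2; ring
  · have h1 := abs_stepKernel_le (by norm_num : (0 : ℝ) < 4) c τ
    have h2 := integral_hyp_four_le hc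
    have h3 : |stepKernel c τ| ≤ 1 / 8 * Real.exp (4 * τ) := by
      refine h1.trans ((mul_le_mul_of_nonneg_left h2 (by positivity)).trans ?_)
      have : (2 * Real.pi)⁻¹ * Real.exp (4 * τ) * (2 * Real.pi / 16) = 1 / 16 * Real.exp (4 * τ) := by
        field_simp
      rw [this]
      gcongr
      norm_num
    calc _ ≤ Real.exp (-(5 / 2 * τ)) * (1 / 8 * Real.exp (4 * τ)) := by gcongr
      _ = 1 / 8 * Real.exp (-(5 / 2 * τ) + 4 * τ) := by rw [Real.exp_add]; ring
      _ = _ := by rw [abs_of_nonpos h]; congr 2; ring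

lemma abs_heatAi_four_le {c : ℝ} (hc : 3 / 2 ≤ c) {t y : ℝ} (ht : 0 ≤ t) (hy : 0 ≤ y) :
    |heatAi t (y + 2 * c)| ≤ 1 / 64 * Real.exp (-(4 * t)) * Real.exp (-(2 * y)) := by
  have h4 : √(4 : ℝ) = 2 := by rw [show (4 : ℝ) = 2 ^ 2 by norm_num, Real.sqrt_sq zero_le_two]
  have h1 := abs_heatAi_le (by norm_num : (0 : ℝ) < 4) ht (y + 2 * c)
  have h2 : ∫ u : ℝ, Real.exp ((hyp 4 u ^ 3).re / 3 - (y + 2 * c) * (hyp 4 u).re) ≤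
      Real.exp (-(2 * y)) * (2 * Real.pi / 16) := by
    refine le_trans ?_ (mul_le_mul_of_nonneg_left (integral_hyp_four_le hc) (Real.exp_pos _).le)
    rw [← integral_const_mul]
    refine integral_mono (integrable_hyp_real (by norm_num) _)
      ((integrable_hyp_real (by norm_num) _).const_mul _) fun u => ?_
    simp only
    rw [← Real.exp_add, Real.exp_le_exp]
    have h3 := sqrt_le_hyp_re (by norm_num : (0 : ℝ) < 4) u
    rw [h4] at h3
    nlinarith
  rw [h4] at h1
  calc _ ≤ _ := h1
    _ ≤ _ := mul_le_mul_of_nonneg_left h2 (by positivity)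
    _ = _ := by
      rw [show -4 * t = -(4 * t) by ring]
      field_simp
      norm_num

lemma growth_mul_gauss_le {s : ℝ} (hs : 0 < s) (y : ℝ) : growth s y * gauss s y ≤
    (√(4 * Real.pi * s))⁻¹ * Real.exp (-(1 / (8 * s)) * y ^ 2) := by
  unfold growth gauss
  have h0 : 0 ≤ y ^ 2 / (16 * s) := by positivity
  have h1 : -(1 / (8 * s)) * y ^ 2 = -(2 * (y ^ 2 / (16 * s))) := by field_simp; ring
  have h2 : -y ^ 2 / (4 * s) = -(4 * (y ^ 2 / (16 * s))) := by field_simp; ring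
  rw [h1, h2, mul_left_comm]
  refine mul_le_mul_of_nonneg_left ?_ (by positivity)
  split_ifs with h
  · rw [← Real.exp_add, Real.exp_le_exp]
    linarith
  · rw [← Real.exp_add, Real.exp_le_exp]
    linarith

lemma integrable_heatAi_mul_drift (c : ℝ) {t s : ℝ} (ht : 0 ≤ t) (hs : 0 < s) :
    Integrable fun y => heatAi t (y + 2 * c) * (-y / s * gauss s y) := by
  obtain ⟨C, hC, hb⟩ := exists_abs_heatAi_le hs c
  refine ((integrable_drift hs).const_mul C).mono' ?_ (Eventually.of_forall fun y => ?_)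
  · have := measurable_gauss_right s
    have h2 : Measurable fun y => heatAi t (y + 2 * c) :=
      measurable_heatAi.comp (f := fun y : ℝ => (t, y + 2 * c)) (by fun_prop)
    exact Measurable.aestronglyMeasurable (by fun_prop)
  · rw [norm_mul, norm_mul, norm_div, norm_neg, Real.norm_eq_abs, Real.norm_eq_abs,
      Real.norm_of_nonneg hs.le, Real.norm_of_nonneg (gauss_nonneg _ _)]
    refine (mul_le_mul_of_nonneg_right (hb t y ht)
      (mul_nonneg (div_nonneg (abs_nonneg y) hs.le) (gauss_nonneg _ _))).trans ?_
    have h1 := mul_le_mul_of_nonneg_left (growth_mul_gauss_le hs y)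
      (mul_nonneg hC (div_nonneg (abs_nonneg y) hs.le))
    refine (le_of_eq ?_).trans (h1.trans (le_of_eq ?_)) <;> ring

lemma hit_eq_drift (s y : ℝ) : hit y s = - (-y / s * gauss s y) := by
  unfold hit; ring

lemma hit_neg_eq_drift (s y : ℝ) : hit (-y) s = -y / s * gauss s y := by
  unfold hit gauss; rw [neg_sq]

lemma timeKernel_of_nonpos (c L t : ℝ) {s : ℝ} (hs : s ≤ 0) : timeKernel c L t s = 0 := by
  simp [timeKernel, passageDensity, hs.not_gt]

lemma setIntegral_heatAi_mul_drift (c : ℝ) {t s : ℝ} (ht : 0 ≤ t) (hs : 0 < s) :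
    ∫ y in Iic 0, heatAi t (y + 2 * c) * (-y / s * gauss s y) =
      stepKernel c (s - t) + edgeKernel c t s := by
  have hi := integrable_heatAi_mul_drift c ht hs
  have h1 : ∫ y, heatAi t (y + 2 * c) * (-y / s * gauss s y) = stepKernel c (s - t) := by
    have h := integral_heatAi_mul_drift one_pos c ht hs
    rw [← neg_sub s t, ← ofReal_stepKernel one_pos] at h
    exact_mod_cast h
  have h2 : edgeKernel c t s = - ∫ y in Ioi 0, heatAi t (y + 2 * c) * (-y / s * gauss s y) := by
    rw [edgeKernel, ← integral_neg]
    congr 1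
    funext y
    rw [hit_eq_drift]
    ring
  rw [← h1, h2, ← intervalIntegral.integral_Iic_add_Ioi hi.integrableOn hi.integrableOn (b := 0)]
  ring

lemma timeKernel_eq (c L : ℝ) {t s : ℝ} (ht : 0 ≤ t) (hs : 0 < s) :
    timeKernel c L t s =
      (if s ≤ L then stepKernel c (s - t) + edgeKernel c t s else 0) + edgeKernel c t s := by
  have hi := integrable_heatAi_mul_drift c ht hs
  have hp : EqOn (fun y => heatAi t (y + 2 * c) * passageDensity L y s)
      (fun y => heatAi t (y + 2 * c) * hit y s) (Ioi 0) := fun y hy => by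
    have hy' : 0 < y := hy
    simp [passageDensity, hs, hy', abs_of_pos hy']
  have hn : EqOn (fun y => heatAi t (y + 2 * c) * passageDensity L y s)
      (fun y => if s ≤ L then heatAi t (y + 2 * c) * (-y / s * gauss s y) else 0) (Iic 0) := by
    intro y hy
    have hy' : y ≤ 0 := hy
    simp [passageDensity, hs, hy'.not_gt, abs_of_nonpos hy', hit_neg_eq_drift]
  have hip : IntegrableOn (fun y => heatAi t (y + 2 * c) * hit y s) (Ioi 0) := by
    refine hi.neg.integrableOn.congr (Eventually.of_forall fun y => ?_)
    simp only [Pi.neg_apply]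
    rw [hit_eq_drift]
    ring
  have hin : IntegrableOn (fun y => if s ≤ L then
      heatAi t (y + 2 * c) * (-y / s * gauss s y) else 0) (Iic 0) := by
    split_ifs
    · exact hi.integrableOn
    · exact integrableOn_zero
  rw [timeKernel, ← intervalIntegral.integral_Iic_add_Ioi
    (hin.congr_fun hn.symm measurableSet_Iic) (hip.congr_fun hp.symm measurableSet_Ioi),
    setIntegral_congr_fun measurableSet_Iic hn, setIntegral_congr_fun measurableSet_Ioi hp]
  congr 1
  split_ifs
  · exact setIntegral_heatAi_mul_drift c ht hs
  · simp

/-- The mass of the passages at time `s` from the right half line, exponentially weighted. -/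
noncomputable def edgeWeight (s : ℝ) : ℝ := ∫ y in Ioi 0, Real.exp (-(2 * y)) * hit y s

lemma edgeWeight_nonneg {s : ℝ} (hs : 0 ≤ s) : 0 ≤ edgeWeight s :=
  setIntegral_nonneg measurableSet_Ioi fun _ hy =>
    mul_nonneg (Real.exp_pos _).le (hit_nonneg (le_of_lt hy) hs)

lemma measurable_edgeWeight : Measurable edgeWeight := by
  have h : Measurable (Function.uncurry fun s y : ℝ => Real.exp (-(2 * y)) * hit y s) := by
    have := measurable_hit.comp (measurable_swap (α := ℝ) (β := ℝ))
    exact (by fun_prop : Measurable fun p : ℝ × ℝ => Real.exp (-(2 * p.2))).mul this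
  exact (h.stronglyMeasurable.integral_prod_right (ν := volume.restrict (Ioi 0))).measurable

lemma integrableOn_exp_mul_hit {s : ℝ} (hs : 0 < s) :
    IntegrableOn (fun y => Real.exp (-(2 * y)) * hit y s) (Ioi 0) := by
  refine (((integrable_drift hs).const_mul (Real.exp (2 * s * 2 ^ 2))).integrableOn
    (s := Ioi 0)).mono' ?_ ?_
  · have : Measurable fun y => hit y s := measurable_hit.comp (measurable_id.prodMk measurable_const)
    exact Measurable.aestronglyMeasurable (by fun_prop)
  · refine (ae_restrict_mem measurableSet_Ioi).mono fun y hy => ?_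
    have hy' : 0 < y := hy
    have h := exp_mul_gauss_le hs 2 y
    rw [Real.norm_of_nonneg (mul_nonneg (Real.exp_pos _).le (hit_nonneg hy'.le hs.le)),
      abs_of_pos hy']
    unfold hit
    calc _ = y / s * (Real.exp (-(2 * y)) * gauss s y) := by ring
      _ ≤ y / s * _ := mul_le_mul_of_nonneg_left h (by positivity)
      _ = _ := by ring

lemma lintegral_edgeWeight : ∫⁻ s in Ioi 0, ENNReal.ofReal (edgeWeight s) ≤ ENNReal.ofReal (1 / 2) := by
  have h1 : ∀ s ∈ Ioi (0 : ℝ), ENNReal.ofReal (edgeWeight s) =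
      ∫⁻ y in Ioi 0, ENNReal.ofReal (Real.exp (-(2 * y)) * hit y s) := fun s hs => by
    rw [edgeWeight, ofReal_integral_eq_lintegral_ofReal (integrableOn_exp_mul_hit hs)]
    exact (ae_restrict_mem measurableSet_Ioi).mono fun y hy =>
      mul_nonneg (Real.exp_pos _).le (hit_nonneg (le_of_lt hy) (le_of_lt hs))
  rw [setLIntegral_congr_fun measurableSet_Ioi h1, lintegral_lintegral_swap]
  · have h2 : ∀ y ∈ Ioi (0 : ℝ), ∫⁻ s in Ioi 0, ENNReal.ofReal (Real.exp (-(2 * y)) * hit y s) =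
        ENNReal.ofReal (Real.exp (-2 * y)) := fun y hy => by
      rw [← ofReal_integral_eq_lintegral_ofReal ((integrableOn_hit hy).const_mul _),
        integral_const_mul, integral_hit hy, mul_one, neg_mul]
      exact (ae_restrict_mem measurableSet_Ioi).mono fun s hs =>
        mul_nonneg (Real.exp_pos _).le (hit_nonneg (le_of_lt hy) (le_of_lt hs))
    rw [setLIntegral_congr_fun measurableSet_Ioi h2, ← ofReal_integral_eq_lintegral_ofReal
      (integrableOn_exp_mul_Ioi (by norm_num) 0)
      (Eventually.of_forall fun _ => (Real.exp_pos _).le), integral_exp_mul_Ioi (by norm_num)]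
    apply le_of_eq
    norm_num
  · have h : Measurable (Function.uncurry fun s y : ℝ => Real.exp (-(2 * y)) * hit y s) := by
      have := measurable_hit.comp (measurable_swap (α := ℝ) (β := ℝ))
      exact (by fun_prop : Measurable fun p : ℝ × ℝ => Real.exp (-(2 * p.2))).mul this
    exact h.ennreal_ofReal.aemeasurable

/-- The boundary correction, conjugated as in `tiltedStep`. -/
noncomputable def tiltedEdge (c t s : ℝ) : ℝ := Real.exp (-(5 / 2 * (s - t))) * edgeKernel c t s

lemma abs_tiltedEdge_le {c : ℝ} (hc : 3 / 2 ≤ c) {t s : ℝ} (ht : 0 ≤ t) (hs : 0 < s) :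
    |tiltedEdge c t s| ≤ 1 / 64 * Real.exp (-(3 / 2 * (t + s))) * edgeWeight s := by
  have h1 : |edgeKernel c t s| ≤ 1 / 64 * Real.exp (-(4 * t)) * edgeWeight s := by
    rw [← Real.norm_eq_abs, edgeWeight, ← integral_const_mul]
    refine norm_integral_le_of_norm_le ((integrableOn_exp_mul_hit hs).const_mul _)
      ((ae_restrict_mem measurableSet_Ioi).mono fun y hy => ?_)
    have hy' : 0 ≤ y := le_of_lt hy
    rw [norm_mul, Real.norm_of_nonneg (hit_nonneg hy' hs.le), Real.norm_eq_abs, ← mul_assoc]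
    exact mul_le_mul_of_nonneg_right (abs_heatAi_four_le hc ht hy') (hit_nonneg hy' hs.le)
  rw [tiltedEdge, abs_mul, Real.abs_exp]
  calc _ ≤ Real.exp (-(5 / 2 * (s - t))) * (1 / 64 * Real.exp (-(4 * t)) * edgeWeight s) := by gcongr
    _ = 1 / 64 * Real.exp (-(5 / 2 * (s - t)) + -(4 * t)) * edgeWeight s := by
      rw [Real.exp_add]; ring
    _ ≤ _ := by
      have := edgeWeight_nonneg hs.le
      gcongr
      linarith

lemma abs_prod_add_sub_prod_le {ι : Type*} (S : Finset ι) {x y X Y : ι → ℝ}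
    (hx : ∀ i, |x i| ≤ X i) (hy : ∀ i, |y i| ≤ Y i) :
    |∏ i ∈ S, (x i + y i) - ∏ i ∈ S, x i| ≤ ∏ i ∈ S, (X i + Y i) - ∏ i ∈ S, X i := by
  classical
  induction S using Finset.induction_on with
  | empty => simp
  | insert a S ha ih =>
    rw [Finset.prod_insert ha, Finset.prod_insert ha, Finset.prod_insert ha, Finset.prod_insert ha]
    have h1 : |∏ i ∈ S, (x i + y i)| ≤ ∏ i ∈ S, (X i + Y i) := by
      rw [Finset.abs_prod]
      exact Finset.prod_le_prod (fun _ _ => abs_nonneg _) fun i _ =>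
        (abs_add_le _ _).trans (add_le_add (hx i) (hy i))
    set P' := ∏ i ∈ S, (x i + y i)
    set P := ∏ i ∈ S, x i
    set Q' := ∏ i ∈ S, (X i + Y i)
    set Q := ∏ i ∈ S, X i
    have h2 : (x a + y a) * P' - x a * P = x a * (P' - P) + y a * P' := by ring
    rw [h2]
    calc _ ≤ |x a| * |P' - P| + |y a| * |P'| := by
          rw [← abs_mul, ← abs_mul]; exact abs_add_le _ _
      _ ≤ X a * (Q' - Q) + Y a * Q' := by
          have hX := (abs_nonneg _).trans (hx a)
          have hY := (abs_nonneg _).trans (hy a)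
          have := hx a
          have := hy a
          gcongr
      _ = _ := by ring

lemma prod_add_sub_prod_le_sum {ι : Type*} [DecidableEq ι] (S : Finset ι) {X Y : ι → ℝ}
    (hX : ∀ i, 0 ≤ X i) (hY : ∀ i, 0 ≤ Y i) :
    ∏ i ∈ S, (X i + Y i) - ∏ i ∈ S, X i ≤
      ∑ j ∈ S, ∏ i ∈ S, (if i = j then Y i else X i + Y i) := by
  induction S using Finset.induction_on with
  | empty => simp
  | insert a S ha ih =>
    rw [Finset.prod_insert ha, Finset.prod_insert ha, Finset.sum_insert ha, Finset.prod_insert ha,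
      if_pos rfl]
    have h1 : ∏ i ∈ S, (if i = a then Y i else X i + Y i) = ∏ i ∈ S, (X i + Y i) :=
      Finset.prod_congr rfl fun i hi => if_neg (ne_of_mem_of_not_mem hi ha)
    have h2 : ∑ j ∈ S, ∏ i ∈ insert a S, (if i = j then Y i else X i + Y i) =
        (X a + Y a) * ∑ j ∈ S, ∏ i ∈ S, (if i = j then Y i else X i + Y i) := by
      rw [Finset.mul_sum]
      refine Finset.sum_congr rfl fun j hj => ?_
      rw [Finset.prod_insert ha, if_neg (ne_of_mem_of_not_mem hj ha).symm]
    rw [h1, h2]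
    have h3 : 0 ≤ ∑ j ∈ S, ∏ i ∈ S, (if i = j then Y i else X i + Y i) :=
      Finset.sum_nonneg fun j _ => Finset.prod_nonneg fun i _ => by
        split_ifs
        · exact hY i
        · exact add_nonneg (hX i) (hY i)
    have h4 := mul_le_mul_of_nonneg_left ih (hX a)
    have h5 := mul_nonneg (hY a) h3
    linarith

lemma sum_shift_sub {n : ℕ} (t : Fin (n + 1) → ℝ) : ∑ i, (t (i + 1) - t i) = 0 := by
  rw [Finset.sum_sub_distrib, sub_eq_zero]
  exact Equiv.sum_comp (Equiv.addRight 1) t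

open scoped Fin.NatCast in
lemma abs_sub_le_sum_cycle {n : ℕ} (t : Fin (n + 1) → ℝ) (a b : Fin (n + 1)) :
    |t a - t b| ≤ ∑ i, |t (i + 1) - t i| := by
  wlog h : a ≤ b generalizing a b
  · rw [abs_sub_comm]; exact this b a (le_of_not_ge h)
  have h1 := dist_le_Ico_sum_dist (fun m : ℕ => t (m : Fin (n + 1))) (Fin.le_def.1 h)
  simp only [Fin.cast_val_eq_self, Real.dist_eq] at h1
  refine h1.trans ?_
  have h2 : ∑ i, |t (i + 1) - t i| =
      ∑ m ∈ Finset.range (n + 1), |t (m : Fin (n + 1)) - t ((m + 1 : ℕ) : Fin (n + 1))| := by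
    rw [← Fin.sum_univ_eq_sum_range fun m : ℕ => |t (m : Fin (n + 1)) - t ((m + 1 : ℕ) : Fin (n + 1))|]
    refine Finset.sum_congr rfl fun i _ => ?_
    rw [Nat.cast_succ, Fin.cast_val_eq_self, abs_sub_comm]
  rw [h2]
  refine Finset.sum_le_sum_of_subset_of_nonneg (fun m hm => ?_) fun _ _ _ => abs_nonneg _
  rw [Finset.mem_Ico] at hm
  rw [Finset.mem_range]
  omega

/-- The largest coordinate. -/
noncomputable def top {n : ℕ} (t : Fin (n + 1) → ℝ) : ℝ := Finset.univ.sup' Finset.univ_nonempty t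

lemma top_le_iff {n : ℕ} {t : Fin (n + 1) → ℝ} {a : ℝ} : top t ≤ a ↔ ∀ i, t i ≤ a := by
  simp [top]

lemma exists_eq_top {n : ℕ} (t : Fin (n + 1) → ℝ) : ∃ k, top t = t k := by
  obtain ⟨k, -, hk⟩ := Finset.exists_mem_eq_sup' (Finset.univ_nonempty (α := Fin (n + 1))) t
  exact ⟨k, hk⟩

lemma le_top {n : ℕ} (t : Fin (n + 1) → ℝ) (i : Fin (n + 1)) : t i ≤ top t :=
  top_le_iff.1 le_rfl i

/-- Cyclic product of the time kernel. -/
noncomputable def timeCycle (c L : ℝ) {n : ℕ} (t : Fin (n + 1) → ℝ) : ℝ :=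
  ∏ i, timeKernel c L (t i) (t (i + 1))

/-- Cyclic product of the step kernel. -/
noncomputable def stepCycle (c : ℝ) {n : ℕ} (t : Fin (n + 1) → ℝ) : ℝ :=
  ∏ i, tiltedStep c (t (i + 1) - t i)

/-- Majorant of the step kernel after extracting exponential decay. -/
noncomputable def stepBound (τ : ℝ) : ℝ := 1 / 8 * Real.exp (-(1 / 2 * |τ|))

/-- Majorant of the edge kernel after extracting exponential decay. -/
noncomputable def edgeBound (s : ℝ) : ℝ := if 0 < s then edgeWeight s / 32 else 0

/-- Cyclic majorant with an edge factor at position `j`. -/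
noncomputable def cycleBound {n : ℕ} (j : Fin (n + 1)) (t : Fin (n + 1) → ℝ) : ℝ :=
  ∏ i, if i = j then edgeBound (t (i + 1)) else stepBound (t (i + 1) - t i) + edgeBound (t (i + 1))

lemma stepBound_nonneg (τ : ℝ) : 0 ≤ stepBound τ := by unfold stepBound; positivity

lemma edgeBound_nonneg (s : ℝ) : 0 ≤ edgeBound s := by
  unfold edgeBound
  split_ifs with h
  · have := edgeWeight_nonneg h.le
    positivity
  · rfl

lemma cycleBound_nonneg {n : ℕ} (j : Fin (n + 1)) (t : Fin (n + 1) → ℝ) : 0 ≤ cycleBound j t :=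
  Finset.prod_nonneg fun i _ => by
    split_ifs
    · exact edgeBound_nonneg _
    · exact add_nonneg (stepBound_nonneg _) (edgeBound_nonneg _)

lemma timeCycle_eq_zero (c L : ℝ) {n : ℕ} {t : Fin (n + 1) → ℝ} {k : Fin (n + 1)} (hk : t k ≤ 0) :
    timeCycle c L t = 0 := by
  refine Finset.prod_eq_zero (Finset.mem_univ (k - 1)) ?_
  rw [sub_add_cancel]
  exact timeKernel_of_nonpos c L _ hk

lemma timeCycle_eq_tilted (c L : ℝ) {n : ℕ} {t : Fin (n + 1) → ℝ} (ht : ∀ i, 0 < t i) :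
    timeCycle c L t = ∏ i, ((if t (i + 1) ≤ L then tiltedStep c (t (i + 1) - t i) else 0) +
      ((if t (i + 1) ≤ L then tiltedEdge c (t i) (t (i + 1)) else 0) +
        tiltedEdge c (t i) (t (i + 1)))) := by
  have h1 : ∏ i, Real.exp (-(5 / 2 * (t (i + 1) - t i))) = 1 := by
    rw [← Real.exp_sum, Finset.sum_neg_distrib, ← Finset.mul_sum, sum_shift_sub]
    simp
  rw [← one_mul (timeCycle c L t), ← h1, timeCycle, ← Finset.prod_mul_distrib]
  refine Finset.prod_congr rfl fun i _ => ?_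
  rw [timeKernel_eq c L (ht i).le (ht (i + 1)), tiltedStep, tiltedEdge]
  split_ifs <;> ring

lemma timeCycle_eq_of_top_le (c : ℝ) {L L' : ℝ} (hL : L ≤ L') {n : ℕ} {t : Fin (n + 1) → ℝ}
    (ht : ∀ i, 0 < t i) (h : top t ≤ L) : timeCycle c L t = timeCycle c L' t := by
  rw [timeCycle_eq_tilted c L ht, timeCycle_eq_tilted c L' ht]
  refine Finset.prod_congr rfl fun i _ => ?_
  have h1 := top_le_iff.1 h (i + 1)
  rw [if_pos h1, if_pos h1, if_pos (h1.trans hL), if_pos (h1.trans hL)]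

lemma exp_mul_cycleBound_le {n : ℕ} {t : Fin (n + 1) → ℝ} (ht : ∀ i, 0 < t i) (j : Fin (n + 1)) :
    (∏ i, if i = j then 1 / 32 * Real.exp (-(3 / 2 * (t i + t (i + 1)))) * edgeWeight (t (i + 1))
      else 1 / 8 * Real.exp (-(3 / 2 * |t (i + 1) - t i|)) +
        1 / 32 * Real.exp (-(3 / 2 * (t i + t (i + 1)))) * edgeWeight (t (i + 1))) ≤
      Real.exp (-top t) * cycleBound j t := by
  have habs : ∀ i, |t (i + 1) - t i| ≤ t i + t (i + 1) := fun i => by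
    have := ht i
    have := ht (i + 1)
    rw [abs_le]; constructor <;> linarith
  have hw : ∀ i, 0 ≤ edgeWeight (t i) := fun i => edgeWeight_nonneg (ht i).le
  set d : Fin (n + 1) → ℝ := fun i => if i = j then t i + t (i + 1) else |t (i + 1) - t i| with hd
  have h1 : top t ≤ ∑ i, d i := by
    obtain ⟨k, hk⟩ := exists_eq_top t
    have h2 : ∑ i, d i = ∑ i, |t (i + 1) - t i| + (t j + t (j + 1) - |t (j + 1) - t j|) := by
      have : ∀ i, d i = |t (i + 1) - t i| +
          if i = j then t j + t (j + 1) - |t (j + 1) - t j| else 0 := fun i => by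
        simp only [hd]
        split_ifs with h
        · subst h; ring
        · ring
      simp_rw [this]
      rw [Finset.sum_add_distrib, Finset.sum_ite_eq' Finset.univ j]
      simp
    have h3 := abs_sub_le_sum_cycle t k j
    have h4 := abs_sub_le_sum_cycle t k (j + 1)
    have h5 := le_abs_self (t k - t j)
    have h6 := le_abs_self (t k - t (j + 1))
    have := ht j
    have := ht (j + 1)
    rw [hk, h2]
    rcases abs_cases (t (j + 1) - t j) with h | h <;> linarith [h.1]
  calc _ ≤ ∏ i, Real.exp (-d i) * (if i = j then edgeBound (t (i + 1)) else
        stepBound (t (i + 1) - t i) + edgeBound (t (i + 1))) := by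
        refine Finset.prod_le_prod (fun i _ => ?_) fun i _ => ?_
        · have := hw (i + 1)
          split_ifs <;> positivity
        · have hi := ht i
          have hi1 := ht (i + 1)
          have hwi := hw (i + 1)
          have e1 : Real.exp (-(3 / 2 * |t (i + 1) - t i|)) =
              Real.exp (-|t (i + 1) - t i|) * Real.exp (-(1 / 2 * |t (i + 1) - t i|)) := by
            rw [← Real.exp_add]; congr 1; ring
          simp only [hd, edgeBound, stepBound, if_pos hi1]
          split_ifs with h
          · have e2 : Real.exp (-(3 / 2 * (t i + t (i + 1)))) ≤ Real.exp (-(t i + t (i + 1))) := by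
              rw [Real.exp_le_exp]; linarith
            have := mul_le_mul_of_nonneg_right e2 hwi
            linarith
          · have e2 : Real.exp (-(3 / 2 * (t i + t (i + 1)))) ≤ Real.exp (-|t (i + 1) - t i|) := by
              rw [Real.exp_le_exp]; linarith [habs i]
            have := mul_le_mul_of_nonneg_right e2 hwi
            rw [e1]
            linarith
    _ = Real.exp (-∑ i, d i) * cycleBound j t := by
        rw [Finset.prod_mul_distrib, ← Real.exp_sum, Finset.sum_neg_distrib, cycleBound]
    _ ≤ _ := by
        have := cycleBound_nonneg j t
        gcongr

lemma abs_timeCycle_sub_le {c : ℝ} (hc : 3 / 2 ≤ c) (L : ℝ) {n : ℕ} {t : Fin (n + 1) → ℝ}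
    (ht : ∀ i, 0 < t i) : |timeCycle c L t - if top t ≤ L then stepCycle c t else 0| ≤
      Real.exp (-top t) * ∑ j, cycleBound j t := by
  have h0 : (∏ i, if t (i + 1) ≤ L then tiltedStep c (t (i + 1) - t i) else 0) =
      if top t ≤ L then stepCycle c t else 0 := by
    split_ifs with h
    · exact Finset.prod_congr rfl fun i _ => if_pos (top_le_iff.1 h _)
    · rw [top_le_iff, not_forall] at h
      obtain ⟨k, hk⟩ := h
      refine Finset.prod_eq_zero (Finset.mem_univ (k - 1)) ?_
      rw [sub_add_cancel, if_neg hk]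
  rw [timeCycle_eq_tilted c L ht, ← h0]
  set X : Fin (n + 1) → ℝ := fun i => 1 / 8 * Real.exp (-(3 / 2 * |t (i + 1) - t i|)) with hX
  set Y : Fin (n + 1) → ℝ := fun i =>
    1 / 32 * Real.exp (-(3 / 2 * (t i + t (i + 1)))) * edgeWeight (t (i + 1)) with hY
  have hX0 : ∀ i, 0 ≤ X i := fun i => by positivity
  have hY0 : ∀ i, 0 ≤ Y i := fun i => by
    have := edgeWeight_nonneg (ht (i + 1)).le
    positivity
  have hx : ∀ i, |if t (i + 1) ≤ L then tiltedStep c (t (i + 1) - t i) else 0| ≤ X i := fun i => by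
    split_ifs
    · exact abs_tiltedStep_le hc _
    · simpa using hX0 i
  have hy : ∀ i, |(if t (i + 1) ≤ L then tiltedEdge c (t i) (t (i + 1)) else 0) +
      tiltedEdge c (t i) (t (i + 1))| ≤ Y i := fun i => by
    have h1 := abs_tiltedEdge_le hc (ht i).le (ht (i + 1))
    have h2 : |if t (i + 1) ≤ L then tiltedEdge c (t i) (t (i + 1)) else 0| ≤
        |tiltedEdge c (t i) (t (i + 1))| := by
      split_ifs
      · rfl
      · simp
    refine (abs_add_le _ _).trans ?_
    simp only [hY]
    linarith
  refine (abs_prod_add_sub_prod_le Finset.univ hx hy).trans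
    ((prod_add_sub_prod_le_sum Finset.univ hX0 hY0).trans ?_)
  rw [Finset.mul_sum]
  exact Finset.sum_le_sum fun j _ => exp_mul_cycleBound_le ht j

lemma abs_stepCycle_le {c : ℝ} (hc : 3 / 2 ≤ c) {n : ℕ} (t : Fin (n + 1) → ℝ) :
    |stepCycle c t| ≤ Real.exp (-∑ i, |t (i + 1) - t i|) * ∏ i, stepBound (t (i + 1) - t i) := by
  rw [stepCycle, Finset.abs_prod, ← Finset.sum_neg_distrib, Real.exp_sum, ← Finset.prod_mul_distrib]
  refine Finset.prod_le_prod (fun _ _ => abs_nonneg _) fun i _ => ?_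
  refine (abs_tiltedStep_le hc _).trans (le_of_eq ?_)
  rw [stepBound, mul_left_comm, ← Real.exp_add]
  congr 2
  ring

lemma abs_stepCycle_le_prod {c : ℝ} (hc : 3 / 2 ≤ c) {n : ℕ} (t : Fin (n + 1) → ℝ) :
    |stepCycle c t| ≤ ∏ i, stepBound (t (i + 1) - t i) := by
  refine (abs_stepCycle_le hc t).trans (mul_le_of_le_one_left
    (Finset.prod_nonneg fun _ _ => stepBound_nonneg _) ?_)
  rw [Real.exp_le_one_iff, neg_nonpos]
  exact Finset.sum_nonneg fun _ _ => abs_nonneg _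

lemma abs_stepCycle_le_exp_top {c : ℝ} (hc : 3 / 2 ≤ c) {n : ℕ} {t : Fin (n + 1) → ℝ}
    {k : Fin (n + 1)} (hk : t k ≤ 0) :
    |stepCycle c t| ≤ Real.exp (-top t) * ∏ i, stepBound (t (i + 1) - t i) := by
  refine (abs_stepCycle_le hc t).trans (mul_le_mul_of_nonneg_right ?_
    (Finset.prod_nonneg fun _ _ => stepBound_nonneg _))
  obtain ⟨m, hm⟩ := exists_eq_top t
  have h1 := abs_sub_le_sum_cycle t m k
  have h2 := le_abs_self (t m - t k)
  rw [Real.exp_le_exp, hm]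
  linarith

lemma measurePreserving_cons (n : ℕ) : MeasurePreserving
    (fun p : ℝ × (Fin n → ℝ) => (Fin.cons p.1 p.2 : Fin (n + 1) → ℝ)) (volume.prod volume) volume := by
  have h := (volume_preserving_piFinSuccAbove (fun _ : Fin (n + 1) => ℝ) 0).symm
  have e : (fun p : ℝ × (Fin n → ℝ) => (Fin.cons p.1 p.2 : Fin (n + 1) → ℝ)) =
      (MeasurableEquiv.piFinSuccAbove (fun _ : Fin (n + 1) => ℝ) 0).symm := by
    funext p
    exact (Fin.insertNth_zero' p.1 p.2).symm
  rw [e]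
  exact h

lemma lintegral_fin_succ {n : ℕ} {f : (Fin (n + 1) → ℝ) → ENNReal} (hf : Measurable f) :
    ∫⁻ t, f t = ∫⁻ x, ∫⁻ u, f (Fin.cons x u) := by
  have h := measurePreserving_cons n
  rw [← h.lintegral_comp hf]
  exact lintegral_prod _ (hf.comp h.measurable).aemeasurable

lemma measurable_cons (n : ℕ) (x : ℝ) :
    Measurable fun u : Fin n → ℝ => (Fin.cons x u : Fin (n + 1) → ℝ) :=
  (measurePreserving_cons n).measurable.comp (measurable_const.prodMk measurable_id)

lemma measurable_chain {H : ℝ → ℝ → ENNReal} (hH : Measurable (Function.uncurry H)) (n : ℕ) (x : ℝ) :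
    Measurable fun u : Fin n → ℝ =>
      ∏ i, H ((Fin.cons x u : Fin (n + 1) → ℝ) i.castSucc) (u i) :=
  Finset.measurable_fun_prod _ fun i _ => hH.comp (Measurable.prodMk
    ((measurable_pi_apply i.castSucc).comp (measurable_cons n x)) (measurable_pi_apply i))

lemma lintegral_chain_le {H : ℝ → ℝ → ENNReal} (hH : Measurable (Function.uncurry H)) {ρ : ENNReal}
    (hρ : ∀ x, ∫⁻ y, H x y ≤ ρ) (n : ℕ) (x : ℝ) :
    ∫⁻ u : Fin n → ℝ, ∏ i, H ((Fin.cons x u : Fin (n + 1) → ℝ) i.castSucc) (u i) ≤ ρ ^ n := by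
  induction n generalizing x with
  | zero => simp [volume_pi]
  | succ n ih =>
    rw [lintegral_fin_succ (measurable_chain hH (n + 1) x)]
    calc _ = ∫⁻ y, H x y * ∫⁻ v : Fin n → ℝ,
          ∏ i, H ((Fin.cons y v : Fin (n + 1) → ℝ) i.castSucc) (v i) := by
          refine lintegral_congr fun y => ?_
          rw [← lintegral_const_mul _ (measurable_chain hH n y)]
          refine lintegral_congr fun v => ?_
          rw [Fin.prod_univ_succ]
          simp
      _ ≤ ∫⁻ y, H x y * ρ ^ n := lintegral_mono fun y => mul_le_mul_right (ih y) _
      _ ≤ ρ ^ (n + 1) := by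
          rw [lintegral_mul_const _ (hH.of_uncurry_left), pow_succ']
          exact mul_le_mul_left (hρ x) _

lemma measurable_top (n : ℕ) : Measurable (top (n := n)) := by
  have := Finset.measurable_sup' (s := (Finset.univ : Finset (Fin (n + 1)))) Finset.univ_nonempty
    (f := fun i (t : Fin (n + 1) → ℝ) => t i) fun i _ => measurable_pi_apply i
  convert this using 1
  funext t
  simp [top, Finset.sup'_apply]

lemma top_cons_add {n : ℕ} (x : ℝ) (u : Fin n → ℝ) :
    top (Fin.cons x (fun j => u j + x) : Fin (n + 1) → ℝ) =
      top (Fin.cons 0 u : Fin (n + 1) → ℝ) + x := by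
  have h : ∀ a, top (Fin.cons x (fun j => u j + x) : Fin (n + 1) → ℝ) ≤ a ↔
      top (Fin.cons 0 u : Fin (n + 1) → ℝ) + x ≤ a := fun a => by
    rw [← le_sub_iff_add_le, top_le_iff, top_le_iff, Fin.forall_fin_succ, Fin.forall_fin_succ]
    simp [le_sub_iff_add_le]
  exact le_antisymm ((h _).2 le_rfl) ((h _).1 le_rfl)

/-- The largest coordinate is independent of the increments from the first coordinate. -/
lemma measurePreserving_top (n : ℕ) : MeasurePreserving
    (fun t : Fin (n + 1) → ℝ => (top t, fun j : Fin n => t j.succ - t 0))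
    volume (volume.prod volume) := by
  have h1 := volume_preserving_piFinSuccAbove (fun _ : Fin (n + 1) => ℝ) 0
  have h2 : MeasurePreserving (fun p : ℝ × (Fin n → ℝ) => (p.1, fun j => p.2 j - p.1))
      (volume.prod volume) (volume.prod volume) := by
    refine (MeasurePreserving.id volume).skew_product
      (g := fun (x : ℝ) (v : Fin n → ℝ) (j : Fin n) => v j - x) ?_ ?_
    · exact measurable_pi_lambda _ fun j =>
        ((measurable_pi_apply j).comp measurable_snd).sub measurable_fst
    · exact Eventually.of_forall fun x => (measurePreserving_sub_right volume fun _ => x).map_eq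
  have hc : Measurable fun u : Fin n → ℝ => top (Fin.cons 0 u : Fin (n + 1) → ℝ) :=
    (measurable_top n).comp (measurable_cons n 0)
  have h3 : MeasurePreserving (fun p : (Fin n → ℝ) × ℝ =>
      (p.1, top (Fin.cons 0 p.1 : Fin (n + 1) → ℝ) + p.2))
      (volume.prod volume) (volume.prod volume) := by
    refine (MeasurePreserving.id volume).skew_product
      (g := fun (u : Fin n → ℝ) (x : ℝ) => top (Fin.cons 0 u : Fin (n + 1) → ℝ) + x) ?_ ?_
    · exact (hc.comp measurable_fst).add measurable_snd
    · exact Eventually.of_forall fun x => (measurePreserving_add_left volume _).map_eq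
  have h4 := Measure.measurePreserving_swap.comp (h3.comp
    (Measure.measurePreserving_swap.comp (h2.comp h1)))
  have e : (fun t : Fin (n + 1) → ℝ => (top t, fun j : Fin n => t j.succ - t 0)) =
      Prod.swap ∘ (fun p : (Fin n → ℝ) × ℝ => (p.1, top (Fin.cons 0 p.1 : Fin (n + 1) → ℝ) + p.2)) ∘
        Prod.swap ∘ (fun p : ℝ × (Fin n → ℝ) => (p.1, fun j => p.2 j - p.1)) ∘
          MeasurableEquiv.piFinSuccAbove (fun _ : Fin (n + 1) => ℝ) 0 := by
    funext t
    simp only [Function.comp, Prod.swap, MeasurableEquiv.piFinSuccAbove,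
      Fin.insertNthEquiv]
    refine Prod.ext ?_ ?_
    · simp only
      rw [← top_cons_add]
      congr 1
      funext i
      refine Fin.cases ?_ (fun j => ?_) i <;> simp [Fin.tail]
    · simp [Fin.tail]
  rw [e]
  exact h4

lemma measurable_stepKernel (c : ℝ) : Measurable (stepKernel c) := by
  have h2 : Measurable (hyp (5 / 2)) := (continuous_hyp (by norm_num)).measurable
  have h : Measurable (Function.uncurry fun τ u : ℝ => cexp (phase (-τ) (2 * c) (hyp (5 / 2) u))) := by
    unfold Function.uncurry phase
    fun_prop
  have h3 := (h.stronglyMeasurable.integral_prod_right (ν := volume)).measurable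
  unfold stepKernel
  fun_prop

lemma measurable_tiltedStep (c : ℝ) : Measurable (tiltedStep c) := by
  have := measurable_stepKernel c
  unfold tiltedStep
  fun_prop

lemma measurable_stepCycle (c : ℝ) (n : ℕ) : Measurable (stepCycle c (n := n)) := by
  have := measurable_tiltedStep c
  unfold stepCycle
  fun_prop

lemma measurable_stepBound : Measurable stepBound := by
  unfold stepBound
  have : Measurable fun x : ℝ => |x| := measurable_norm
  fun_prop

lemma measurable_edgeBound : Measurable edgeBound := by
  unfold edgeBound
  exact Measurable.ite measurableSet_Ioi (measurable_edgeWeight.div_const _) measurable_const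

lemma measurable_cycleBound {n : ℕ} (j : Fin (n + 1)) : Measurable (cycleBound j) := by
  have := measurable_stepBound
  have := measurable_edgeBound
  refine Finset.measurable_fun_prod _ fun i _ => ?_
  split_ifs <;> fun_prop

lemma integrable_stepBound : Integrable stepBound := by
  have h := (integrable_exp_neg_mul_abs (b := 1 / 2) (by norm_num)).const_mul (1 / 8)
  refine h.congr (Eventually.of_forall fun τ => ?_)
  simp only [stepBound, neg_mul]

lemma lintegral_stepBound : ∫⁻ τ, ENNReal.ofReal (stepBound τ) = ENNReal.ofReal (1 / 2) := by
  rw [← ofReal_integral_eq_lintegral_ofReal integrable_stepBound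
    (Eventually.of_forall stepBound_nonneg)]
  simp only [stepBound]
  rw [integral_const_mul]
  simp_rw [← neg_mul]
  rw [integral_exp_neg_mul_abs (by norm_num)]
  norm_num

lemma lintegral_edgeBound : ∫⁻ s, ENNReal.ofReal (edgeBound s) ≤ ENNReal.ofReal (1 / 64) := by
  have h : ∀ s, ENNReal.ofReal (edgeBound s) =
      (Ioi (0 : ℝ)).indicator (fun s => ENNReal.ofReal (edgeWeight s) * ENNReal.ofReal (1 / 32)) s :=
    fun s => by
      unfold edgeBound indicator
      simp only [mem_Ioi]
      split_ifs with h
      · rw [← ENNReal.ofReal_mul (edgeWeight_nonneg h.le), div_eq_mul_one_div]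
      · simp
  simp_rw [h]
  rw [lintegral_indicator measurableSet_Ioi,
    lintegral_mul_const _ measurable_edgeWeight.ennreal_ofReal]
  refine (mul_le_mul_left lintegral_edgeWeight _).trans (le_of_eq ?_)
  rw [← ENNReal.ofReal_mul (by norm_num)]
  norm_num

lemma lintegral_stepBound_cycle (n : ℕ) : ∫⁻ u : Fin n → ℝ, ENNReal.ofReal (∏ i : Fin (n + 1),
      stepBound ((Fin.cons 0 u : Fin (n + 1) → ℝ) (i + 1) - (Fin.cons 0 u : Fin (n + 1) → ℝ) i)) ≤
    ENNReal.ofReal ((3 / 4) ^ n) := by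
  have hH : Measurable (Function.uncurry fun x y : ℝ => ENNReal.ofReal (stepBound (y - x))) := by
    have := measurable_stepBound
    unfold Function.uncurry
    fun_prop
  have hρ : ∀ x : ℝ, ∫⁻ y, ENNReal.ofReal (stepBound (y - x)) ≤ ENNReal.ofReal (3 / 4) := fun x => by
    rw [lintegral_sub_right_eq_self (fun y => ENNReal.ofReal (stepBound y)), lintegral_stepBound]
    exact ENNReal.ofReal_le_ofReal (by norm_num)
  rw [ENNReal.ofReal_pow (by norm_num)]
  refine le_trans (lintegral_mono fun u => ?_) (lintegral_chain_le hH hρ n 0)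
  rw [ENNReal.ofReal_prod_of_nonneg fun _ _ => stepBound_nonneg _, Fin.prod_univ_castSucc]
  refine (mul_le_mul' (le_of_eq ?_) ?_).trans_eq (mul_one _)
  · refine Finset.prod_congr rfl fun i _ => ?_
    rw [Fin.coeSucc_eq_succ, Fin.cons_succ]
  · rw [ENNReal.ofReal_le_one, stepBound]
    have : Real.exp (-(1 / 2 * |(Fin.cons 0 u : Fin (n + 1) → ℝ) (Fin.last n + 1) -
      (Fin.cons 0 u : Fin (n + 1) → ℝ) (Fin.last n)|)) ≤ 1 := by
      rw [Real.exp_le_one_iff, neg_nonpos]; positivity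
    linarith

lemma cycleBound_rotate {n : ℕ} (j : Fin (n + 1)) (t : Fin (n + 1) → ℝ) :
    cycleBound j t = cycleBound (Fin.last n) fun i => t (i + (j - Fin.last n)) := by
  unfold cycleBound
  rw [← Equiv.prod_comp (Equiv.addRight (j - Fin.last n))]
  refine Finset.prod_congr rfl fun i _ => ?_
  have h : i + (j - Fin.last n) = j ↔ i = Fin.last n := by
    rw [← eq_sub_iff_add_eq, sub_sub_cancel]
  simp only [Equiv.coe_addRight, h, add_right_comm i _ 1]

lemma lintegral_cycleBound {n : ℕ} (j : Fin (n + 1)) :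
    ∫⁻ t, ENNReal.ofReal (cycleBound j t) ≤ ENNReal.ofReal ((3 / 4) ^ n) := by
  have hr : ∫⁻ t, ENNReal.ofReal (cycleBound j t) =
      ∫⁻ t, ENNReal.ofReal (cycleBound (Fin.last n) t) := by
    have h := volume_measurePreserving_piCongrLeft (fun _ : Fin (n + 1) => ℝ)
      (Equiv.addRight (j - Fin.last n))
    rw [← h.lintegral_comp (measurable_cycleBound _).ennreal_ofReal]
    refine lintegral_congr fun t => ?_
    rw [cycleBound_rotate j]
    congr 2
    funext i
    exact Equiv.piCongrLeft_apply_apply (fun _ : Fin (n + 1) => ℝ) (Equiv.addRight (j - Fin.last n)) t i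
  have hH : Measurable (Function.uncurry fun x y : ℝ =>
      ENNReal.ofReal (stepBound (y - x) + edgeBound y)) := by
    have := measurable_stepBound
    have := measurable_edgeBound
    unfold Function.uncurry
    fun_prop
  have hρ : ∀ x : ℝ, ∫⁻ y, ENNReal.ofReal (stepBound (y - x) + edgeBound y) ≤
      ENNReal.ofReal (3 / 4) := fun x => by
    simp_rw [ENNReal.ofReal_add (stepBound_nonneg _) (edgeBound_nonneg _)]
    have hm : Measurable fun y => ENNReal.ofReal (stepBound (y - x)) := by
      have := measurable_stepBound
      fun_prop
    rw [lintegral_add_left hm,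
      lintegral_sub_right_eq_self (fun y => ENNReal.ofReal (stepBound y)), lintegral_stepBound]
    refine (add_le_add le_rfl lintegral_edgeBound).trans ?_
    rw [← ENNReal.ofReal_add (by norm_num) (by norm_num)]
    exact ENNReal.ofReal_le_ofReal (by norm_num)
  rw [hr, lintegral_fin_succ (measurable_cycleBound _).ennreal_ofReal]
  calc _ = ∫⁻ x, ENNReal.ofReal (edgeBound x) * ∫⁻ u : Fin n → ℝ, ∏ i,
        (fun x y : ℝ => ENNReal.ofReal (stepBound (y - x) + edgeBound y))
          ((Fin.cons x u : Fin (n + 1) → ℝ) i.castSucc) (u i) := by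
        refine lintegral_congr fun x => ?_
        rw [← lintegral_const_mul _ (measurable_chain hH n x)]
        refine lintegral_congr fun u => ?_
        rw [cycleBound, Fin.prod_univ_castSucc, ENNReal.ofReal_mul', mul_comm, if_pos rfl,
          Fin.last_add_one, Fin.cons_zero, ENNReal.ofReal_prod_of_nonneg]
        · congr 1
          refine Finset.prod_congr rfl fun i _ => ?_
          rw [if_neg (Fin.castSucc_lt_last i).ne, Fin.coeSucc_eq_succ, Fin.cons_succ]
        · intro i _
          split_ifs
          · exact edgeBound_nonneg _
          · exact add_nonneg (stepBound_nonneg _) (edgeBound_nonneg _)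
        · rw [if_pos rfl]
          exact edgeBound_nonneg _
    _ ≤ ∫⁻ x, ENNReal.ofReal (edgeBound x) * ENNReal.ofReal (3 / 4) ^ n :=
        lintegral_mono fun x => mul_le_mul_right (lintegral_chain_le hH hρ n x) _
    _ ≤ _ := by
        rw [lintegral_mul_const _ measurable_edgeBound.ennreal_ofReal, ENNReal.ofReal_pow (by norm_num)]
        refine mul_le_of_le_one_left' (lintegral_edgeBound.trans ?_)
        rw [ENNReal.ofReal_le_one]
        norm_num

lemma cons_increments {n : ℕ} (t : Fin (n + 1) → ℝ) (i : Fin (n + 1)) :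
    (Fin.cons 0 (fun j : Fin n => t j.succ - t 0) : Fin (n + 1) → ℝ) i = t i - t 0 := by
  refine Fin.cases ?_ (fun j => ?_) i <;> simp

/-- The step kernel integrated over bridges from `0` to `0`. -/
noncomputable def bridge (c : ℝ) (n : ℕ) : ℝ :=
  ∫ u : Fin n → ℝ, stepCycle c (Fin.cons 0 u : Fin (n + 1) → ℝ)

lemma stepCycle_increments (c : ℝ) {n : ℕ} (t : Fin (n + 1) → ℝ) :
    stepCycle c (Fin.cons 0 (fun j : Fin n => t j.succ - t 0) : Fin (n + 1) → ℝ) = stepCycle c t := by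
  simp only [stepCycle, cons_increments, sub_sub_sub_cancel_right]

lemma integrable_stepCycle_bridge {c : ℝ} (hc : 3 / 2 ≤ c) (n : ℕ) :
    Integrable fun u : Fin n → ℝ => stepCycle c (Fin.cons 0 u : Fin (n + 1) → ℝ) := by
  refine ⟨((measurable_stepCycle c n).comp (measurable_cons n 0)).aestronglyMeasurable, ?_⟩
  refine lt_of_le_of_lt (lintegral_mono fun u => ?_)
    ((lintegral_stepBound_cycle n).trans_lt ENNReal.ofReal_lt_top)
  rw [Real.enorm_eq_ofReal_abs]
  exact ENNReal.ofReal_le_ofReal (abs_stepCycle_le_prod hc _)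

lemma abs_integral_le_of_lintegral_le {α : Type*} [MeasurableSpace α] {μ : Measure α} {f g : α → ℝ}
    {B : ℝ} (hB : 0 ≤ B) (hfg : ∀ x, |f x| ≤ g x)
    (h : ∫⁻ x, ENNReal.ofReal (g x) ∂μ ≤ ENNReal.ofReal B) : |∫ x, f x ∂μ| ≤ B := by
  rw [← ENNReal.ofReal_le_ofReal_iff hB, ← Real.enorm_eq_ofReal_abs]
  refine (enorm_integral_le_lintegral_enorm _).trans ((lintegral_mono fun x => ?_).trans h)
  rw [Real.enorm_eq_ofReal_abs]
  exact ENNReal.ofReal_le_ofReal (hfg x)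

lemma abs_bridge_le {c : ℝ} (hc : 3 / 2 ≤ c) (n : ℕ) : |bridge c n| ≤ (3 / 4) ^ n :=
  abs_integral_le_of_lintegral_le (by positivity) (fun _ => abs_stepCycle_le_prod hc _)
    (lintegral_stepBound_cycle n)

lemma integrable_top_mul_stepCycle {ψ : ℝ → ℝ} (hψ : Integrable ψ) {c : ℝ} (hc : 3 / 2 ≤ c) (n : ℕ) :
    Integrable (fun t : Fin (n + 1) → ℝ => ψ (top t) * stepCycle c t) ∧
    ∫ t : Fin (n + 1) → ℝ, ψ (top t) * stepCycle c t = (∫ x, ψ x) * bridge c n := by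
  have hm := measurePreserving_top n
  have hi : Integrable (fun p : ℝ × (Fin n → ℝ) =>
      ψ p.1 * stepCycle c (Fin.cons 0 p.2 : Fin (n + 1) → ℝ)) (volume.prod volume) :=
    hψ.mul_prod (integrable_stepCycle_bridge hc n)
  constructor
  · have h := hm.integrable_comp_of_integrable hi
    simpa only [Function.comp_def, stepCycle_increments] using h
  · rw [bridge, ← integral_prod_mul]
    have h1 := hm.map_eq ▸ hi.aestronglyMeasurable
    rw [← hm.map_eq, integral_map hm.measurable.aemeasurable h1]
    simp only [stepCycle_increments]

/-- Majorant on configurations, in terms of the weight `ψ` of the largest coordinate. -/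
noncomputable def majorant (A : ℝ) (ψ : ℝ → ℝ) {n : ℕ} (t : Fin (n + 1) → ℝ) : ℝ :=
  A * ∑ j, cycleBound j t + ψ (top t) * ∏ i, stepBound (t (i + 1) - t i)

lemma lintegral_majorant {A p : ℝ} (hA : 0 ≤ A) {ψ : ℝ → ℝ} (hψ : Measurable ψ)
    (hψ0 : ∀ x, 0 ≤ ψ x) (hp0 : 0 ≤ p) (hp : ∫⁻ x, ENNReal.ofReal (ψ x) ≤ ENNReal.ofReal p) (n : ℕ) :
    ∫⁻ t : Fin (n + 1) → ℝ, ENNReal.ofReal (majorant A ψ t) ≤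
      ENNReal.ofReal ((A * (n + 1) + p) * (3 / 4) ^ n) := by
  have h1 : ∀ t : Fin (n + 1) → ℝ, ENNReal.ofReal (majorant A ψ t) =
      ENNReal.ofReal A * ∑ j, ENNReal.ofReal (cycleBound j t) + ENNReal.ofReal (ψ (top t)) *
        ENNReal.ofReal (∏ i, stepBound (t (i + 1) - t i)) := fun t => by
    rw [majorant, ENNReal.ofReal_add, ENNReal.ofReal_mul hA, ENNReal.ofReal_mul (hψ0 _),
      ENNReal.ofReal_sum_of_nonneg fun j _ => cycleBound_nonneg j t]
    · exact mul_nonneg hA (Finset.sum_nonneg fun j _ => cycleBound_nonneg j t)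
    · exact mul_nonneg (hψ0 _) (Finset.prod_nonneg fun _ _ => stepBound_nonneg _)
  have hs : Measurable fun t : Fin (n + 1) → ℝ => ∏ i, stepBound (t (i + 1) - t i) := by
    have := measurable_stepBound
    fun_prop
  have h2 : ∫⁻ t : Fin (n + 1) → ℝ, ENNReal.ofReal A * ∑ j, ENNReal.ofReal (cycleBound j t) ≤
      ENNReal.ofReal (A * (n + 1) * (3 / 4) ^ n) := by
    rw [lintegral_const_mul _ (Finset.measurable_fun_sum _ fun j _ =>
        (measurable_cycleBound j).ennreal_ofReal), lintegral_finsetSum _ fun j _ =>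
        (measurable_cycleBound j).ennreal_ofReal, mul_assoc, ENNReal.ofReal_mul hA]
    refine mul_le_mul_right ((Finset.sum_le_sum fun j _ => lintegral_cycleBound j).trans
      (le_of_eq ?_)) _
    rw [Finset.sum_const, Finset.card_univ, Fintype.card_fin, nsmul_eq_mul,
      ENNReal.ofReal_mul (by positivity)]
    congr 1
    rw [← ENNReal.ofReal_natCast]
    push_cast
    rfl
  have h3 : ∫⁻ t : Fin (n + 1) → ℝ, ENNReal.ofReal (ψ (top t)) *
      ENNReal.ofReal (∏ i, stepBound (t (i + 1) - t i)) ≤ ENNReal.ofReal (p * (3 / 4) ^ n) := by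
    have hm := measurePreserving_top n
    have hm2 : Measurable fun u : Fin n → ℝ => ENNReal.ofReal (∏ i : Fin (n + 1),
        stepBound ((Fin.cons 0 u : Fin (n + 1) → ℝ) (i + 1) - (Fin.cons 0 u : Fin (n + 1) → ℝ) i)) :=
      (hs.comp (measurable_cons n 0)).ennreal_ofReal
    have hQ : Measurable fun q : ℝ × (Fin n → ℝ) => ENNReal.ofReal (ψ q.1) *
        ENNReal.ofReal (∏ i : Fin (n + 1), stepBound ((Fin.cons 0 q.2 : Fin (n + 1) → ℝ) (i + 1) -
          (Fin.cons 0 q.2 : Fin (n + 1) → ℝ) i)) :=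
      (hψ.ennreal_ofReal.comp measurable_fst).mul (hm2.comp measurable_snd)
    have h4 := hm.lintegral_comp hQ
    simp only [cons_increments, sub_sub_sub_cancel_right] at h4
    rw [h4, lintegral_prod_mul hψ.ennreal_ofReal.aemeasurable hm2.aemeasurable,
      ENNReal.ofReal_mul hp0]
    exact mul_le_mul' hp (lintegral_stepBound_cycle n)
  simp_rw [h1]
  have hm3 : Measurable fun t : Fin (n + 1) → ℝ => ENNReal.ofReal (ψ (top t)) *
      ENNReal.ofReal (∏ i, stepBound (t (i + 1) - t i)) :=
    (hψ.comp (measurable_top n)).ennreal_ofReal.mul hs.ennreal_ofReal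
  rw [lintegral_add_right _ hm3, add_mul, ENNReal.ofReal_add (by positivity) (by positivity)]
  exact add_le_add h2 h3

lemma abs_Tr_le {c : ℝ} (hc : 3 / 2 ≤ c) {L : ℝ} (hL : 0 < L) (n : ℕ) :
    |Tr n L c| ≤ (1 * (n + 1) + L) * (3 / 4) ^ n := by
  rw [(Tr_eq_integral_timeKernel hL c n).1]
  refine abs_integral_le_of_lintegral_le (g := majorant 1 ((Ioc 0 L).indicator 1))
    (by positivity) (fun t => ?_) (lintegral_majorant zero_le_one
    (measurable_one.indicator measurableSet_Ioc) (indicator_nonneg fun _ _ => zero_le_one) hL.le ?_ n)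
  · change |timeCycle c L t| ≤ _
    have hs : 0 ≤ ∑ j, cycleBound j t := Finset.sum_nonneg fun j _ => cycleBound_nonneg j t
    have hp : 0 ≤ ∏ i, stepBound (t (i + 1) - t i) := Finset.prod_nonneg fun _ _ => stepBound_nonneg _
    have hi : 0 ≤ (Ioc 0 L).indicator (1 : ℝ → ℝ) (top t) :=
      indicator_nonneg (fun _ _ => zero_le_one) _
    unfold majorant
    by_cases ht : ∀ i, 0 < t i
    · have h1 := abs_timeCycle_sub_le hc L ht
      have h0 : 0 < top t := (ht 0).trans_le (le_top t 0)
      have h2 : |if top t ≤ L then stepCycle c t else 0| ≤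
          (Ioc 0 L).indicator (1 : ℝ → ℝ) (top t) * ∏ i, stepBound (t (i + 1) - t i) := by
        simp only [indicator, mem_Ioc, h0, true_and]
        split_ifs
        · simpa using abs_stepCycle_le_prod hc t
        · simp
      have h3 : Real.exp (-top t) ≤ 1 := by rw [Real.exp_le_one_iff]; linarith
      have h4 := mul_le_mul_of_nonneg_right h3 hs
      have h5 := abs_sub_abs_le_abs_sub (timeCycle c L t) (if top t ≤ L then stepCycle c t else 0)
      linarith
    · push Not at ht
      obtain ⟨k, hk⟩ := ht
      rw [timeCycle_eq_zero c L hk, abs_zero]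
      positivity
  · have : ∀ x, ENNReal.ofReal ((Ioc 0 L).indicator (1 : ℝ → ℝ) x) =
        (Ioc 0 L).indicator 1 x := fun x => by
      unfold indicator; split_ifs <;> simp
    simp_rw [this]
    rw [lintegral_indicator_one measurableSet_Ioc, Real.volume_Ioc, sub_zero]

lemma abs_Tr_sub_le {c : ℝ} (hc : 3 / 2 ≤ c) {L L' : ℝ} (hL : 0 < L) (hLL' : L ≤ L') (n : ℕ) :
    |Tr n L' c - Tr n L c - (L' - L) * bridge c n| ≤
      (2 * Real.exp (-L) * (n + 1) + Real.exp (-L)) * (3 / 4) ^ n := by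
  have hψi : Integrable ((Ioc L L').indicator (1 : ℝ → ℝ)) := by
    rw [integrable_indicator_iff measurableSet_Ioc]
    exact integrableOn_const (by simp)
  obtain ⟨hW, hW2⟩ := integrable_top_mul_stepCycle hψi hc n
  have hT := Tr_eq_integral_timeKernel hL c n
  have hT' := Tr_eq_integral_timeKernel (hL.trans_le hLL') c n
  rw [integral_indicator_one measurableSet_Ioc, Measure.real, Real.volume_Ioc,
    ENNReal.toReal_ofReal (by linarith)] at hW2
  have hd : Integrable fun t : Fin (n + 1) → ℝ => ∏ i, timeKernel c L' (t i) (t (i + 1)) -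
      ∏ i, timeKernel c L (t i) (t (i + 1)) := hT'.2.sub hT.2
  rw [hT.1, hT'.1, ← hW2, ← integral_sub hT'.2 hT.2, ← integral_sub hd hW]
  refine abs_integral_le_of_lintegral_le
    (g := majorant (2 * Real.exp (-L)) ((Ioi L).indicator fun x => Real.exp (-x)))
    (by positivity) (fun t => ?_) (lintegral_majorant (by positivity)
    (Measurable.indicator (by fun_prop) measurableSet_Ioi)
    (indicator_nonneg fun _ _ => (Real.exp_pos _).le) (Real.exp_pos _).le ?_ n)
  · change |timeCycle c L' t - timeCycle c L t - _| ≤ _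
    have hs : 0 ≤ ∑ j, cycleBound j t := Finset.sum_nonneg fun j _ => cycleBound_nonneg j t
    have hp : 0 ≤ ∏ i, stepBound (t (i + 1) - t i) := Finset.prod_nonneg fun _ _ => stepBound_nonneg _
    have hi : 0 ≤ (Ioi L).indicator (fun x => Real.exp (-x)) (top t) :=
      indicator_nonneg (fun _ _ => (Real.exp_pos _).le) _
    unfold majorant
    by_cases hM : top t ≤ L
    · have h1 : top t ∉ Ioc L L' := fun h => h.1.not_ge hM
      rw [indicator_of_notMem h1, zero_mul, sub_zero]
      have h2 : timeCycle c L' t = timeCycle c L t := by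
        by_cases ht : ∀ i, 0 < t i
        · exact (timeCycle_eq_of_top_le c hLL' ht hM).symm
        · push Not at ht
          obtain ⟨k, hk⟩ := ht
          rw [timeCycle_eq_zero c L hk, timeCycle_eq_zero c L' hk]
      rw [h2, sub_self, abs_zero]
      positivity
    · have hM' : L < top t := not_le.1 hM
      have h1 : (Ioc L L').indicator (1 : ℝ → ℝ) (top t) * stepCycle c t =
          if top t ≤ L' then stepCycle c t else 0 := by
        simp only [indicator, mem_Ioc, hM', true_and]
        split_ifs <;> simp
      rw [h1, indicator_of_mem (show top t ∈ Ioi L from hM')]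
      by_cases ht : ∀ i, 0 < t i
      · have h2 := abs_timeCycle_sub_le hc L ht
        have h3 := abs_timeCycle_sub_le hc L' ht
        rw [if_neg hM, sub_zero] at h2
        have h4 : Real.exp (-top t) ≤ Real.exp (-L) := by rw [Real.exp_le_exp]; linarith
        have h5 := mul_le_mul_of_nonneg_right h4 hs
        have h6 := abs_sub (timeCycle c L' t - if top t ≤ L' then stepCycle c t else 0)
          (timeCycle c L t)
        rw [sub_right_comm] at h6
        have : 0 ≤ Real.exp (-top t) * ∏ i, stepBound (t (i + 1) - t i) := by positivity
        linarith
      · push Not at ht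
        obtain ⟨k, hk⟩ := ht
        rw [timeCycle_eq_zero c L hk, timeCycle_eq_zero c L' hk, sub_zero, zero_sub, abs_neg]
        have h2 := abs_stepCycle_le_exp_top hc hk
        have h3 : |if top t ≤ L' then stepCycle c t else 0| ≤ |stepCycle c t| := by
          split_ifs <;> simp
        have : 0 ≤ 2 * Real.exp (-L) * ∑ j, cycleBound j t := by positivity
        linarith
  · have : ∀ x, ENNReal.ofReal ((Ioi L).indicator (fun x => Real.exp (-x)) x) =
        (Ioi L).indicator (fun x => ENNReal.ofReal (Real.exp (-x))) x := fun x => by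
      unfold indicator; split_ifs <;> simp
    simp_rw [this]
    rw [lintegral_indicator measurableSet_Ioi, ← ofReal_integral_eq_lintegral_ofReal
      (integrableOn_exp_neg_Ioi L) (Eventually.of_forall fun _ => (Real.exp_pos _).le),
      integral_exp_neg_Ioi]

lemma hyp_mul {α l : ℝ} (hα : 0 < α) (hl : 0 < l) (s : ℝ) :
    hyp (l ^ 2 * α) (l ^ 2 * s) = l * hyp α s := by
  have h : hyp (l ^ 2 * α) (l ^ 2 * s) ^ 2 = (l * hyp α s) ^ 2 := by
    rw [mul_pow, hyp_sq, hyp_sq]; push_cast; ring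
  rcases sq_eq_sq_iff_eq_or_eq_neg.1 h with h | h
  · exact h
  · have h1 := hyp_re_pos (show 0 < l ^ 2 * α by positivity) (l ^ 2 * s)
    have h2 := mul_pos hl (hyp_re_pos hα s)
    rw [h, neg_re, re_ofReal_mul] at h1
    linarith

/-- Fourier transform of the tilted step kernel. -/
noncomputable def symbol (c s : ℝ) : ℂ := exp (phase 0 (2 * c) (hyp (5 / 2) s))

lemma integral_symbol_pow (c : ℝ) (n : ℕ) : ∫ s, symbol c s ^ (n + 1) =
    2 * Real.pi * ((-2 * ((n : ℝ) + 1) ^ (-(2 : ℝ) / 3) *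
      Ai' (2 * ((n : ℝ) + 1) ^ ((2 : ℝ) / 3) * c) : ℝ) : ℂ) := by
  have hn : (0 : ℝ) < n + 1 := by positivity
  set l : ℝ := ((n : ℝ) + 1) ^ ((1 : ℝ) / 3) with hl
  have hl0 : 0 < l := by positivity
  have h3 : l ^ 3 = n + 1 := by
    rw [hl, ← Real.rpow_natCast, ← Real.rpow_mul hn.le]; norm_num
  have h2 : ((n : ℝ) + 1) ^ ((2 : ℝ) / 3) = l ^ 2 := by
    rw [hl, ← Real.rpow_natCast, ← Real.rpow_mul hn.le]; norm_num
  have h2' : ((n : ℝ) + 1) ^ (-(2 : ℝ) / 3) = (l ^ 2)⁻¹ := by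
    rw [← h2, ← Real.rpow_neg hn.le]; norm_num
  have hs : ∀ s, symbol c s ^ (n + 1) =
      exp (phase 0 (2 * l ^ 2 * c) (hyp (l ^ 2 * (5 / 2)) (l ^ 2 * s))) := fun s => by
    rw [hyp_mul (by norm_num) hl0, symbol, ← Complex.exp_nat_mul]
    congr 1
    have h : ((n + 1 : ℕ) : ℂ) = (l : ℂ) ^ 3 := by
      rw [← ofReal_pow, h3]; push_cast; rfl
    rw [h, phase, phase]
    push_cast
    ring
  have h := ofReal_Ai' (show 0 < l ^ 2 * (5 / 2) by positivity) (2 * l ^ 2 * c)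
  rw [integral_div] at h
  simp_rw [hs]
  rw [Measure.integral_comp_mul_left
    (fun s => exp (phase 0 (2 * l ^ 2 * c) (hyp (l ^ 2 * (5 / 2)) s))), h2, h2']
  push_cast
  rw [h, abs_of_pos (by positivity), real_smul]
  push_cast
  have : (Real.pi : ℂ) ≠ 0 := by exact_mod_cast Real.pi_ne_zero
  field_simp

lemma continuous_symbol (c : ℝ) : Continuous (symbol c) :=
  ((continuous_phase _ _).comp (continuous_hyp (by norm_num))).cexp

lemma integrable_symbol (c : ℝ) : Integrable (symbol c) := by
  change Integrable fun s => exp (phase 0 (2 * c) (hyp (5 / 2) s))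
  simpa using integrable_hyp_phase (α := 5 / 2) (by norm_num) 0 (2 * c)
    (q := fun _ => 1) continuous_const (fun w => by simp)

lemma integrable_tiltedStep {c : ℝ} (hc : 3 / 2 ≤ c) : Integrable (tiltedStep c) := by
  refine ((integrable_exp_neg_mul_abs (b := 3 / 2) (by norm_num)).const_mul (1 / 8)).mono'
    (measurable_tiltedStep c).aestronglyMeasurable (Eventually.of_forall fun τ => ?_)
  rw [Real.norm_eq_abs, neg_mul]
  exact abs_tiltedStep_le hc τ

lemma ofReal_tiltedStep (c τ : ℝ) : (tiltedStep c τ : ℂ) =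
    (1 / (2 * Real.pi)) * ∫ s : ℝ, exp (τ * s * I) * symbol c s := by
  rw [tiltedStep, ofReal_mul, ofReal_stepKernel (α := 5 / 2) (by norm_num), mul_left_comm,
    ← integral_const_mul]
  congr 2
  funext s
  rw [exp_phase_eq, hyp_sq, symbol, ← mul_assoc, ofReal_exp, ← Complex.exp_add]
  congr 2
  push_cast
  ring

open FourierTransform in
lemma integral_tiltedStep_mul_exp {c : ℝ} (hc : 3 / 2 ≤ c) (s : ℝ) :
    ∫ τ : ℝ, (tiltedStep c τ : ℂ) * exp (-(s * τ * I)) = symbol c s := by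
  have hi : ∀ x : ℝ, ∫ v : ℝ, exp ((2 * Real.pi * x : ℝ) * v * I) * symbol c v =
      2 * Real.pi * (tiltedStep c (2 * Real.pi * x) : ℂ) := fun x => by
    rw [ofReal_tiltedStep, ← mul_assoc, mul_one_div_cancel, one_mul]
    exact_mod_cast Real.two_pi_pos.ne'
  have h1 : ∀ x : ℝ, 𝓕 (symbol c) x = 2 * Real.pi * (tiltedStep c (2 * Real.pi * -x) : ℂ) :=
    fun x => by
      rw [← hi, Real.fourier_real_eq_integral_exp_smul]
      congr 1
      funext v
      rw [smul_eq_mul]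
      congr 2
      push_cast
      ring
  have h2 : ∀ x : ℝ, 𝓕⁻ (symbol c) x = 2 * Real.pi * (tiltedStep c (2 * Real.pi * x) : ℂ) :=
    fun x => by
      rw [← hi, Real.fourierInv_eq']
      congr 1
      funext v
      rw [smul_eq_mul]
      congr 2
      simp
      ring
  have h3 : Integrable (𝓕 (symbol c)) := by
    have h : Integrable fun x : ℝ => 2 * Real.pi * (tiltedStep c (2 * Real.pi * x) : ℂ) :=
      (((integrable_tiltedStep hc).comp_mul_left' (R := 2 * Real.pi) (by positivity)).ofReal).const_mul _
    exact h.comp_neg.congr (Eventually.of_forall fun x => (h1 x).symm)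
  have h4 := congrFun ((continuous_symbol c).fourier_fourierInv_eq (integrable_symbol c) h3) s
  rw [Real.fourier_real_eq_integral_exp_smul] at h4
  rw [← h4]
  have h5 := Measure.integral_comp_mul_left
    (fun τ : ℝ => (tiltedStep c τ : ℂ) * exp (-(s * τ * I))) (2 * Real.pi)
  rw [abs_of_pos (by positivity), real_smul] at h5
  have h6 : ∀ v : ℝ, exp (((-2 * Real.pi * v * s : ℝ) : ℂ) * I) • 𝓕⁻ (symbol c) v =
      2 * Real.pi * ((tiltedStep c (2 * Real.pi * v) : ℂ) * exp (-(s * (2 * Real.pi * v : ℝ) * I))) :=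
    fun v => by
      rw [h2, smul_eq_mul, mul_comm, mul_assoc]
      congr 3
      push_cast
      ring
  simp_rw [h6]
  rw [integral_const_mul, h5, ofReal_inv, ← ofReal_ofNat, ← ofReal_mul, mul_inv_cancel_left₀]
  exact_mod_cast Real.two_pi_pos.ne'

lemma norm_exp_neg_mul_I (s y : ℝ) : ‖exp (-(s * y * I))‖ = 1 := by
  rw [show -((s : ℂ) * y * I) = ((-(s * y) : ℝ) : ℂ) * I by push_cast; ring]
  exact norm_exp_ofReal_mul_I _

lemma integrable_symbol_pow {c : ℝ} (hc : 3 / 2 ≤ c) (n : ℕ) :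
    Integrable fun s => symbol c s ^ (n + 1) := by
  have hb : ∀ s, ‖symbol c s‖ ≤ ∫ τ, ‖tiltedStep c τ‖ := fun s => by
    rw [← integral_tiltedStep_mul_exp hc]
    refine (norm_integral_le_integral_norm _).trans (le_of_eq ?_)
    congr 1
    funext τ
    rw [norm_mul, norm_exp_neg_mul_I, norm_real, mul_one]
  have h := (integrable_symbol c).bdd_mul (f := fun s => symbol c s ^ n)
    (c := (∫ τ, ‖tiltedStep c τ‖) ^ n)
    ((continuous_symbol c).pow n).aestronglyMeasurable (Eventually.of_forall fun s => by
      rw [norm_pow]; exact pow_le_pow_left₀ (norm_nonneg _) (hb s) n)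
  simpa only [pow_succ] using h

/-- Product of tilted steps along a path from `x` to `0`. -/
noncomputable def pathWeight (c : ℝ) {n : ℕ} (x : ℝ) (u : Fin n → ℝ) : ℝ :=
  (∏ i, tiltedStep c (u i - (Fin.cons x u : Fin (n + 1) → ℝ) i.castSucc)) *
    tiltedStep c (0 - (Fin.cons x u : Fin (n + 1) → ℝ) (Fin.last n))

lemma pathWeight_cons (c : ℝ) {n : ℕ} (x y : ℝ) (v : Fin n → ℝ) :
    pathWeight c x (Fin.cons y v : Fin (n + 1) → ℝ) = tiltedStep c (y - x) * pathWeight c y v := by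
  rw [pathWeight, pathWeight, Fin.prod_univ_succ, ← Fin.succ_last, Fin.cons_succ]
  simp [mul_assoc]

lemma stepCycle_eq_pathWeight (c : ℝ) {n : ℕ} (u : Fin n → ℝ) :
    stepCycle c (Fin.cons 0 u : Fin (n + 1) → ℝ) = pathWeight c 0 u := by
  rw [stepCycle, pathWeight, Fin.prod_univ_castSucc, Fin.last_add_one]
  simp

lemma abs_tiltedStep_le_stepBound {c : ℝ} (hc : 3 / 2 ≤ c) (τ : ℝ) :
    |tiltedStep c τ| ≤ stepBound τ := by
  refine (abs_tiltedStep_le hc τ).trans ?_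
  unfold stepBound
  gcongr
  norm_num

lemma integrable_pathWeight {c : ℝ} (hc : 3 / 2 ≤ c) (n : ℕ) (x : ℝ) :
    Integrable fun u : Fin n → ℝ => pathWeight c x u := by
  have hk := measurable_tiltedStep c
  have hcm := measurable_cons n x
  have hH : Measurable (Function.uncurry fun x y : ℝ => ENNReal.ofReal (stepBound (y - x))) := by
    have := measurable_stepBound
    unfold Function.uncurry
    fun_prop
  have hρ : ∀ x : ℝ, ∫⁻ y, ENNReal.ofReal (stepBound (y - x)) ≤ ENNReal.ofReal (1 / 2) := fun x => by
    rw [lintegral_sub_right_eq_self (fun y => ENNReal.ofReal (stepBound y)), lintegral_stepBound]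
  have hm : Measurable fun u : Fin n → ℝ => pathWeight c x u := by
    unfold pathWeight
    refine (Finset.measurable_fun_prod _ fun i _ => hk.comp ((measurable_pi_apply i).sub
      ((measurable_pi_apply _).comp hcm))).mul (hk.comp (measurable_const.sub
      ((measurable_pi_apply _).comp hcm)))
  refine ⟨hm.aestronglyMeasurable, ?_⟩
  refine lt_of_le_of_lt (lintegral_mono fun u => ?_) ((lintegral_chain_le hH hρ n x).trans_lt
    (ENNReal.pow_lt_top ENNReal.ofReal_lt_top))
  rw [Real.enorm_eq_ofReal_abs, ← ENNReal.ofReal_prod_of_nonneg fun _ _ => stepBound_nonneg _]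
  refine ENNReal.ofReal_le_ofReal ?_
  change |pathWeight c x u| ≤ _
  rw [pathWeight, abs_mul, Finset.abs_prod]
  have h1 : |tiltedStep c (0 - (Fin.cons x u : Fin (n + 1) → ℝ) (Fin.last n))| ≤ 1 := by
    refine (abs_tiltedStep_le hc _).trans ?_
    have : Real.exp (-(3 / 2 * |0 - (Fin.cons x u : Fin (n + 1) → ℝ) (Fin.last n)|)) ≤ 1 := by
      rw [Real.exp_le_one_iff, neg_nonpos]; positivity
    linarith
  exact (mul_le_of_le_one_right (Finset.prod_nonneg fun _ _ => abs_nonneg _) h1).trans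
    (Finset.prod_le_prod (fun _ _ => abs_nonneg _) fun _ _ => abs_tiltedStep_le_stepBound hc _)

lemma integral_pathWeight {c : ℝ} (hc : 3 / 2 ≤ c) (n : ℕ) (x : ℝ) :
    ((∫ u : Fin n → ℝ, pathWeight c x u : ℝ) : ℂ) =
      (1 / (2 * Real.pi)) * ∫ s : ℝ, symbol c s ^ (n + 1) * exp (-(s * x * I)) := by
  induction n generalizing x with
  | zero =>
    have : ∀ u : Fin 0 → ℝ, pathWeight c x u = tiltedStep c (-x) := fun u => by
      simp [pathWeight]
    simp_rw [this]
    rw [integral_const, measureReal_def, volume_pi, Measure.pi_univ, Finset.prod_of_isEmpty,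
      ENNReal.toReal_one, one_smul, ofReal_tiltedStep]
    congr 2
    funext s
    rw [mul_comm, zero_add, pow_one]
    congr 2
    push_cast
    ring
  | succ n ih =>
    have hp := measurePreserving_cons n
    have hpi := integrable_pathWeight hc (n + 1) x
    have hci := hp.integrable_comp_of_integrable hpi
    have e1 : ∫ u : Fin (n + 1) → ℝ, pathWeight c x u =
        ∫ y, tiltedStep c (y - x) * ∫ v : Fin n → ℝ, pathWeight c y v := by
      have h1 := hp.map_eq.symm ▸ hpi.aestronglyMeasurable
      rw [← hp.map_eq, integral_map hp.measurable.aemeasurable h1]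
      refine (integral_prod _ hci).trans ?_
      congr 1
      funext y
      rw [← integral_const_mul]
      congr 1
      funext v
      exact pathWeight_cons c x y v
    have hki : Integrable fun y => (tiltedStep c (y - x) : ℂ) :=
      ((integrable_tiltedStep hc).comp_sub_right x).ofReal
    have hF : Integrable (Function.uncurry fun y s : ℝ =>
        exp (-(s * y * I)) * ((tiltedStep c (y - x) : ℂ) * symbol c s ^ (n + 1)))
        (volume.prod volume) := by
      refine (hki.mul_prod (integrable_symbol_pow hc n)).bdd_mul (c := 1) ?_
        (Eventually.of_forall fun p => (norm_exp_neg_mul_I _ _).le)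
      exact Continuous.aestronglyMeasurable (by fun_prop)
    rw [e1, ← integral_complex_ofReal]
    calc _ = ∫ y : ℝ, (1 / (2 * Real.pi)) * ∫ s : ℝ,
          exp (-(s * y * I)) * ((tiltedStep c (y - x) : ℂ) * symbol c s ^ (n + 1)) := by
          congr 1
          funext y
          rw [ofReal_mul, ih, mul_left_comm, ← integral_const_mul]
          congr 2
          funext s
          ring
      _ = (1 / (2 * Real.pi)) * ∫ s : ℝ, ∫ y : ℝ,
          exp (-(s * y * I)) * ((tiltedStep c (y - x) : ℂ) * symbol c s ^ (n + 1)) := by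
          rw [integral_const_mul, integral_integral_swap hF]
      _ = _ := by
          congr 2
          funext s
          have h := integral_sub_right_eq_self (μ := volume)
            (fun τ : ℝ => (tiltedStep c τ : ℂ) * exp (-(s * τ * I))) x
          rw [integral_tiltedStep_mul_exp hc s] at h
          rw [pow_succ _ (n + 1), mul_assoc, mul_comm (symbol c s), ← mul_assoc]
          nth_rewrite 3 [← h]
          rw [← integral_const_mul]
          congr 1
          funext y
          have : exp (-(s * y * I)) = exp (-(s * (y - x : ℝ) * I)) * exp (-(s * x * I)) := by
            rw [← Complex.exp_add]; congr 1; push_cast; ring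
          rw [this]
          ring

lemma bridge_eq {c : ℝ} (hc : 3 / 2 ≤ c) (n : ℕ) : bridge c n =
    -2 * ((n : ℝ) + 1) ^ (-(2 : ℝ) / 3) * Ai' (2 * ((n : ℝ) + 1) ^ ((2 : ℝ) / 3) * c) := by
  rw [← ofReal_inj, bridge]
  simp_rw [stepCycle_eq_pathWeight]
  rw [integral_pathWeight hc]
  simp only [ofReal_zero, mul_zero, zero_mul, neg_zero, Complex.exp_zero, mul_one]
  rw [integral_symbol_pow]
  have : (Real.pi : ℂ) ≠ 0 := by exact_mod_cast Real.pi_ne_zero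
  field_simp

lemma hasSum_geometric_three_quarters : HasSum (fun n : ℕ => (3 / 4 : ℝ) ^ n) 4 := by
  have := hasSum_geometric_of_lt_one (r := (3 / 4 : ℝ)) (by norm_num) (by norm_num)
  norm_num at this
  exact this

lemma abs_div_succ_le {x a b : ℝ} {n : ℕ} (hb : 0 ≤ b) (h : |x| ≤ (a * (n + 1) + b) * (3 / 4) ^ n) :
    |x / (n + 1)| ≤ (a + b) * (3 / 4) ^ n := by
  have hn : (0 : ℝ) < n + 1 := by positivity
  rw [abs_div, abs_of_pos hn, div_le_iff₀ hn]
  refine h.trans ?_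
  rw [mul_right_comm, add_mul a b]
  refine mul_le_mul_of_nonneg_right ?_ (by positivity)
  have : b * 1 ≤ b * (n + 1) := mul_le_mul_of_nonneg_left (by simp) hb
  linarith

lemma kappa_term {c : ℝ} (hc : 3 / 2 ≤ c) (n : ℕ) :
    ((n : ℝ) + 1) ^ (-(5 : ℝ) / 3) * Ai' (2 * ((n : ℝ) + 1) ^ ((2 : ℝ) / 3) * c) =
      -(1 / 2) * (bridge c n / (n + 1)) := by
  have hn : (0 : ℝ) < n + 1 := by positivity
  have h : ((n : ℝ) + 1) ^ (-(2 : ℝ) / 3) = ((n : ℝ) + 1) ^ (-(5 : ℝ) / 3) * (n + 1) := by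
    nth_rewrite 3 [← Real.rpow_one ((n : ℝ) + 1)]
    rw [← Real.rpow_add hn]
    norm_num
  rw [bridge_eq hc, h]
  field_simp

lemma abs_bridge_div_le {c : ℝ} (hc : 3 / 2 ≤ c) (n : ℕ) :
    |bridge c n / (n + 1)| ≤ (0 + 1) * (3 / 4) ^ n :=
  abs_div_succ_le zero_le_one ((abs_bridge_le hc n).trans_eq (by ring))

lemma summable_abs_bridge_div {c : ℝ} (hc : 3 / 2 ≤ c) :
    Summable fun n : ℕ => |bridge c n / (n + 1)| :=
  Summable.of_nonneg_of_le (fun _ => abs_nonneg _) (abs_bridge_div_le hc)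
    (hasSum_geometric_three_quarters.summable.mul_left _)

lemma kappa_eq {c : ℝ} (hc : 3 / 2 ≤ c) : kappa c = ∑' n : ℕ, bridge c n / (n + 1) := by
  rw [kappa, tsum_congr (kappa_term hc), tsum_mul_left]
  ring

lemma summable_abs_Tr_div {c : ℝ} (hc : 3 / 2 ≤ c) {L : ℝ} (hL : 0 < L) :
    Summable fun n : ℕ => |Tr n L c / (n + 1)| :=
  Summable.of_nonneg_of_le (fun _ => abs_nonneg _)
    (fun n => abs_div_succ_le hL.le (abs_Tr_le hc hL n))
    (hasSum_geometric_three_quarters.summable.mul_left _)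

/-- Remainder of the trace series after removing the linear term. -/
noncomputable def remainder (c L : ℝ) : ℝ := (∑' n : ℕ, Tr n L c / (n + 1)) - kappa c * L

lemma abs_remainder_sub_le {c : ℝ} (hc : 3 / 2 ≤ c) {L L' : ℝ} (hL : 0 < L) (hLL' : L ≤ L') :
    |remainder c L' - remainder c L| ≤ 12 * Real.exp (-L) := by
  have h1 := (summable_abs_Tr_div hc hL).of_abs
  have h2 := (summable_abs_Tr_div hc (hL.trans_le hLL')).of_abs
  have h3 := (summable_abs_bridge_div hc).of_abs
  have h4 : HasSum (fun n : ℕ => (Tr n L' c - Tr n L c - (L' - L) * bridge c n) / (n + 1))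
      (remainder c L' - remainder c L) := by
    have h := (h2.hasSum.sub h1.hasSum).sub (h3.hasSum.mul_left (L' - L))
    rw [← kappa_eq hc] at h
    have e : remainder c L' - remainder c L = (∑' n : ℕ, Tr n L' c / (n + 1)) -
        (∑' n : ℕ, Tr n L c / (n + 1)) - (L' - L) * kappa c := by
      unfold remainder; ring
    rw [e]
    simp only [sub_div, mul_div_assoc]
    exact h
  have h5 : HasSum (fun n : ℕ => (2 * Real.exp (-L) + Real.exp (-L)) * (3 / 4 : ℝ) ^ n)
      (12 * Real.exp (-L)) := by
    rw [show 12 * Real.exp (-L) = (2 * Real.exp (-L) + Real.exp (-L)) * 4 by ring]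
    exact hasSum_geometric_three_quarters.mul_left _
  rw [← h4.tsum_eq, ← Real.norm_eq_abs]
  exact tsum_of_norm_bounded h5 fun n =>
    abs_div_succ_le (Real.exp_pos _).le (abs_Tr_sub_le hc hL hLL' n)

lemma exists_remainder_limit {c : ℝ} (hc : 3 / 2 ≤ c) :
    ∃ D : ℝ, ∀ L, 0 < L → |remainder c L - D| ≤ 12 * Real.exp (-L) := by
  have h0 : Tendsto (fun n : ℕ => 12 * Real.exp (-((n : ℝ) + 1))) atTop (𝓝 0) := by
    have h := (Real.tendsto_exp_neg_atTop_nhds_zero.comp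
      (tendsto_atTop_add_const_right _ (1 : ℝ) tendsto_natCast_atTop_atTop)).const_mul (12 : ℝ)
    simpa [Function.comp_def] using h
  have hC : CauchySeq fun n : ℕ => remainder c ((n : ℝ) + 1) :=
    cauchySeq_of_le_tendsto_0' _ (fun n m hnm => by
      rw [dist_comm, Real.dist_eq]
      exact abs_remainder_sub_le hc (by positivity) (by gcongr)) h0
  obtain ⟨D, hD⟩ := cauchySeq_tendsto_of_complete hC
  refine ⟨D, fun L hL => ?_⟩
  rw [abs_sub_comm]
  refine le_of_tendsto ((hD.sub_const (remainder c L)).abs) ?_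
  filter_upwards [tendsto_natCast_atTop_atTop.eventually_ge_atTop L] with n hn
  exact abs_remainder_sub_le hc hL (by linarith)

end AiryOnePersistence

/-- For `c ≥ 3/2` the series defining `κ(c)` converges absolutely, and for all large `L`
the series `∑_{n≥1} Tr_n(L,c)/n` converges absolutely and equals
`κ(c)·L + D + O(e^{-L})`. -/
theorem airy1_persistence_exponent (c : ℝ) (hc : 3 / 2 ≤ c) :
    Summable (fun n : ℕ =>
      |((n : ℝ) + 1) ^ (-(5 : ℝ) / 3) * Ai' (2 * ((n : ℝ) + 1) ^ ((2 : ℝ) / 3) * c)|) ∧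
    ∃ D M L₀ : ℝ, 0 < M ∧ 1 ≤ L₀ ∧ ∀ L, L₀ ≤ L →
      Summable (fun n : ℕ => |Tr n L c / ((n : ℝ) + 1)|) ∧
      |(∑' n : ℕ, Tr n L c / ((n : ℝ) + 1)) - kappa c * L - D| ≤ M * Real.exp (-L) := by
  constructor
  · refine ((AiryOnePersistence.summable_abs_bridge_div hc).mul_left (1 / 2)).congr fun n => ?_
    rw [AiryOnePersistence.kappa_term hc, abs_mul]
    norm_num
  · obtain ⟨D, hD⟩ := AiryOnePersistence.exists_remainder_limit hc
    refine ⟨D, 12, 1, by norm_num, le_rfl, fun L hL => ?_⟩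
    have hL0 : 0 < L := one_pos.trans_le hL
    exact ⟨AiryOnePersistence.summable_abs_Tr_div hc hL0, hD L hL0⟩
end

section
/- For every r ≥ 1, the integral ∫_ℝ e^{rx}·|Ai(x)| dx is finite and satisfies ∫_ℝ e^{rx}·|Ai(x)| dx ≤ 2·exp(r³/3). -/
open MeasureTheory

open Filter Topology

/-- The integrand `e^{w³/3 - wx}` of the Airy contour integral. -/
noncomputable def airyKernel (x : ℝ) (w : ℂ) : ℂ :=
  Complex.exp (w ^ 3 / 3 - w * (x : ℂ))

theorem differentiable_airyKernel (x : ℝ) : Differentiable ℂ (airyKernel x) := by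
  unfold airyKernel
  fun_prop

theorem norm_airyKernel (x s t : ℝ) :
    ‖airyKernel x (s + t * Complex.I)‖ =
      Real.exp (s ^ 3 / 3 - s * x) * Real.exp (-s * t ^ 2) := by
  have h : ((s : ℂ) + t * Complex.I) ^ 3 / 3 - (s + t * Complex.I) * (x : ℂ) =
      ((s ^ 3 / 3 - s * x - s * t ^ 2 : ℝ) : ℂ) +
        ((s ^ 2 * t - t ^ 3 / 3 - t * x : ℝ) : ℂ) * Complex.I := by
    push_cast
    linear_combination ((s : ℂ) * t ^ 2 + t ^ 3 * Complex.I / 3) * Complex.I_sq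
  rw [airyKernel, Complex.norm_exp, h, Complex.add_re, Complex.ofReal_re, Complex.re_ofReal_mul,
    Complex.I_re, mul_zero, add_zero, ← Real.exp_add]
  ring_nf

theorem integrable_airyKernel_vertical (x : ℝ) {s : ℝ} (hs : 0 < s) :
    Integrable (fun t : ℝ => airyKernel x (s + t * Complex.I)) := by
  refine ((integrable_exp_neg_mul_sq hs).const_mul (Real.exp (s ^ 3 / 3 - s * x))).mono'
    ?_ (ae_of_all _ fun t => (norm_airyKernel x s t).le)
  have := (differentiable_airyKernel x).continuous
  exact (by fun_prop : Continuous fun t : ℝ => airyKernel x (s + t * Complex.I)).aestronglyMeasurable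

theorem tendsto_integral_airyKernel_horizontal (x : ℝ) {a b : ℝ} (ha : 0 < a) (hb : 0 < b)
    {l : Filter ℝ} {f : ℝ → ℝ} (hf : Tendsto (fun T => f T ^ 2) l atTop) :
    Tendsto (fun T : ℝ => ∫ s in a..b, airyKernel x (s + f T * Complex.I)) l (𝓝 0) := by
  set m := min a b
  set M := max a b
  have hm : 0 < m := lt_min ha hb
  have hbound : Tendsto (fun T : ℝ => Real.exp (M ^ 3 / 3 + M * |x|) *
      Real.exp (-(m * f T ^ 2)) * |b - a|) l (𝓝 0) := by
    have := Real.tendsto_exp_neg_atTop_nhds_zero.comp (hf.const_mul_atTop hm)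
    simpa using (this.const_mul (Real.exp (M ^ 3 / 3 + M * |x|))).mul_const |b - a|
  refine squeeze_zero_norm (fun T => ?_) hbound
  refine intervalIntegral.norm_integral_le_of_norm_le_const fun s hs => ?_
  have hs1 : m < s := hs.1
  have hs2 : s ≤ M := hs.2
  have hs0 : 0 < s := hm.trans hs1
  rw [norm_airyKernel]
  gcongr
  · have h1 : s ^ 3 ≤ M ^ 3 := by gcongr
    have h2 : s * -x ≤ M * |x| :=
      (mul_le_mul_of_nonneg_left (neg_le_abs x) hs0.le).trans (by gcongr)
    linarith
  · have : m * f T ^ 2 ≤ s * f T ^ 2 := by gcongr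
    linarith

theorem integral_airyKernel_vertical_eq (x : ℝ) {a b : ℝ} (ha : 0 < a) (hb : 0 < b) :
    ∫ t : ℝ, airyKernel x (a + t * Complex.I) = ∫ t : ℝ, airyKernel x (b + t * Complex.I) := by
  have hlim {s : ℝ} (hs : 0 < s) := intervalIntegral_tendsto_integral
    (integrable_airyKernel_vertical x hs) tendsto_neg_atTop_atBot tendsto_id
  have hsq : Tendsto (fun T : ℝ => T ^ 2) atTop atTop := tendsto_pow_atTop two_ne_zero
  have hbot := tendsto_integral_airyKernel_horizontal x ha hb (f := fun T => -T)
    (by simpa only [neg_sq] using hsq)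
  have htop := tendsto_integral_airyKernel_horizontal x ha hb (f := fun T => T) hsq
  have hrect (T : ℝ) := Complex.integral_boundary_rect_eq_zero_of_differentiableOn
    (airyKernel x) ⟨a, -T⟩ ⟨b, T⟩ (differentiable_airyKernel x).differentiableOn
  have hsum := ((hbot.sub htop).add ((hlim hb).const_smul Complex.I)).sub
    ((hlim ha).const_smul Complex.I)
  have h0 := tendsto_nhds_unique (hsum.congr hrect) tendsto_const_nhds
  simp only [sub_zero, zero_add, smul_eq_mul, ← mul_sub] at h0
  exact (sub_eq_zero.mp ((mul_eq_zero.mp h0).resolve_left Complex.I_ne_zero)).symm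

theorem abs_Ai_le (x : ℝ) {s : ℝ} (hs : 0 < s) :
    |Ai x| ≤ Real.exp (s ^ 3 / 3 - s * x) / (2 * Real.sqrt (Real.pi * s)) := by
  have hAi : Ai x = 1 / (2 * Real.pi) * (∫ t : ℝ, airyKernel x (s + t * Complex.I)).re := by
    rw [← integral_airyKernel_vertical_eq x one_pos hs]
    have h := Complex.reCLM.integral_comp_comm (integrable_airyKernel_vertical x one_pos)
    simp only [Complex.reCLM_apply] at h
    rw [← h]
    simp [Ai, airyKernel]
  have hnorm : ‖∫ t : ℝ, airyKernel x (s + t * Complex.I)‖ ≤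
      Real.exp (s ^ 3 / 3 - s * x) * Real.sqrt (Real.pi / s) := by
    refine (norm_integral_le_integral_norm _).trans_eq ?_
    simp_rw [norm_airyKernel, integral_const_mul, integral_gaussian]
  have hpi := Real.pi_pos
  rw [hAi, abs_mul, abs_of_pos (by positivity)]
  calc _ ≤ 1 / (2 * Real.pi) * (Real.exp (s ^ 3 / 3 - s * x) * Real.sqrt (Real.pi / s)) := by
        gcongr
        exact (Complex.abs_re_le_norm _).trans hnorm
    _ = _ := by
        rw [Real.sqrt_div hpi.le, Real.sqrt_mul hpi.le]
        have := Real.sqrt_pos.mpr hpi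
        have := Real.sqrt_pos.mpr hs
        field_simp
        exact Real.sq_sqrt hpi.le

theorem measurable_Ai : Measurable Ai := by
  have h : StronglyMeasurable (Function.uncurry fun x t : ℝ =>
      (Complex.exp ((1 + (t : ℂ) * Complex.I) ^ 3 / 3
        - (1 + (t : ℂ) * Complex.I) * (x : ℂ))).re) := by
    refine Continuous.stronglyMeasurable ?_
    unfold Function.uncurry
    fun_prop
  exact h.integral_prod_right.measurable.const_mul _

/-- The estimate for `Ai` obtained from the contour `Re w = r + d`. -/
theorem exp_mul_abs_Ai_le (r x : ℝ) {d : ℝ} (hd : 0 < r + d) :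
    Real.exp (r * x) * |Ai x| ≤ Real.exp (r ^ 3 / 3) *
      (Real.exp (r * d ^ 2 + d ^ 3 / 3) / (2 * Real.sqrt (Real.pi * (r + d)))) *
        Real.exp (-d * (x - r ^ 2)) := by
  calc _ ≤ Real.exp (r * x) * (Real.exp ((r + d) ^ 3 / 3 - (r + d) * x) /
        (2 * Real.sqrt (Real.pi * (r + d)))) := by
        gcongr
        exact abs_Ai_le x hd
    _ = _ := by
        rw [mul_div_assoc', mul_div_assoc', div_mul_eq_mul_div, ← Real.exp_add, ← Real.exp_add,
          ← Real.exp_add]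
        ring_nf

theorem integrableOn_exp_decay_Ioi {d : ℝ} (hd : 0 < d) (c : ℝ) :
    IntegrableOn (fun x : ℝ => Real.exp (-d * (x - c))) (Set.Ioi c) ∧
      ∫ x in Set.Ioi c, Real.exp (-d * (x - c)) = 1 / d := by
  have h (x : ℝ) : Real.exp (-d * (x - c)) = Real.exp (d * c) * Real.exp (-d * x) := by
    rw [← Real.exp_add]; ring_nf
  simp_rw [h]
  refine ⟨(integrableOn_exp_mul_Ioi (neg_neg_of_pos hd) c).const_mul _, ?_⟩
  rw [integral_const_mul, integral_exp_mul_Ioi (neg_neg_of_pos hd), neg_div_neg_eq,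
    mul_div_assoc', ← Real.exp_add]
  simp

theorem integrableOn_exp_decay_Iic {d : ℝ} (hd : 0 < d) (c : ℝ) :
    IntegrableOn (fun x : ℝ => Real.exp (d * (x - c))) (Set.Iic c) ∧
      ∫ x in Set.Iic c, Real.exp (d * (x - c)) = 1 / d := by
  have h (x : ℝ) : Real.exp (d * (x - c)) = Real.exp (-d * c) * Real.exp (d * x) := by
    rw [← Real.exp_add]; ring_nf
  simp_rw [h]
  refine ⟨(integrableOn_exp_mul_Iic hd c).const_mul _, ?_⟩
  rw [integral_const_mul, integral_exp_mul_Iic hd, mul_div_assoc', ← Real.exp_add]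
  simp

theorem exp_airy_right_const_le {p : ℝ} (hp : 1 ≤ p) :
    Real.exp (p ^ 2 * (1 / (2 * p)) ^ 2 + (1 / (2 * p)) ^ 3 / 3) /
      (2 * Real.sqrt (Real.pi * (p ^ 2 + 1 / (2 * p)))) * (1 / (1 / (2 * p))) ≤ 4 / 5 := by
  have hp0 : 0 < p := by linarith
  have hinv : 1 / (2 * p) ≤ 1 / 2 := by gcongr; linarith
  have hexp : Real.exp (p ^ 2 * (1 / (2 * p)) ^ 2 + (1 / (2 * p)) ^ 3 / 3) ≤ 7 / 5 := by
    have h1 : p ^ 2 * (1 / (2 * p)) ^ 2 = 1 / 4 := by field_simp; norm_num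
    have h2 : (1 / (2 * p)) ^ 3 ≤ (1 / 2) ^ 3 := by gcongr
    refine (Real.exp_le_exp.mpr (by linarith : _ ≤ (7 / 24 : ℝ))).trans ?_
    have := Real.exp_bound' (x := 7 / 24) (by norm_num) (by norm_num) (n := 4) (by norm_num)
    norm_num [Finset.sum_range_succ, Nat.factorial] at this
    linarith
  have hsqrt : 7 / 4 * p ≤ Real.sqrt (Real.pi * (p ^ 2 + 1 / (2 * p))) := by
    apply Real.le_sqrt_of_sq_le
    have h : 0 < 1 / (2 * p) := by positivity
    nlinarith [Real.pi_gt_d2, sq_nonneg p, mul_pos Real.pi_pos h]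
  calc _ ≤ (7 / 5) / (2 * (7 / 4 * p)) * (1 / (1 / (2 * p))) := by gcongr
    _ = 4 / 5 := by field_simp

theorem exp_airy_left_const_le {p : ℝ} (hp : 1 ≤ p) :
    Real.exp (p ^ 2 * (-(1 / (2 * p))) ^ 2 + (-(1 / (2 * p))) ^ 3 / 3) /
      (2 * Real.sqrt (Real.pi * (p ^ 2 + -(1 / (2 * p))))) * (1 / (1 / (2 * p))) ≤ 6 / 5 := by
  have hp0 : 0 < p := by linarith
  have hexp : Real.exp (p ^ 2 * (-(1 / (2 * p))) ^ 2 + (-(1 / (2 * p))) ^ 3 / 3) ≤ 3 / 2 := by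
    have h1 : p ^ 2 * (-(1 / (2 * p))) ^ 2 = 1 / 4 := by field_simp; norm_num
    have h2 : 0 < (1 / (2 * p)) ^ 3 := by positivity
    refine (Real.exp_le_exp.mpr (by nlinarith : _ ≤ (1 / 4 : ℝ))).trans ?_
    have := Real.exp_bound' (x := 1 / 4) (by norm_num) (by norm_num) (n := 4) (by norm_num)
    norm_num [Finset.sum_range_succ, Nat.factorial] at this
    linarith
  have hsqrt : 5 / 4 * p ≤ Real.sqrt (Real.pi * (p ^ 2 + -(1 / (2 * p)))) := by
    apply Real.le_sqrt_of_sq_le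
    have h : 1 / (2 * p) ≤ p ^ 2 / 2 := by
      rw [div_le_div_iff₀ (by positivity) (by norm_num)]
      nlinarith [one_le_pow₀ hp (n := 3)]
    nlinarith [Real.pi_gt_d4, sq_nonneg p, Real.pi_pos]
  calc _ ≤ (3 / 2) / (2 * (5 / 4 * p)) * (1 / (1 / (2 * p))) := by gcongr
    _ = 6 / 5 := by field_simp; norm_num

/-- For `r ≥ 1`, `∫_ℝ e^{rx} |Ai(x)| dx` is finite and bounded by `2 e^{r³/3}`. -/
theorem exp_abs_airy_integral (r : ℝ) (hr : 1 ≤ r) :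
    Integrable (fun x : ℝ => Real.exp (r * x) * |Ai x|) ∧
    (∫ x : ℝ, Real.exp (r * x) * |Ai x|) ≤ 2 * Real.exp (r ^ 3 / 3) := by
  obtain ⟨p, hp, rfl⟩ : ∃ p : ℝ, 1 ≤ p ∧ p ^ 2 = r :=
    ⟨Real.sqrt r, Real.one_le_sqrt.mpr hr, Real.sq_sqrt (by linarith)⟩
  have hR := exp_airy_right_const_le hp
  have hL := exp_airy_left_const_le hp
  have hd : 0 < 1 / (2 * p) := by positivity
  have hd1 : 1 / (2 * p) < 1 := by
    rw [div_lt_one (by positivity)]; linarith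
  set d := 1 / (2 * p)
  obtain ⟨hRi, hRv⟩ := integrableOn_exp_decay_Ioi hd ((p ^ 2) ^ 2)
  obtain ⟨hLi, hLv⟩ := integrableOn_exp_decay_Iic hd ((p ^ 2) ^ 2)
  have hmeas : Measurable (fun x : ℝ => Real.exp (p ^ 2 * x) * |Ai x|) :=
    (by fun_prop : Measurable fun x : ℝ => Real.exp (p ^ 2 * x)).mul measurable_Ai.abs
  have hnorm (x : ℝ) : ‖Real.exp (p ^ 2 * x) * |Ai x|‖ = Real.exp (p ^ 2 * x) * |Ai x| :=
    Real.norm_of_nonneg (by positivity)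
  have hbR (x : ℝ) := exp_mul_abs_Ai_le (p ^ 2) x (d := d) (by linarith)
  have hbL (x : ℝ) := exp_mul_abs_Ai_le (p ^ 2) x (d := -d) (by linarith)
  simp only [neg_neg] at hbL
  have hRi := hRi.const_mul (Real.exp ((p ^ 2) ^ 3 / 3) *
    (Real.exp (p ^ 2 * d ^ 2 + d ^ 3 / 3) / (2 * Real.sqrt (Real.pi * (p ^ 2 + d)))))
  have hLi := hLi.const_mul (Real.exp ((p ^ 2) ^ 3 / 3) *
    (Real.exp (p ^ 2 * (-d) ^ 2 + (-d) ^ 3 / 3) / (2 * Real.sqrt (Real.pi * (p ^ 2 + -d)))))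
  have hR' := hRi.mono' hmeas.aestronglyMeasurable
    (ae_of_all _ fun x => (hnorm x).trans_le (hbR x))
  have hL' := hLi.mono' hmeas.aestronglyMeasurable
    (ae_of_all _ fun x => (hnorm x).trans_le (hbL x))
  have hintegrable : Integrable (fun x : ℝ => Real.exp (p ^ 2 * x) * |Ai x|) := by
    rw [← integrableOn_univ, ← Set.Iic_union_Ioi (a := (p ^ 2) ^ 2)]
    exact IntegrableOn.union hL' hR'
  refine ⟨hintegrable, ?_⟩
  have hIR := integral_mono hR' hRi hbR
  have hIL := integral_mono hL' hLi hbL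
  rw [integral_const_mul, hRv, mul_assoc] at hIR
  rw [integral_const_mul, hLv, mul_assoc] at hIL
  rw [← intervalIntegral.integral_Iic_add_Ioi hL' hR']
  have hE := Real.exp_pos ((p ^ 2) ^ 3 / 3)
  linarith [mul_le_mul_of_nonneg_left hR hE.le, mul_le_mul_of_nonneg_left hL hE.le]
end
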